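/- arXiv:1009.3461 — 5 statements merged into one kernel-verified Lean document; each statement's English description precedes it below -/
import Mathlib

section
/- Let X be a non-separable complex Banach space with the property that every bounded linear operator on X has the form w·I + S for some w ∈ ℂ, where S is strictly singular and has separable range, and let Y = X ⊕ X. Then for every bounded linear operator T on Y and every non-zero vector (x,y) ∈ Y, the J-set J_T((x,y)) has empty interior. -/
open Filter Topology

/-- The J-set of `x` under the operator `T`. -/
def JSet {𝕜 X : Type*} [NontriviallyNormedField 𝕜] [NormedAddCommGroup X] [NormedSpace 𝕜 X]
    (T : X →L[𝕜] X) (x : X) : Set X :=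
  {y | ∃ k : ℕ → ℕ, StrictMono k ∧ ∃ u : ℕ → X,
    Tendsto u atTop (𝓝 x) ∧ Tendsto (fun n => (T ^ k n) (u n)) atTop (𝓝 y)}

/-- A bounded operator is strictly singular if it is bounded below by no positive constant
on any infinite-dimensional subspace. -/
def StrictlySingular {𝕜 X : Type*} [NontriviallyNormedField 𝕜] [NormedAddCommGroup X]
    [NormedSpace 𝕜 X] (S : X →L[𝕜] X) : Prop :=
  ∀ M : Submodule 𝕜 X, ¬ FiniteDimensional 𝕜 M →
    ¬ ∃ c : ℝ, 0 < c ∧ ∀ x ∈ M, c * ‖x‖ ≤ ‖S x‖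

/-- A functional vanishing on a proper closed subspace. -/
lemma exists_functional_vanishing {E : Type*} [NormedAddCommGroup E] [NormedSpace ℂ E]
    (Z : Submodule ℂ E) (hZ : IsClosed (Z : Set E)) (x : E) (hx : x ∉ Z) :
    ∃ f : E →L[ℂ] ℂ, f x ≠ 0 ∧ ∀ z ∈ Z, f z = 0 := by
  obtain ⟨f, u, h1, h2⟩ := RCLike.geometric_hahn_banach_point_closed (𝕜 := ℂ) (x := x)
    (t := (Z : Set E)) (Z.restrictScalars ℝ).convex hZ hx
  have h0 := h2 0 Z.zero_mem
  simp at h0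
  refine ⟨f, ?_, ?_⟩
  · intro h
    rw [h] at h1
    simp at h1
    linarith
  · intro z hz
    by_contra hne
    have := h2 (((u : ℂ) / f z) • z) (Z.smul_mem _ hz)
    rw [map_smul, smul_eq_mul, div_mul_cancel₀ _ hne] at this
    simp at this

/-- Eigenfunctionals with eigenvalue in the closed disc prevent interior of J-sets. -/
lemma interior_JSet_of_eigenfunctional {E : Type*} [NormedAddCommGroup E] [NormedSpace ℂ E]
    (T : E →L[ℂ] E) (f : E →L[ℂ] ℂ) (hf : f ≠ 0) (l : ℂ) (hl : ‖l‖ ≤ 1)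
    (h : ∀ x, f (T x) = l * f x) (p : E) : interior (JSet T p) = ∅ := by
  have hpow : ∀ n x, f ((T ^ n) x) = l ^ n * f x := by
    intro n
    induction n with
    | zero => intro x; simp
    | succ n ih => intro x; rw [pow_succ', mul_apply_eq_comp, h, ih, pow_succ]; ring
  -- on the J-set, the functional has norm zero or a fixed one
  have key : ∀ y ∈ JSet T p, ‖f y‖ = 0 ∨ ‖f y‖ = ‖f p‖ := by
    rintro y ⟨k, hk, u, hu, hy⟩
    have h1 : Tendsto (fun n => ‖l‖ ^ k n * ‖f (u n)‖) atTop (𝓝 ‖f y‖) := by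
      have := ((f.continuous.tendsto y).comp hy).norm
      refine this.congr fun n => ?_
      rw [Function.comp_apply, hpow, norm_mul, norm_pow]
    have h2 : Tendsto (fun n => ‖f (u n)‖) atTop (𝓝 ‖f p‖) :=
      ((f.continuous.tendsto p).comp hu).norm
    rcases hl.lt_or_eq with hl | hl
    · left
      have h3 := ((tendsto_pow_atTop_nhds_zero_of_lt_one (norm_nonneg l) hl).comp
        hk.tendsto_atTop).mul h2
      rw [zero_mul] at h3
      exact tendsto_nhds_unique h1 h3
    · right
      simp only [hl, one_pow, one_mul] at h1
      exact tendsto_nhds_unique h1 h2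
  obtain ⟨v, hv⟩ : ∃ v, f v ≠ 0 := by
    by_contra! hc
    exact hf (by ext x; simp [hc x])
  rw [Set.eq_empty_iff_forall_notMem]
  intro y hy
  have hcont : Tendsto (fun r : ℝ => y + (r : ℂ) • (f v)⁻¹ • v) (𝓝 0) (𝓝 y) := by
    have : Continuous (fun r : ℝ => y + (r : ℂ) • (f v)⁻¹ • v) := by fun_prop
    simpa using this.tendsto 0
  have hev := hcont.eventually (mem_interior_iff_mem_nhds.1 hy)
  have hfv : ∀ r : ℝ, f (y + (r : ℂ) • (f v)⁻¹ • v) = f y + r := by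
    intro r; simp [hv]
  -- only finitely many r are possible
  have hbad : {r : ℝ | ‖f y + r‖ = 0 ∨ ‖f y + r‖ = ‖f p‖}.Finite := by
    have : {r : ℝ | ‖f y + r‖ = 0 ∨ ‖f y + r‖ = ‖f p‖} ⊆
        ({-(f y).re} : Set ℝ) ∪
        ({-(f y).re + Real.sqrt (‖f p‖ ^ 2 - (f y).im ^ 2),
          -(f y).re - Real.sqrt (‖f p‖ ^ 2 - (f y).im ^ 2)} : Set ℝ) := by
      rintro r (hr | hr)
      · left
        rw [norm_eq_zero] at hr
        have := congrArg Complex.re hr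
        simp at this
        simp; linarith
      · right
        have h1 : ((f y).re + r) ^ 2 + (f y).im ^ 2 = ‖f p‖ ^ 2 := by
          rw [← hr, Complex.sq_norm, Complex.normSq_apply]; simp; ring
        have h2 : ‖f p‖ ^ 2 - (f y).im ^ 2 = ((f y).re + r) ^ 2 := by linarith
        rw [h2, Real.sqrt_sq_eq_abs]
        rcases abs_cases ((f y).re + r) with ⟨h, _⟩ | ⟨h, _⟩ <;> rw [h] <;> simp
    exact Set.Finite.subset (by simp) this
  have : {r : ℝ | ‖f y + r‖ = 0 ∨ ‖f y + r‖ = ‖f p‖} ∈ 𝓝 (0 : ℝ) := by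
    filter_upwards [hev] with r hr
    have := key _ hr
    rwa [hfv] at this
  exact (infinite_of_mem_nhds (0:ℝ) this) hbad

/-- An operator all of whose spectrum is outside the closed unit disc. -/
lemma JSet_of_spectrum {E : Type*} [NormedAddCommGroup E] [NormedSpace ℂ E] [CompleteSpace E]
    (T : E →L[ℂ] E) (h : ∀ l : ℂ, ‖l‖ ≤ 1 → IsUnit (T - l • ContinuousLinearMap.id ℂ E))
    (p y : E) (hy : y ∈ JSet T p) : p = 0 := by
  by_contra hp
  have : Nontrivial E := ⟨p, 0, hp⟩
  obtain ⟨U, hU⟩ : IsUnit T := by simpa using h 0 (by simp)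
  set R : E →L[ℂ] E := ↑U⁻¹ with hR
  have hsp : spectralRadius ℂ R < (1 : NNReal) := by
    apply spectrum.spectralRadius_lt_of_forall_lt
    intro z hz
    have hz' : z⁻¹ ∈ spectrum ℂ T := by
      rw [← hU]; exact spectrum.inv₀_mem_iff.2 hz
    have h1 : 1 < ‖z⁻¹‖ := by
      by_contra! hc
      have h2 := h _ hc
      rw [spectrum.mem_iff] at hz'
      apply hz'
      have h3 := h2.neg
      rw [neg_sub] at h3
      simpa [Algebra.algebraMap_eq_smul_one] using! h3
    rw [norm_inv] at h1
    have h0 : 0 < ‖z‖ := by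
      by_contra! hc
      have : ‖z‖ = 0 := le_antisymm hc (norm_nonneg _)
      rw [this] at h1; simp at h1; linarith
    have : ‖z‖ < 1 := by
      by_contra! hc
      exact absurd (inv_le_one_of_one_le₀ hc) (not_le.2 h1)
    exact_mod_cast this
  have hRn : Tendsto (fun n : ℕ => ‖R ^ n‖) atTop (𝓝 0) := by
    obtain ⟨r, hr1, hr2⟩ := ENNReal.lt_iff_exists_nnreal_btwn.1 hsp
    have hg := spectrum.pow_nnnorm_pow_one_div_tendsto_nhds_spectralRadius R
    have hr2' : (r : ℝ) < 1 := by exact_mod_cast hr2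
    refine squeeze_zero' (Eventually.of_forall fun _ => norm_nonneg _) ?_
      (tendsto_pow_atTop_nhds_zero_of_lt_one r.2 hr2')
    filter_upwards [hg.eventually (gt_mem_nhds hr1), eventually_gt_atTop 0] with n hn hn0
    have h1 : (‖R ^ n‖₊ : ENNReal) ≤ (r : ENNReal) ^ n := by
      have h2 := ENNReal.rpow_le_rpow hn.le (z := (n : ℝ)) (by positivity)
      rw [← ENNReal.rpow_mul, one_div, inv_mul_cancel₀ (by positivity), ENNReal.rpow_one,
        ENNReal.rpow_natCast] at h2
      exact h2
    exact_mod_cast h1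
  obtain ⟨k, hk, u, hu, hy⟩ := hy
  have hinv : ∀ n x, (R ^ n) ((T ^ n) x) = x := by
    intro n x
    rw [← mul_apply_eq_comp, ← hU, hR, ← Units.val_pow_eq_pow_val,
      ← Units.val_pow_eq_pow_val, ← Units.val_mul]
    simp
  have h0 : Tendsto u atTop (𝓝 0) := by
    rw [tendsto_zero_iff_norm_tendsto_zero]
    have h1 := (hRn.comp hk.tendsto_atTop).mul hy.norm
    rw [zero_mul] at h1
    refine squeeze_zero (fun _ => norm_nonneg _) (fun n => ?_) h1
    calc ‖u n‖ = ‖(R ^ k n) ((T ^ k n) (u n))‖ := by rw [hinv]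
      _ ≤ _ := (R ^ k n).le_opNorm _
  exact hp (tendsto_nhds_unique hu h0)

/-- Upper semi-Fredholm: bounded below on a finite intersection of kernels of functionals. -/
def USF {E F : Type*} [NormedAddCommGroup E] [NormedSpace ℂ E] [NormedAddCommGroup F]
    [NormedSpace ℂ F] (A : E →L[ℂ] F) : Prop :=
  ∃ s : Finset (E →L[ℂ] ℂ), ∃ c : ℝ, 0 < c ∧ ∀ x, (∀ f ∈ s, f x = 0) → c * ‖x‖ ≤ ‖A x‖

/-- The operator is small on suitable infinite-dimensional subspaces of each
infinite-dimensional subspace. -/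
def SmallOn {E F : Type*} [NormedAddCommGroup E] [NormedSpace ℂ E] [NormedAddCommGroup F]
    [NormedSpace ℂ F] (A : E →L[ℂ] F) : Prop :=
  ∀ M : Submodule ℂ E, ¬ FiniteDimensional ℂ M → ∀ ε : ℝ, 0 < ε →
    ∃ M' : Submodule ℂ E, M' ≤ M ∧ ¬ FiniteDimensional ℂ M' ∧ ∀ x ∈ M', ‖A x‖ ≤ ε * ‖x‖

lemma exists_small_subspace {E F : Type*} [NormedAddCommGroup E] [NormedSpace ℂ E]
    [NormedAddCommGroup F] [NormedSpace ℂ F] (A : E →L[ℂ] F) (M : Submodule ℂ E)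
    (H : ∀ s : Finset (E →L[ℂ] ℂ), ∀ c : ℝ, 0 < c →
      ∃ x ∈ M, (∀ f ∈ s, f x = 0) ∧ ‖A x‖ < c * ‖x‖) (ε : ℝ) (hε : 0 < ε) :
    ∃ M' : Submodule ℂ E, M' ≤ M ∧ ¬ FiniteDimensional ℂ M' ∧ ∀ x ∈ M', ‖A x‖ ≤ ε * ‖x‖ := by
  classical
  obtain ⟨g, hg1, hg2⟩ := exists_seq_of_forall_finset_exists
    (α := E × (E →L[ℂ] ℂ) × ℕ)
    (fun a => a.1 ∈ M ∧ ‖a.1‖ = 1 ∧ ‖a.2.1‖ ≤ 1 ∧ a.2.1 a.1 = 1 ∧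
      ‖A a.1‖ ≤ ε * (1 / 4) ^ (a.2.2 + 1))
    (fun a b => a.2.2 < b.2.2 ∧ a.2.1 b.1 = 0) (by
      intro s _
      set K := s.sup (fun a => a.2.2) + 1 with hK
      obtain ⟨x, hxM, hx0, hxA⟩ := H (s.image fun a => a.2.1) (ε * (1 / 4) ^ (K + 1)) (by positivity)
      have hx : ‖x‖ ≠ 0 := by
        intro h
        rw [h, mul_zero] at hxA
        exact absurd hxA (not_lt.2 (norm_nonneg _))
      have hxp : 0 < ‖x‖ := lt_of_le_of_ne (norm_nonneg _) hx.symm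
      obtain ⟨f, hf1, hf2⟩ := exists_dual_vector ℂ x hx
      have hxc : (‖x‖ : ℂ) ≠ 0 := by exact_mod_cast hx
      refine ⟨⟨((‖x‖ : ℂ)⁻¹) • x, f, K⟩, ⟨M.smul_mem _ hxM, ?_, hf1.le, ?_, ?_⟩, ?_⟩
      · simp [norm_smul, hx]
      · rw [map_smul, hf2, smul_eq_mul]; exact inv_mul_cancel₀ hxc
      · simp only [map_smul, norm_smul, norm_inv, Complex.norm_real, norm_norm]
        rw [inv_mul_le_iff₀ hxp]
        linarith
      · intro a ha
        refine ⟨?_, ?_⟩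
        · have := Finset.le_sup (f := fun a : E × (E →L[ℂ] ℂ) × ℕ => a.2.2) ha
          simp only [hK]; omega
        · have := hx0 a.2.1 (Finset.mem_image_of_mem _ ha)
          simp [this])
  set x : ℕ → E := fun n => (g n).1 with hx
  set f : ℕ → (E →L[ℂ] ℂ) := fun n => (g n).2.1 with hf
  have hmono : StrictMono (fun n => (g n).2.2) := fun m n h => (hg2 m n h).1
  have hAx : ∀ n, ‖A (x n)‖ ≤ ε * (1 / 4) ^ (n + 1) := by
    intro n
    refine (hg1 n).2.2.2.2.trans ?_
    have : n ≤ (g n).2.2 := hmono.id_le n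
    gcongr ε * ?_
    exact pow_le_pow_of_le_one (by norm_num) (by norm_num) (by omega)
  have hx1 : ∀ n, ‖x n‖ = 1 := fun n => (hg1 n).2.1
  have hf1 : ∀ n, ‖f n‖ ≤ 1 := fun n => (hg1 n).2.2.1
  have hfx : ∀ n, f n (x n) = 1 := fun n => (hg1 n).2.2.2.1
  have hfx0 : ∀ m n, m < n → f m (x n) = 0 := fun m n h => (hg2 m n h).2
  -- coefficient bound
  have hcoef : ∀ (c : ℕ →₀ ℂ) (n : ℕ), ‖c n‖ ≤ 2 ^ n * ‖Finsupp.linearCombination ℂ x c‖ := by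
    intro c n
    set v := Finsupp.linearCombination ℂ x c with hv
    induction n using Nat.strong_induction_on with
    | _ n ih =>
      obtain ⟨N, hN, hnN⟩ : ∃ N, c.support ⊆ Finset.range N ∧ n < N := by
        refine ⟨max (c.support.sup id + 1) (n + 1), ?_, by omega⟩
        intro i hi
        have := Finset.le_sup (f := id) hi
        simp only [id] at this
        rw [Finset.mem_range]; omega
      have hvsum : v = ∑ i ∈ Finset.range N, c i • x i := by
        rw [hv, Finsupp.linearCombination_apply]
        exact Finsupp.sum_of_support_subset _ hN _ (by simp)
      have hfv : f n v = ∑ i ∈ Finset.range n, c i * f n (x i) + c n := by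
        rw [hvsum, map_sum]
        have h1 : Finset.range (n + 1) ⊆ Finset.range N := by
          intro i; simp only [Finset.mem_range]; omega
        rw [← Finset.sum_subset h1, Finset.sum_range_succ]
        · simp [hfx]
        · intro i _ hi
          rw [map_smul, hfx0 n i (by simpa using hi)]; simp
      have hcn : c n = f n v - ∑ i ∈ Finset.range n, c i * f n (x i) := by rw [hfv]; ring
      have hfle : ∀ w, ‖f n w‖ ≤ ‖w‖ := fun w => by
        simpa using (f n).le_of_opNorm_le (hf1 n) w
      have hgeom : ∑ i ∈ Finset.range n, (2 : ℝ) ^ i = 2 ^ n - 1 := by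
        rw [geom_sum_eq (by norm_num)]; norm_num
      calc ‖c n‖ ≤ ‖f n v‖ + ‖∑ i ∈ Finset.range n, c i * f n (x i)‖ := by
            rw [hcn]; exact norm_sub_le _ _
        _ ≤ ‖v‖ + ∑ i ∈ Finset.range n, 2 ^ i * ‖v‖ := by
            gcongr
            · exact hfle v
            · refine norm_sum_le_of_le _ fun i hi => ?_
              rw [norm_mul]
              have h1 := ih i (Finset.mem_range.1 hi)
              have h2 := hfle (x i)
              rw [hx1] at h2
              calc ‖c i‖ * ‖f n (x i)‖ ≤ ‖c i‖ * 1 := by gcongr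
                _ ≤ _ := by rw [mul_one]; exact h1
        _ = 2 ^ n * ‖v‖ := by rw [← Finset.sum_mul, hgeom]; ring
  have hli : LinearIndependent ℂ x := by
    rw [linearIndependent_iff]
    intro c hc
    ext n
    have := hcoef c n
    rw [hc] at this
    simpa using this
  refine ⟨Submodule.span ℂ (Set.range x), ?_, ?_, ?_⟩
  · rw [Submodule.span_le]
    rintro _ ⟨n, rfl⟩
    exact (hg1 n).1
  · intro hfin
    have h2 := (linearIndependent_span hli)
    have := h2.finite
    exact not_finite ℕ
  · intro v hv
    rw [Finsupp.mem_span_range_iff_exists_finsupp] at hv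
    obtain ⟨c, rfl⟩ := hv
    have hco := hcoef c
    rw [Finsupp.linearCombination_apply] at hco
    set v := c.sum fun i a => a • x i with hv
    obtain ⟨N, hN⟩ : ∃ N, c.support ⊆ Finset.range N := by
      refine ⟨c.support.sup id + 1, ?_⟩
      intro i hi
      have := Finset.le_sup (f := id) hi
      simp only [id] at this
      rw [Finset.mem_range]; omega
    have hvsum : v = ∑ i ∈ Finset.range N, c i • x i :=
      Finsupp.sum_of_support_subset _ hN _ (by simp)
    have hgeom : ∑ i ∈ Finset.range N, ((1 : ℝ) / 2) ^ i ≤ 2 := by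
      rw [geom_sum_eq (by norm_num)]
      have : (0 : ℝ) ≤ (1 / 2) ^ N := by positivity
      have h3 : (((1 : ℝ) / 2) ^ N - 1) / (1 / 2 - 1) = 2 - 2 * (1 / 2) ^ N := by ring
      rw [h3]; linarith
    calc ‖A v‖ ≤ ∑ i ∈ Finset.range N, (ε * ‖v‖ / 4) * (1 / 2) ^ i := by
          conv_lhs => rw [hvsum, map_sum]
          refine norm_sum_le_of_le _ fun i _ => ?_
          rw [map_smul, norm_smul]
          calc ‖c i‖ * ‖A (x i)‖ ≤ (2 ^ i * ‖v‖) * (ε * (1 / 4) ^ (i + 1)) := by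
                gcongr
                · exact hco i
                · exact hAx i
            _ = (ε * ‖v‖ / 4) * (2 ^ i * (1 / 4) ^ i) := by ring
            _ = _ := by rw [← mul_pow]; norm_num
      _ ≤ (ε * ‖v‖ / 4) * 2 := by
          rw [← Finset.mul_sum]; gcongr
      _ ≤ ε * ‖v‖ := by
          have : 0 ≤ ε * ‖v‖ := by positivity
          linarith

lemma inf_dim_inter {E : Type*} [NormedAddCommGroup E] [NormedSpace ℂ E]
    (M : Submodule ℂ E) (hM : ¬ FiniteDimensional ℂ M) (s : Finset (E →L[ℂ] ℂ)) :
    ¬ FiniteDimensional ℂ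
      (M ⊓ LinearMap.ker (LinearMap.pi (fun f : s => (f.1 : E →ₗ[ℂ] ℂ))) : Submodule ℂ E) := by
  intro h
  apply hM
  set Φ := LinearMap.pi (fun f : s => (f.1 : E →ₗ[ℂ] ℂ)) with hΦ
  have h1 : (M.map Φ).FG := IsNoetherian.noetherian _
  have h2 : (M ⊓ LinearMap.ker Φ).FG := Module.Finite.iff_fg.1 h
  exact Module.Finite.iff_fg.2 (Submodule.fg_of_fg_map_of_fg_inf_ker Φ h1 h2)

lemma smallOn_of_SS {E F : Type*} [NormedAddCommGroup E] [NormedSpace ℂ E]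
    [NormedAddCommGroup F] [NormedSpace ℂ F] (S : E →L[ℂ] F)
    (hS : ∀ M : Submodule ℂ E, ¬ FiniteDimensional ℂ M →
      ¬ ∃ c : ℝ, 0 < c ∧ ∀ x ∈ M, c * ‖x‖ ≤ ‖S x‖) : SmallOn S := by
  intro M hM ε hε
  refine exists_small_subspace S M ?_ ε hε
  intro s c hc
  have h := hS _ (inf_dim_inter M hM s)
  push Not at h
  obtain ⟨x, hx, hlt⟩ := h c hc
  refine ⟨x, hx.1, ?_, hlt⟩
  intro f hf
  have := hx.2
  exact congrFun (LinearMap.mem_ker.1 this) ⟨f, hf⟩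

lemma smallOn_comp {X E : Type*} [NormedAddCommGroup E] [NormedSpace ℂ E]
    [NormedAddCommGroup X] [NormedSpace ℂ X] (S : X →L[ℂ] X) (hS : StrictlySingular S)
    (B : E →L[ℂ] X) : SmallOn (S.comp B) := by
  apply smallOn_of_SS
  rintro M hM ⟨c, hc, h⟩
  refine hS (M.map (B : E →ₗ[ℂ] X)) ?_ ⟨c / (‖B‖ + 1), by positivity, ?_⟩
  · intro hfin
    apply hM
    let j : M →ₗ[ℂ] (M.map (B : E →ₗ[ℂ] X)) := (B : E →ₗ[ℂ] X).submoduleMap M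
    refine FiniteDimensional.of_injective j ?_
    rw [← LinearMap.ker_eq_bot, LinearMap.ker_eq_bot']
    intro m hm
    have h1 : B m.1 = 0 := congrArg Subtype.val hm
    have h2 := h m.1 m.2
    simp only [ContinuousLinearMap.comp_apply, h1, map_zero, norm_zero] at h2
    have h3 : ‖m.1‖ ≤ 0 := by
      by_contra! hc'
      have := mul_pos hc hc'
      linarith
    exact Subtype.ext (norm_le_zero_iff.1 h3)
  · rintro _ ⟨m, hm, rfl⟩
    have h2 := h m hm
    have h3 := B.le_opNorm m
    simp only [ContinuousLinearMap.comp_apply] at h2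
    refine le_trans ?_ h2
    rw [div_mul_eq_mul_div, div_le_iff₀ (by positivity)]
    have : ‖B m‖ ≤ (‖B‖ + 1) * ‖m‖ := by nlinarith [norm_nonneg m]
    calc c * ‖B m‖ ≤ c * ((‖B‖ + 1) * ‖m‖) := by gcongr
      _ = _ := by ring

lemma SmallOn.comp_left {E F G : Type*} [NormedAddCommGroup E] [NormedSpace ℂ E]
    [NormedAddCommGroup F] [NormedSpace ℂ F] [NormedAddCommGroup G] [NormedSpace ℂ G]
    {S : E →L[ℂ] F} (hS : SmallOn S) (B : F →L[ℂ] G) : SmallOn (B.comp S) := by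
  intro M hM ε hε
  obtain ⟨M', h1, h2, h3⟩ := hS M hM (ε / (‖B‖ + 1)) (by positivity)
  refine ⟨M', h1, h2, fun x hx => ?_⟩
  have h4 := h3 x hx
  have h5 := B.le_opNorm (S x)
  rw [div_mul_eq_mul_div, le_div_iff₀ (by positivity)] at h4
  simp only [ContinuousLinearMap.comp_apply]
  nlinarith [norm_nonneg (S x)]

lemma SmallOn.add {E F : Type*} [NormedAddCommGroup E] [NormedSpace ℂ E]
    [NormedAddCommGroup F] [NormedSpace ℂ F]
    {S R : E →L[ℂ] F} (hS : SmallOn S) (hR : SmallOn R) : SmallOn (S + R) := by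
  intro M hM ε hε
  obtain ⟨M', h1, h2, h3⟩ := hS M hM (ε / 2) (by positivity)
  obtain ⟨M'', h4, h5, h6⟩ := hR M' h2 (ε / 2) (by positivity)
  refine ⟨M'', h4.trans h1, h5, fun x hx => ?_⟩
  have := h3 x (h4 hx)
  have := h6 x hx
  have := norm_add_le (S x) (R x)
  simp only [_root_.add_apply]
  linarith

lemma SmallOn.smul {E F : Type*} [NormedAddCommGroup E] [NormedSpace ℂ E]
    [NormedAddCommGroup F] [NormedSpace ℂ F]
    {S : E →L[ℂ] F} (hS : SmallOn S) (t : ℂ) : SmallOn (t • S) := by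
  have h := hS.comp_left (t • ContinuousLinearMap.id ℂ F)
  have e : (t • ContinuousLinearMap.id ℂ F).comp S = t • S := by ext x; simp
  rwa [e] at h

lemma usf_of_small {E : Type*} [NormedAddCommGroup E] [NormedSpace ℂ E] [CompleteSpace E]
    (V S : E →L[ℂ] E) (hV : IsUnit V) (hS : SmallOn S) : USF (V + S) := by
  by_contra hU
  unfold USF at hU
  push Not at hU
  obtain ⟨U, rfl⟩ := hV
  set R : E →L[ℂ] E := ↑U⁻¹
  have hR : ∀ x, ‖x‖ ≤ ‖R‖ * ‖(U : E →L[ℂ] E) x‖ := by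
    intro x
    have : R ((U : E →L[ℂ] E) x) = x := by
      rw [← mul_apply_eq_comp]; simp [R]
    conv_lhs => rw [← this]
    exact R.le_opNorm _
  set ε : ℝ := 1 / (4 * (‖R‖ + 1)) with hε
  have hε0 : 0 < ε := by positivity
  -- the ambient space must be infinite dimensional
  obtain ⟨M, -, hM, h1⟩ := exists_small_subspace (U + S : E →L[ℂ] E) ⊤ (by
    intro s c hc
    obtain ⟨x, hx⟩ := hU s c hc
    exact ⟨x, trivial, hx⟩) ε hε0
  obtain ⟨M', h2, hM', h3⟩ := hS M hM ε hε0
  apply hM'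
  have : M' = ⊥ := by
    rw [Submodule.eq_bot_iff]
    intro x hx
    have a1 := h1 x (h2 hx)
    have a2 := h3 x hx
    have a3 := hR x
    have a4 : ‖(U : E →L[ℂ] E) x‖ ≤ ‖(U + S : E →L[ℂ] E) x‖ + ‖S x‖ := by
      have := norm_sub_le ((U + S : E →L[ℂ] E) x) (S x)
      simpa using this
    have a5 : ‖x‖ ≤ (‖R‖ + 1) * (2 * (ε * ‖x‖)) := by
      refine a3.trans ?_
      gcongr
      · linarith
      · linarith
    have a6 : (‖R‖ + 1) * (2 * (ε * ‖x‖)) = ‖x‖ / 2 := by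
      rw [hε]; field_simp; norm_num
    rw [a6] at a5
    have := norm_nonneg x
    exact norm_le_zero_iff.1 (by linarith)
  rw [this]
  infer_instance

/-- Finite-rank perturbations of invertible operators. -/
def Phi0 {E : Type*} [NormedAddCommGroup E] [NormedSpace ℂ E] (A : E →L[ℂ] E) : Prop :=
  ∃ F : E →L[ℂ] E, FiniteDimensional ℂ (LinearMap.range (F : E →ₗ[ℂ] E)) ∧ IsUnit (A + F)

lemma finrank_range_add {E : Type*} [NormedAddCommGroup E] [NormedSpace ℂ E] (F G : E →L[ℂ] E)
    (hF : FiniteDimensional ℂ (LinearMap.range (F : E →ₗ[ℂ] E)))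
    (hG : FiniteDimensional ℂ (LinearMap.range (G : E →ₗ[ℂ] E))) :
    FiniteDimensional ℂ (LinearMap.range ((F + G : E →L[ℂ] E) : E →ₗ[ℂ] E)) := by
  refine Submodule.finiteDimensional_of_le
    (S₂ := LinearMap.range (F : E →ₗ[ℂ] E) ⊔ LinearMap.range (G : E →ₗ[ℂ] E)) ?_
  rintro _ ⟨x, rfl⟩
  exact Submodule.add_mem_sup ⟨x, rfl⟩ ⟨x, rfl⟩

lemma finrank_range_neg {E : Type*} [NormedAddCommGroup E] [NormedSpace ℂ E] (F : E →L[ℂ] E)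
    (hF : FiniteDimensional ℂ (LinearMap.range (F : E →ₗ[ℂ] E))) :
    FiniteDimensional ℂ (LinearMap.range ((-F : E →L[ℂ] E) : E →ₗ[ℂ] E)) := by
  refine Submodule.finiteDimensional_of_le (S₂ := LinearMap.range (F : E →ₗ[ℂ] E)) ?_
  rintro _ ⟨x, rfl⟩
  exact ⟨-x, by simp⟩

lemma finrank_range_comp {E : Type*} [NormedAddCommGroup E] [NormedSpace ℂ E] (R F : E →L[ℂ] E)
    (hF : FiniteDimensional ℂ (LinearMap.range (F : E →ₗ[ℂ] E))) :
    FiniteDimensional ℂ (LinearMap.range ((R * F : E →L[ℂ] E) : E →ₗ[ℂ] E)) := by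
  refine Submodule.finiteDimensional_of_le
    (S₂ := (LinearMap.range (F : E →ₗ[ℂ] E)).map (R : E →ₗ[ℂ] E)) ?_
  rintro _ ⟨x, rfl⟩
  exact ⟨F x, ⟨x, rfl⟩, rfl⟩

lemma Phi0.add_fin {E : Type*} [NormedAddCommGroup E] [NormedSpace ℂ E] {A : E →L[ℂ] E}
    (hA : Phi0 A) (G : E →L[ℂ] E)
    (hG : FiniteDimensional ℂ (LinearMap.range (G : E →ₗ[ℂ] E))) : Phi0 (A + G) := by
  obtain ⟨F, hF, hU⟩ := hA
  refine ⟨F + -G, finrank_range_add _ _ hF (finrank_range_neg _ hG), ?_⟩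
  convert hU using 1
  abel

lemma one_sub_fin {E : Type*} [NormedAddCommGroup E] [NormedSpace ℂ E] (G : E →L[ℂ] E)
    (hG : FiniteDimensional ℂ (LinearMap.range (G : E →ₗ[ℂ] E))) :
    Function.Injective (1 - G : E →L[ℂ] E) ↔ Function.Surjective (1 - G : E →L[ℂ] E) := by
  set R := LinearMap.range (G : E →ₗ[ℂ] E) with hR
  have hGR : ∀ x, G x ∈ R := fun x => ⟨x, rfl⟩
  let B : R →ₗ[ℂ] R := LinearMap.codRestrict R
    (((1 - G : E →L[ℂ] E) : E →ₗ[ℂ] E).comp R.subtype)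
    (fun x => by
      have : x.1 - G x.1 ∈ R := R.sub_mem x.2 (hGR _)
      simpa using this)
  have hB : ∀ x : R, (B x : E) = x.1 - G x.1 := fun x => by simp [B]
  constructor
  · intro h
    have hBi : Function.Injective B := by
      intro a b hab
      have h1 := congrArg Subtype.val hab
      rw [hB, hB] at h1
      exact Subtype.ext (h (by simpa using h1))
    have hBs := LinearMap.injective_iff_surjective.1 hBi
    intro y
    obtain ⟨r, hr⟩ := hBs ⟨G y, hGR y⟩
    have h1 := congrArg Subtype.val hr
    rw [hB] at h1
    simp only at h1
    refine ⟨y + r.1, ?_⟩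
    simp only [_root_.sub_apply, one_apply_eq_self, map_add]
    rw [← sub_eq_zero] at h1 ⊢
    rw [← h1]; abel
  · intro h
    have hBs : Function.Surjective B := by
      rintro ⟨r, hr⟩
      obtain ⟨x, hx⟩ := h r
      have hx' : x - G x = r := by simpa using hx
      have hxR : x ∈ R := by
        have : x = r + G x := by rw [← hx']; abel
        rw [this]; exact R.add_mem hr (hGR x)
      exact ⟨⟨x, hxR⟩, Subtype.ext (by rw [hB]; exact hx')⟩
    have hBi := LinearMap.injective_iff_surjective.2 hBs
    rw [injective_iff_map_eq_zero]
    intro x hx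
    have hx' : x - G x = 0 := by simpa using hx
    have hxR : x ∈ R := by rw [sub_eq_zero.1 hx']; exact hGR x
    have : (⟨x, hxR⟩ : R) = 0 := by
      apply hBi
      rw [map_zero]
      exact Subtype.ext (by rw [hB]; exact hx')
    exact congrArg Subtype.val this

lemma Phi0.unit_of_inj_or_surj {E : Type*} [NormedAddCommGroup E] [NormedSpace ℂ E]
    [CompleteSpace E] {A : E →L[ℂ] E} (hA : Phi0 A)
    (h : Function.Injective A ∨ Function.Surjective A) : IsUnit A := by
  obtain ⟨F, hF, U, hU⟩ := hA
  set R : E →L[ℂ] E := ↑U⁻¹ with hRdef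
  have hUA : A = U * (1 - R * F) := by
    rw [mul_sub, ← mul_assoc, hRdef, Units.mul_inv, hU]; simp
  have hRA : R * A = 1 - R * F := by
    rw [hUA, ← mul_assoc, hRdef, Units.inv_mul, one_mul]
  have hfin := finrank_range_comp R F hF
  have hRb : Function.Bijective R :=
    ContinuousLinearMap.isUnit_iff_bijective.1 (Units.isUnit U⁻¹)
  have hcoe : ((R * A : E →L[ℂ] E) : E → E) = R ∘ A := rfl
  have hb : Function.Bijective (1 - R * F : E →L[ℂ] E) := by
    rcases h with h | h
    · have h1 : Function.Injective (1 - R * F : E →L[ℂ] E) := by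
        rw [← hRA, hcoe]; exact hRb.1.comp h
      exact ⟨h1, (one_sub_fin _ hfin).1 h1⟩
    · have h1 : Function.Surjective (1 - R * F : E →L[ℂ] E) := by
        rw [← hRA, hcoe]; exact hRb.2.comp h
      exact ⟨(one_sub_fin _ hfin).2 h1, h1⟩
  rw [hUA]
  exact U.isUnit.mul (ContinuousLinearMap.isUnit_iff_bijective.2 hb)

/-- Structure of upper semi-Fredholm operators: a finite rank perturbation is bounded below
or right invertible. Moreover the range is closed. -/
lemma USF.exists_perturbation {E : Type*} [NormedAddCommGroup E] [NormedSpace ℂ E]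
    [CompleteSpace E] {A : E →L[ℂ] E} (hA : USF A) :
    IsClosed (Set.range A) ∧
    ∃ F : E →L[ℂ] E, FiniteDimensional ℂ (LinearMap.range (F : E →ₗ[ℂ] E)) ∧
      ((∃ c : ℝ, 0 < c ∧ ∀ x, c * ‖x‖ ≤ ‖(A + F) x‖) ∨ ∃ R : E →L[ℂ] E, (A + F) * R = 1) := by
  obtain ⟨s, c, hc, hs⟩ := hA
  let Φ : E →L[ℂ] (s → ℂ) := ContinuousLinearMap.pi (fun f : s => f.1)
  set M := Φ.ker with hM
  have hMs : ∀ x ∈ M, c * ‖x‖ ≤ ‖A x‖ := by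
    intro x hx
    apply hs
    intro f hf
    exact congrFun (LinearMap.mem_ker.1 hx) ⟨f, hf⟩
  obtain ⟨π, hπ⟩ : M.ClosedComplemented := Φ.ker_closedComplemented_of_finiteDimensional_range
  have hMc : IsClosed (M : Set E) := Φ.isClosed_ker
  set N : Submodule ℂ E := π.ker with hN
  have hNM : ∀ x ∈ N, x ∈ M → x = 0 := by
    intro x hx hxM
    have h1 := hπ ⟨x, hxM⟩
    have h2 : π x = 0 := LinearMap.mem_ker.1 hx
    have h3 := h1.symm.trans h2
    exact congrArg Subtype.val h3
  have hNfin : FiniteDimensional ℂ N := by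
    refine FiniteDimensional.of_injective ((Φ : E →ₗ[ℂ] (s → ℂ)).comp N.subtype) ?_
    rw [injective_iff_map_eq_zero]
    intro a ha
    exact Subtype.ext (hNM a.1 a.2 (LinearMap.mem_ker.2 ha))
  let P : E →L[ℂ] N := (ContinuousLinearMap.id ℂ E - M.subtypeL.comp π).codRestrict N (by
    intro x
    rw [hN]
    apply LinearMap.mem_ker.2
    simp [hπ])
  have hP : ∀ x, (P x : E) = x - π x := fun x => by simp [P]
  have hPM : ∀ x, x - (P x : E) ∈ M := fun x => by rw [hP]; simp
  have hPm : ∀ x ∈ M, P x = 0 := by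
    intro x hx
    apply Subtype.ext
    rw [hP]
    have := hπ ⟨x, hx⟩
    simp only at this
    rw [this]; simp
  have hPn : ∀ x : N, P x = x := by
    intro x
    apply Subtype.ext
    rw [hP]
    have : π x = 0 := LinearMap.mem_ker.1 x.2
    rw [this]; simp
  -- the image of M
  set R : Submodule ℂ E := M.map (A : E →ₗ[ℂ] E) with hR
  have hRc : IsClosed (R : Set E) := by
    have hcs : CompleteSpace M := hMc.completeSpace_coe
    have hanti : AntilipschitzWith (Real.toNNReal c⁻¹) (A.comp M.subtypeL) := by
      apply ContinuousLinearMap.antilipschitz_of_bound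
      intro x
      rw [Real.coe_toNNReal _ (by positivity), ← div_eq_inv_mul, le_div_iff₀ hc, mul_comm]
      exact hMs x.1 x.2
    have := hanti.isClosed_range (A.comp M.subtypeL).uniformContinuous
    convert this
    ext y
    simp [hR]
  have hinjM : ∀ x ∈ M, A x = 0 → x = 0 := by
    intro x hx h
    have := hMs x hx
    rw [h, norm_zero] at this
    by_contra hne
    have := mul_pos hc (norm_pos_iff.2 hne)
    linarith
  -- maps extending A|M by g on N
  have hext : ∀ g : N →ₗ[ℂ] E, ∃ F : E →L[ℂ] E,
      FiniteDimensional ℂ (LinearMap.range (F : E →ₗ[ℂ] E)) ∧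
      ∀ x, (A + F) x = A (x - P x) + g (P x) := by
    intro g
    let g' : N →L[ℂ] E := g.toContinuousLinearMap
    refine ⟨(g' - A.comp N.subtypeL).comp P, ?_, ?_⟩
    · refine Submodule.finiteDimensional_of_le
        (S₂ := LinearMap.range ((g' - A.comp N.subtypeL : N →L[ℂ] E) : N →ₗ[ℂ] E)) ?_
      rintro _ ⟨x, rfl⟩
      exact ⟨P x, rfl⟩
    · intro x
      simp [g']
      abel
  obtain ⟨σ, hσ⟩ := R.mkQ.exists_rightInverse_of_surjective (LinearMap.range_eq_top.2 R.mkQ_surjective)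
  have hσ' : ∀ q, R.mkQ (σ q) = q := fun q => LinearMap.congr_fun hσ q
  have hmem : ∀ x, R.mkQ x = 0 ↔ x ∈ R := fun x => by simp
  have hclosed : ∀ B : E →L[ℂ] E, (∀ x ∈ M, B x = A x) → IsClosed (Set.range B) := by
    intro B hB
    have h1 : Set.range B =
        ((R ⊔ N.map (B : E →ₗ[ℂ] E) : Submodule ℂ E) : Set E) := by
      ext y
      constructor
      · rintro ⟨x, rfl⟩
        have : B x = A (x - P x) + B (P x) := by
          rw [← hB _ (hPM x), ← map_add]; simp
        rw [this]
        exact Submodule.add_mem_sup ⟨_, hPM x, rfl⟩ ⟨_, (P x).2, rfl⟩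
      · intro hy
        obtain ⟨_, ⟨m, hm, rfl⟩, _, ⟨n, hn, rfl⟩, rfl⟩ := Submodule.mem_sup.1 hy
        refine ⟨m + n, ?_⟩
        rw [map_add, hB m hm]; rfl
    rw [h1]
    exact Submodule.isClosed_sup_finiteDimensional _ _ hRc
  refine ⟨hclosed A (fun _ _ => rfl), ?_⟩
  have hcase : (∃ g : N →ₗ[ℂ] (E ⧸ R), Function.Injective g) ∨
      (∃ g : N →ₗ[ℂ] (E ⧸ R), Function.Surjective g) := by
    let b := Module.Free.chooseBasis ℂ N
    let b' := Module.Free.chooseBasis ℂ (E ⧸ R)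
    rcases Function.Embedding.total (Module.Free.ChooseBasisIndex ℂ N)
      (Module.Free.ChooseBasisIndex ℂ (E ⧸ R)) with ⟨⟨e⟩⟩ | ⟨⟨e⟩⟩
    · left
      refine ⟨b.constr ℂ (b' ∘ e), ?_⟩
      have hli : LinearIndependent ℂ (b' ∘ e) := b'.linearIndependent.comp e e.injective
      intro x y hxy
      apply b.repr.injective
      apply hli
      simpa only [Finsupp.linearCombination_apply, Module.Basis.constr_apply] using hxy
    · right
      refine ⟨b.constr ℂ (Function.extend e b' 0), ?_⟩
      rw [← LinearMap.range_eq_top, b.constr_range, eq_top_iff, ← b'.span_eq]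
      apply Submodule.span_mono
      rintro _ ⟨i, rfl⟩
      exact ⟨e i, e.injective.extend_apply _ _ _⟩
  rcases hcase with ⟨g, hg⟩ | ⟨g, hg⟩
  · obtain ⟨F, hF, hFx⟩ := hext (σ.comp g)
    refine ⟨F, hF, Or.inl ?_⟩
    have hBM : ∀ x ∈ M, (A + F) x = A x := by
      intro x hx; rw [hFx, hPm x hx]; simp
    have hinj : Function.Injective (A + F) := by
      rw [injective_iff_map_eq_zero]
      intro x hx
      have h1 := congrArg R.mkQ hx
      have h0 : R.mkQ (A (x - P x)) = 0 := (hmem _).2 ⟨_, hPM x, rfl⟩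
      rw [hFx, map_add, h0, zero_add, map_zero, LinearMap.comp_apply,
        hσ'] at h1
      have h2 : P x = 0 := hg (by rw [h1, map_zero])
      have h3 := hPM x
      rw [h2] at h3
      simp only [ZeroMemClass.coe_zero, sub_zero] at h3
      exact hinjM x h3 (by rw [← hBM x h3]; exact hx)
    obtain ⟨K, hK⟩ := (A + F).antilipschitz_of_injective_of_isClosed_range hinj (hclosed _ hBM)
    refine ⟨((K : ℝ) + 1)⁻¹, by positivity, fun x => ?_⟩
    have := hK.le_mul_norm (map_zero _) x
    rw [inv_mul_le_iff₀ (by positivity)]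
    have h2 := norm_nonneg ((A + F) x)
    linarith
  · obtain ⟨F, hF, hFx⟩ := hext (σ.comp g)
    refine ⟨F, hF, Or.inr ?_⟩
    set B := A + F with hB
    have hBM : ∀ x ∈ M, B x = A x := by
      intro x hx; rw [hFx, hPm x hx]; simp
    have hsurj : Function.Surjective B := by
      intro y
      obtain ⟨n, hn⟩ := hg (R.mkQ y)
      have h1 : y - σ (g n) ∈ R := by
        rw [← hmem, map_sub, hσ', hn, sub_self]
      obtain ⟨m, hm, hmy⟩ := h1
      refine ⟨m + n, ?_⟩
      have h2 : P (m + n) = n := by rw [map_add, hPm m hm, hPn, zero_add]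
      have h3 : A m = y - σ (g n) := hmy
      rw [hFx, h2, add_sub_cancel_right, h3]
      simp
    have hkfin : FiniteDimensional ℂ B.ker := by
      refine FiniteDimensional.of_injective ((P : E →ₗ[ℂ] N).comp B.ker.subtype) ?_
      rw [injective_iff_map_eq_zero]
      intro a ha
      have h1 : P a.1 = 0 := ha
      have h2 := hPM a.1
      rw [h1] at h2
      simp only [ZeroMemClass.coe_zero, sub_zero] at h2
      have h3 : B a.1 = 0 := LinearMap.mem_ker.1 a.2
      exact Subtype.ext (hinjM _ h2 (by rw [← hBM _ h2]; exact h3))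
    obtain ⟨ρ, hρ⟩ : B.ker.ClosedComplemented := Submodule.ClosedComplemented.of_finiteDimensional _
    have hkc : CompleteSpace B.ker := B.isClosed_ker.completeSpace_coe
    let C : E →L[ℂ] E × B.ker := B.prod ρ
    have hC1 : C.ker = ⊥ := by
      rw [LinearMap.ker_eq_bot']
      intro x hx
      have hx1 : B x = 0 := congrArg Prod.fst hx
      have hx2 : ρ x = 0 := congrArg Prod.snd hx
      have := hρ ⟨x, LinearMap.mem_ker.2 hx1⟩
      exact congrArg Subtype.val (this.symm.trans hx2)
    have hC2 : C.range = ⊤ := by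
      rw [LinearMap.range_eq_top]
      rintro ⟨y, k⟩
      obtain ⟨x, hx⟩ := hsurj y
      refine ⟨x - ρ x + k, ?_⟩
      have e1 : B (ρ x) = 0 := LinearMap.mem_ker.1 (ρ x).2
      have e2 : B k = 0 := LinearMap.mem_ker.1 k.2
      apply Prod.ext
      · change B (x - ρ x + k) = y
        rw [map_add, map_sub, e1, e2, hx]; simp
      · change ρ (x - ρ x + k) = k
        rw [map_add, map_sub, hρ, hρ]; simp
    let Ce := ContinuousLinearEquiv.ofBijective C hC1 hC2
    refine ⟨(Ce.symm : E × B.ker →L[ℂ] E).comp (ContinuousLinearMap.inl ℂ E B.ker), ?_⟩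
    ext y
    have := ContinuousLinearEquiv.ofBijective_apply_symm_apply C hC1 hC2 (y, 0)
    exact congrArg Prod.fst this

/-- The index-zero property propagates along the segment. -/
lemma unit_of_dense {E : Type*} [NormedAddCommGroup E] [NormedSpace ℂ E] [CompleteSpace E]
    (V S : E →L[ℂ] E) (hV : IsUnit V) (hS : SmallOn S) (hd : DenseRange (V + S)) :
    IsUnit (V + S) := by
  let a : ℝ → (E →L[ℂ] E) := fun t => V + (t : ℂ) • S
  have ha : Continuous a := by fun_prop
  have husf : ∀ t, USF (a t) := fun t => usf_of_small V _ hV (hS.smul _)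
  have hopen : IsOpen {t | Phi0 (a t)} := by
    rw [isOpen_iff_mem_nhds]
    rintro t ⟨F, hF, hU⟩
    have h1 : ∀ᶠ r in 𝓝 t, IsUnit (a r + F) := by
      have : Continuous fun r => a r + F := by fun_prop
      exact this.continuousAt.eventually (Units.isOpen.mem_nhds hU)
    filter_upwards [h1] with r hr
    exact ⟨F, hF, hr⟩
  have hclosed : IsClosed {t | Phi0 (a t)} := by
    rw [← closure_subset_iff_isClosed]
    intro t ht
    obtain ⟨F, hF, hcase⟩ := (husf t).exists_perturbation.2
    refine ⟨F, hF, ?_⟩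
    have hcont : Continuous fun r => a r + F := by fun_prop
    rcases hcase with ⟨c, hc, hb⟩ | ⟨R, hR⟩
    · have h1 : ∀ᶠ r in 𝓝 t, ‖(a r + F) - (a t + F)‖ < c / 4 := by
        have : Tendsto (fun r => ‖(a r + F) - (a t + F)‖) (𝓝 t) (𝓝 0) := by
          have h2 : Continuous (fun r => ‖(a r + F) - (a t + F)‖) :=
            (hcont.sub continuous_const).norm
          have h := h2.tendsto t
          rwa [sub_self, norm_zero] at h
        exact this.eventually (gt_mem_nhds (by positivity))
      obtain ⟨r, hr, hr'⟩ := (mem_closure_iff_frequently.1 ht |>.and_eventually h1).exists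
      have hlow : ∀ x, (c / 2) * ‖x‖ ≤ ‖(a r + F) x‖ := by
        intro x
        have h2 := hb x
        have h3 := ((a r + F) - (a t + F)).le_of_opNorm_le hr'.le x
        have h4 : ‖(a t + F) x‖ ≤ ‖(a r + F) x‖ + ‖((a r + F) - (a t + F)) x‖ := by
          have := norm_sub_le ((a r + F) x) (((a r + F) - (a t + F)) x)
          rwa [_root_.sub_apply, sub_sub_cancel] at this
        nlinarith [norm_nonneg x]
      have hinj : Function.Injective (a r + F) := by
        rw [injective_iff_map_eq_zero]
        intro x hx
        have h2 := hlow x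
        rw [hx, norm_zero] at h2
        by_contra hne
        have := mul_pos hc (norm_pos_iff.2 hne)
        linarith
      obtain ⟨U, hU⟩ := (hr.add_fin F hF).unit_of_inj_or_surj (Or.inl hinj)
      have hUinv : ‖(↑U⁻¹ : E →L[ℂ] E)‖ ≤ 2 / c := by
        apply ContinuousLinearMap.opNorm_le_bound _ (by positivity)
        intro y
        have h2 := hlow ((↑U⁻¹ : E →L[ℂ] E) y)
        rw [← hU, ← mul_apply_eq_comp, Units.mul_inv, one_apply_eq_self] at h2
        rw [div_mul_eq_mul_div, le_div_iff₀ hc]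
        linarith
      have h5 : ‖(↑U⁻¹ : E →L[ℂ] E) * ((a r + F) - (a t + F))‖ < 1 := by
        calc _ ≤ ‖(↑U⁻¹ : E →L[ℂ] E)‖ * ‖(a r + F) - (a t + F)‖ := norm_mul_le _ _
          _ ≤ 2 / c * (c / 4) := by gcongr
          _ < 1 := by field_simp; norm_num
      have h6 : a t + F = U * (1 - (↑U⁻¹ : E →L[ℂ] E) * ((a r + F) - (a t + F))) := by
        rw [mul_sub, ← mul_assoc, Units.mul_inv, hU, one_mul, mul_one, sub_sub_cancel]
      rw [h6]
      exact U.isUnit.mul (isUnit_one_sub_of_norm_lt_one h5)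
    · have h1 : ∀ᶠ r in 𝓝 t, IsUnit ((a r + F) * R) := by
        have : Continuous fun r => (a r + F) * R := hcont.mul continuous_const
        exact this.continuousAt.eventually (Units.isOpen.mem_nhds (by
          change IsUnit ((a t + F) * R)
          rw [hR]; exact isUnit_one))
      obtain ⟨r, hr, hr'⟩ := (mem_closure_iff_frequently.1 ht |>.and_eventually h1).exists
      have hsurj : Function.Surjective (a r + F) := by
        have := (ContinuousLinearMap.isUnit_iff_bijective.1 hr').2
        exact Function.Surjective.of_comp (g := R) this
      obtain ⟨U, hU⟩ := (hr.add_fin F hF).unit_of_inj_or_surj (Or.inr hsurj)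
      rw [← hU] at hr'
      obtain ⟨W, hW⟩ : IsUnit R := (Units.isUnit_units_mul U R).1 hr'
      have : a t + F = ↑W⁻¹ := by
        rw [← hW] at hR
        exact Units.eq_inv_of_mul_eq_one_right hR
      rw [this]
      exact Units.isUnit _
  have huniv : {t | Phi0 (a t)} = Set.univ := by
    refine IsClopen.eq_univ ⟨hclosed, hopen⟩ ⟨0, 0, ?_, ?_⟩
    · rw [show ((0 : E →L[ℂ] E) : E →ₗ[ℂ] E) = 0 from rfl, LinearMap.range_zero]; infer_instance
    · simpa [a] using hV
  have h1 : Phi0 (a 1) := by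
    have : (1 : ℝ) ∈ {t | Phi0 (a t)} := by rw [huniv]; trivial
    exact this
  have ha1 : a 1 = V + S := by simp [a]
  have hcl := (husf 1).exists_perturbation.1
  rw [ha1] at h1 hcl
  refine h1.unit_of_inj_or_surj (Or.inr ?_)
  rw [← Set.range_eq_univ, ← hcl.closure_eq]
  exact hd.closure_eq

/-- The operator on the direct sum given by a scalar matrix. -/
def matOp (X : Type*) [NormedAddCommGroup X] [NormedSpace ℂ X] (a b c d : ℂ) :
    (X × X) →L[ℂ] (X × X) :=
  (a • ContinuousLinearMap.fst ℂ X X + b • ContinuousLinearMap.snd ℂ X X).prod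
    (c • ContinuousLinearMap.fst ℂ X X + d • ContinuousLinearMap.snd ℂ X X)

lemma matOp_apply {X : Type*} [NormedAddCommGroup X] [NormedSpace ℂ X] (a b c d : ℂ) (x y : X) :
    matOp X a b c d (x, y) = (a • x + b • y, c • x + d • y) := by
  simp [matOp]

lemma matOp_mul {X : Type*} [NormedAddCommGroup X] [NormedSpace ℂ X] (a b c d D : ℂ)
    (hD : D * (a * d - b * c) = 1) :
    matOp X a b c d * matOp X (D * d) (-(D * b)) (-(D * c)) (D * a) = 1 := by
  refine ContinuousLinearMap.ext ?_
  rintro ⟨x, y⟩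
  rw [mul_apply_eq_comp, matOp_apply, matOp_apply, one_apply_eq_self]
  apply Prod.ext
  · simp only
    match_scalars <;> first | linear_combination hD | ring
  · simp only
    match_scalars <;> first | linear_combination hD | ring

lemma isUnit_matOp {X : Type*} [NormedAddCommGroup X] [NormedSpace ℂ X] (a b c d : ℂ)
    (h : a * d - b * c ≠ 0) : IsUnit (matOp X a b c d) := by
  have hD := inv_mul_cancel₀ h
  set D := (a * d - b * c)⁻¹
  refine isUnit_iff_exists.2 ⟨matOp X (D * d) (-(D * b)) (-(D * c)) (D * a),
    matOp_mul a b c d D hD, ?_⟩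
  have hne : D ≠ 0 := inv_ne_zero h
  refine ContinuousLinearMap.ext ?_
  rintro ⟨x, y⟩
  rw [mul_apply_eq_comp, matOp_apply, matOp_apply, one_apply_eq_self]
  apply Prod.ext
  · simp only
    match_scalars <;> first | linear_combination hD | ring
  · simp only
    match_scalars <;> first | linear_combination hD | ring

theorem stmt_6 {X : Type*} [NormedAddCommGroup X] [NormedSpace ℂ X] [CompleteSpace X]
    (hX : ¬ TopologicalSpace.SeparableSpace X)
    (hform : ∀ A : X →L[ℂ] X, ∃ (w : ℂ) (S : X →L[ℂ] X),
      StrictlySingular S ∧ TopologicalSpace.IsSeparable (Set.range S) ∧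
      A = w • ContinuousLinearMap.id ℂ X + S) :
    ∀ (T : (X × X) →L[ℂ] (X × X)) (p : X × X), p ≠ 0 → interior (JSet T p) = ∅ := by
  intro T p hp
  by_contra hint
  have hno : ∀ f : (X × X) →L[ℂ] ℂ, f ≠ 0 → ∀ l : ℂ, ‖l‖ ≤ 1 → (∀ x, f (T x) = l * f x) → False :=
    fun f hf l hl h => hint (interior_JSet_of_eigenfunctional T f hf l hl h p)
  obtain ⟨a, S11, h11, s11, e11⟩ := hform ((ContinuousLinearMap.fst ℂ X X).comp
    (T.comp (ContinuousLinearMap.inl ℂ X X)))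
  obtain ⟨b, S12, h12, s12, e12⟩ := hform ((ContinuousLinearMap.fst ℂ X X).comp
    (T.comp (ContinuousLinearMap.inr ℂ X X)))
  obtain ⟨c, S21, h21, s21, e21⟩ := hform ((ContinuousLinearMap.snd ℂ X X).comp
    (T.comp (ContinuousLinearMap.inl ℂ X X)))
  obtain ⟨d, S22, h22, s22, e22⟩ := hform ((ContinuousLinearMap.snd ℂ X X).comp
    (T.comp (ContinuousLinearMap.inr ℂ X X)))
  have hT : ∀ x y : X, T (x, y) =
      (a • x + S11 x + (b • y + S12 y), c • x + S21 x + (d • y + S22 y)) := by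
    intro x y
    have q11 := congrArg (fun A : X →L[ℂ] X => A x) e11
    have q12 := congrArg (fun A : X →L[ℂ] X => A y) e12
    have q21 := congrArg (fun A : X →L[ℂ] X => A x) e21
    have q22 := congrArg (fun A : X →L[ℂ] X => A y) e22
    simp at q11 q12 q21 q22
    have : T (x, y) = T (x, 0) + T (0, y) := by rw [← map_add]; simp
    rw [this]
    apply Prod.ext
    · rw [Prod.fst_add, q11, q12]
    · rw [Prod.snd_add, q21, q22]
  -- the matrix part has no eigenvalue in the closed disc
  have hdet : ∀ l : ℂ, ‖l‖ ≤ 1 → (a - l) * (d - l) - b * c ≠ 0 := by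
    intro l hl h0
    obtain ⟨α, β, hne, hc1, hc2⟩ : ∃ α β : ℂ, ¬ (α = 0 ∧ β = 0) ∧ α * a + β * c = l * α ∧
        α * b + β * d = l * β := by
      by_cases h1 : c = 0 ∧ a - l = 0
      · by_cases h2 : d - l = 0 ∧ b = 0
        · refine ⟨1, 0, by simp, ?_, ?_⟩
          · linear_combination h1.2
          · linear_combination h2.2
        · refine ⟨d - l, -b, by simpa using h2, ?_, ?_⟩
          · linear_combination (d - l) * h1.2 - b * h1.1
          · ring
      · refine ⟨c, -(a - l), by simpa only [neg_eq_zero] using h1, ?_, ?_⟩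
        · ring
        · linear_combination -h0
    let Z : Submodule ℂ X := (Submodule.span ℂ (((Set.range S11 ∪ Set.range S12) ∪
      Set.range S21) ∪ Set.range S22)).topologicalClosure
    have hZc : IsClosed (Z : Set X) := Submodule.isClosed_topologicalClosure _
    have hZs : TopologicalSpace.IsSeparable (Z : Set X) := by
      refine TopologicalSpace.IsSeparable.closure ?_
      exact TopologicalSpace.IsSeparable.span (((s11.union s12).union s21).union s22)
    obtain ⟨x, hx⟩ : ∃ x, x ∉ Z := by
      by_contra! hall
      apply hX
      rw [← TopologicalSpace.isSeparable_univ_iff]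
      exact hZs.mono (fun x _ => hall x)
    obtain ⟨ψ, hψx, hψ⟩ := exists_functional_vanishing Z hZc x hx
    have hsub : ∀ y ∈ ((Set.range S11 ∪ Set.range S12) ∪ Set.range S21) ∪ Set.range S22,
        ψ y = 0 := fun y hy =>
      hψ y (Submodule.le_topologicalClosure _ (Submodule.subset_span hy))
    have z11 : ∀ y, ψ (S11 y) = 0 := fun y => hsub _ (by simp)
    have z12 : ∀ y, ψ (S12 y) = 0 := fun y => hsub _ (by simp)
    have z21 : ∀ y, ψ (S21 y) = 0 := fun y => hsub _ (by simp)
    have z22 : ∀ y, ψ (S22 y) = 0 := fun y => hsub _ (by simp)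
    let f : (X × X) →L[ℂ] ℂ := α • ψ.comp (ContinuousLinearMap.fst ℂ X X) +
      β • ψ.comp (ContinuousLinearMap.snd ℂ X X)
    have hf : ∀ u v : X, f (u, v) = α * ψ u + β * ψ v := fun u v => by simp [f]
    refine hno f ?_ l hl ?_
    · intro hf0
      have k1 := hf x 0
      have k2 := hf 0 x
      rw [hf0] at k1 k2
      simp [hψx] at k1 k2
      exact hne ⟨k1, k2⟩
    · rintro ⟨u, v⟩
      rw [hT, hf, hf]
      simp only [map_add, map_smul, z11, z12, z21, z22, smul_eq_mul, add_zero]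
      linear_combination ψ u * hc1 + ψ v * hc2
  have hunit : ∀ l : ℂ, ‖l‖ ≤ 1 → IsUnit (T - l • ContinuousLinearMap.id ℂ (X × X)) := by
    intro l hl
    let S : (X × X) →L[ℂ] (X × X) :=
      (ContinuousLinearMap.inl ℂ X X).comp (S11.comp (ContinuousLinearMap.fst ℂ X X)) +
      (ContinuousLinearMap.inl ℂ X X).comp (S12.comp (ContinuousLinearMap.snd ℂ X X)) +
      (ContinuousLinearMap.inr ℂ X X).comp (S21.comp (ContinuousLinearMap.fst ℂ X X)) +
      (ContinuousLinearMap.inr ℂ X X).comp (S22.comp (ContinuousLinearMap.snd ℂ X X))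
    have hS : SmallOn S :=
      ((((smallOn_comp S11 h11 _).comp_left _).add ((smallOn_comp S12 h12 _).comp_left _)).add
        ((smallOn_comp S21 h21 _).comp_left _)).add ((smallOn_comp S22 h22 _).comp_left _)
    have hSx : ∀ x y : X, S (x, y) = (S11 x + S12 y, S21 x + S22 y) := fun x y => by simp [S]
    have hV := isUnit_matOp (X := X) (a - l) b c (d - l) (hdet l hl)
    have hTV : T - l • ContinuousLinearMap.id ℂ (X × X) = matOp X (a - l) b c (d - l) + S := by
      refine ContinuousLinearMap.ext ?_
      rintro ⟨x, y⟩
      rw [_root_.sub_apply, _root_.add_apply, hT, hSx, matOp_apply]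
      apply Prod.ext
      · simp only [_root_.smul_apply, ContinuousLinearMap.id_apply, Prod.fst_sub,
          Prod.smul_fst, Prod.fst_add, sub_smul]
        abel
      · simp only [_root_.smul_apply, ContinuousLinearMap.id_apply, Prod.snd_sub,
          Prod.smul_snd, Prod.snd_add, sub_smul]
        abel
    rw [hTV]
    refine unit_of_dense _ _ hV hS ?_
    rw [← hTV]
    set B := T - l • ContinuousLinearMap.id ℂ (X × X) with hB
    intro x
    by_contra hx
    obtain ⟨f, hfx, hf⟩ := exists_functional_vanishing
      (LinearMap.range (B : (X × X) →ₗ[ℂ] (X × X))).topologicalClosure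
      (Submodule.isClosed_topologicalClosure _) x hx
    refine hno f (by rintro rfl; exact hfx rfl) l hl ?_
    intro z
    have h1 := hf (B z) (Submodule.le_topologicalClosure _ ⟨z, rfl⟩)
    have h2 : B z = T z - l • z := by simp [hB]
    rw [h2, map_sub, map_smul, smul_eq_mul] at h1
    exact sub_eq_zero.1 h1
  obtain ⟨y, hy⟩ := Set.nonempty_iff_ne_empty.2 hint
  exact hp (JSet_of_spectrum T hunit p y (interior_subset hy))
end

section
/- Let X be a complex Banach space, let S be a strictly singular bounded linear operator on X, and let T be a bounded linear operator on X whose spectrum σ(T) is at most countable. Then the spectrum σ(S + T) is at most countable, and every accumulation point of σ(S + T) belongs to {0} ∪ σ(T). -/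
open Filter Topology

/-- Construction step for strictly singular perturbations. -/
lemma ss_exists_functionals {X : Type*} [NormedAddCommGroup X] [NormedSpace ℂ X]
    (S : X →L[ℂ] X) (hS : StrictlySingular S) (A : X →L[ℂ] X) (c : ℝ) (hc : 0 < c)
    (h : ∀ x, c * ‖x‖ ≤ ‖A x‖ + ‖S x‖) :
    ∃ s : Finset (StrongDual ℂ X), ∃ d : ℝ, 0 < d ∧
      ∀ x, (∀ f ∈ s, f x = 0) → d * ‖x‖ ≤ ‖A x‖ := by
  classical
  by_contra! hcon
  have key : ∃ g : ℕ → X × StrongDual ℂ X × ℕ,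
      (∀ n, ‖(g n).1‖ = 1 ∧ (g n).2.1 (g n).1 = 1 ∧ ‖(g n).2.1‖ ≤ 1 ∧
        ‖A (g n).1‖ ≤ c / 8 * (1 / 4) ^ (g n).2.2) ∧
      ∀ m n, m < n → ((g m).2.1 (g n).1 = 0 ∧ (g m).2.2 < (g n).2.2) := by
    apply exists_seq_of_forall_finset_exists
      (fun a : X × StrongDual ℂ X × ℕ => ‖a.1‖ = 1 ∧ a.2.1 a.1 = 1 ∧ ‖a.2.1‖ ≤ 1 ∧
        ‖A a.1‖ ≤ c / 8 * (1 / 4) ^ a.2.2)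
      (fun a b => a.2.1 b.1 = 0 ∧ a.2.2 < b.2.2)
    intro s _
    obtain ⟨x, hx0, hx⟩ := hcon (s.image fun a => a.2.1)
      (c / 8 * (1 / 4) ^ (s.sup (fun a => a.2.2) + 1)) (by positivity)
    have hxne : ‖x‖ ≠ 0 := by
      intro h0
      rw [h0, mul_zero] at hx
      exact absurd hx (not_lt.mpr (norm_nonneg _))
    have hxpos : 0 < ‖x‖ := lt_of_le_of_ne (norm_nonneg _) (Ne.symm hxne)
    set y : X := ((‖x‖⁻¹ : ℝ) : ℂ) • x with hy
    have hy1 : ‖y‖ = 1 := by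
      rw [hy, norm_smul]
      simp [hxne]
    obtain ⟨f, hf1, hf2⟩ := exists_dual_vector ℂ y (by rw [hy1]; norm_num)
    refine ⟨(y, f, s.sup (fun a => a.2.2) + 1), ⟨hy1, ?_, hf1.le, ?_⟩, ?_⟩
    · simp [hf2, hy1]
    · simp only [hy, map_smul, norm_smul]
      rw [Complex.norm_real, norm_inv, norm_norm, inv_mul_le_iff₀ hxpos]
      linarith
    · intro a ha
      refine ⟨?_, ?_⟩
      · have := hx0 a.2.1 (Finset.mem_image_of_mem _ ha)
        simp [hy, this]
      · exact Nat.lt_succ_of_le (Finset.le_sup (f := fun a : X × StrongDual ℂ X × ℕ => a.2.2) ha)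
  obtain ⟨g, hg1, hg2⟩ := key
  set x : ℕ → X := fun n => (g n).1 with hxdef
  set f : ℕ → StrongDual ℂ X := fun n => (g n).2.1 with hfdef
  have hk : StrictMono (fun n => (g n).2.2) := fun m n hmn => (hg2 m n hmn).2
  have hx1 : ∀ n, ‖x n‖ = 1 := fun n => (hg1 n).1
  have hfx : ∀ n, f n (x n) = 1 := fun n => (hg1 n).2.1
  have hfn : ∀ n, ‖f n‖ ≤ 1 := fun n => (hg1 n).2.2.1
  have hf0 : ∀ m n, m < n → f m (x n) = 0 := fun m n hmn => (hg2 m n hmn).1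
  have hA : ∀ n, ‖A (x n)‖ ≤ c / 8 * (1 / 4) ^ n := fun n =>
    (hg1 n).2.2.2.trans (by
      gcongr c / 8 * ?_
      exact pow_le_pow_of_le_one (by norm_num) (by norm_num) (hk.id_le n))
  have coef : ∀ (N : ℕ) (a : ℕ → ℂ) (i : ℕ), i < N →
      ‖a i‖ ≤ 2 ^ i * ‖∑ j ∈ Finset.range N, a j • x j‖ := by
    intro N a i
    induction i using Nat.strong_induction_on with
    | _ i ih =>
      intro hi
      set v := ∑ j ∈ Finset.range N, a j • x j with hv
      have h1 : f i v = ∑ j ∈ Finset.range i, a j * f i (x j) + a i := by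
        rw [hv, map_sum, ← Finset.sum_range_add_sum_Ico _ (show i + 1 ≤ N from hi),
          Finset.sum_range_succ, Finset.sum_eq_zero (s := Finset.Ico (i+1) N)]
        · simp [hfx]
        · intro j hj
          rw [Finset.mem_Ico] at hj
          simp [hf0 i j (by omega)]
      have h2 : a i = f i v - ∑ j ∈ Finset.range i, a j * f i (x j) := by rw [h1]; ring
      have h3 : ∀ m n, ‖f m (x n)‖ ≤ 1 := fun m n => by
        have := (f m).le_opNorm (x n)
        rw [hx1, mul_one] at this
        exact this.trans (hfn m)
      have h4 : ‖f i v‖ ≤ ‖v‖ :=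
        ((f i).le_opNorm v).trans (mul_le_of_le_one_left (norm_nonneg _) (hfn i))
      have h5 : ‖∑ j ∈ Finset.range i, a j * f i (x j)‖ ≤ ∑ j ∈ Finset.range i, 2 ^ j * ‖v‖ := by
        refine norm_sum_le_of_le _ fun j hj => ?_
        rw [Finset.mem_range] at hj
        rw [norm_mul]
        calc ‖a j‖ * ‖f i (x j)‖ ≤ ‖a j‖ * 1 := by gcongr; exact h3 i j
          _ ≤ _ := by rw [mul_one]; exact ih j hj (hj.trans hi)
      have h6 : ∑ j ∈ Finset.range i, (2:ℝ) ^ j = 2 ^ i - 1 := by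
        rw [geom_sum_eq (by norm_num)]; norm_num
      rw [← Finset.sum_mul, h6] at h5
      calc ‖a i‖ ≤ ‖f i v‖ + ‖∑ j ∈ Finset.range i, a j * f i (x j)‖ := by
            rw [h2]; exact norm_sub_le _ _
        _ ≤ ‖v‖ + (2 ^ i - 1) * ‖v‖ := by gcongr
        _ = _ := by ring
  have hli : LinearIndependent ℂ x := by
    rw [linearIndependent_iff]
    intro l hl
    ext i
    obtain ⟨N, hN⟩ : ∃ N, l.support ∪ {i} ⊆ Finset.range N := Finset.exists_nat_subset_range _
    rw [Finsupp.linearCombination_apply,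
      Finsupp.sum_of_support_subset l (Finset.union_subset_left hN) _ (by simp)] at hl
    have := coef N l i (Finset.mem_range.mp (hN (by simp)))
    rw [hl] at this
    simpa using this
  refine hS (Submodule.span ℂ (Set.range x)) ?_ ⟨c / 2, by positivity, ?_⟩
  · intro hfin
    have h3 : LinearIndependent ℂ
        (fun n => (⟨x n, Submodule.subset_span ⟨n, rfl⟩⟩ : Submodule.span ℂ (Set.range x))) :=
      LinearIndependent.of_comp (Submodule.subtype _) hli
    have := h3.finite
    exact not_finite ℕ
  · intro v hv
    obtain ⟨l, rfl⟩ := Finsupp.mem_span_range_iff_exists_finsupp.mp hv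
    obtain ⟨N, hN⟩ : ∃ N, l.support ⊆ Finset.range N := Finset.exists_nat_subset_range _
    rw [Finsupp.sum_of_support_subset l hN _ (by simp)]
    set v := ∑ j ∈ Finset.range N, l j • x j with hvdef
    have h1 : ‖A v‖ ≤ ∑ j ∈ Finset.range N, (c / 8 * ‖v‖) * (1 / 2) ^ j := by
      have hAv : A v = ∑ j ∈ Finset.range N, A (l j • x j) := by rw [hvdef, map_sum]
      rw [hAv]
      refine norm_sum_le_of_le _ fun j hj => ?_
      rw [Finset.mem_range] at hj
      rw [map_smul, norm_smul]
      calc ‖l j‖ * ‖A (x j)‖ ≤ (2 ^ j * ‖v‖) * (c / 8 * (1 / 4) ^ j) := by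
            gcongr
            · exact coef N l j hj
            · exact hA j
        _ = (c / 8 * ‖v‖) * ((2 * (1/4)) ^ j) := by rw [mul_pow]; ring
        _ = _ := by norm_num
    have h2 : ∑ j ∈ Finset.range N, ((1:ℝ) / 2) ^ j ≤ 2 := sum_geometric_two_le N
    rw [← Finset.mul_sum] at h1
    have h3 : ‖A v‖ ≤ (c / 8 * ‖v‖) * 2 := h1.trans (by gcongr)
    have h4 := h v
    have h5 : 0 ≤ c * ‖v‖ := by positivity
    linarith

lemma ss_finite_rank {X F : Type*} [NormedAddCommGroup X] [NormedSpace ℂ X] [CompleteSpace X]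
    [NormedAddCommGroup F] [NormedSpace ℂ F] [FiniteDimensional ℂ F]
    (D : (X →L[ℂ] X)ˣ) (L : F →L[ℂ] X) (Q : X →L[ℂ] F) (hQ : Function.Surjective Q)
    (m : F →ₗ[ℂ] F) (hm : ∀ v, m v = v + Q ((↑D⁻¹ : X →L[ℂ] X) (L v))) :
    (Function.Injective ((D : X →L[ℂ] X) + L ∘L Q) → IsUnit ((D : X →L[ℂ] X) + L ∘L Q)) ∧
    (Function.Surjective ((D : X →L[ℂ] X) + L ∘L Q) → IsUnit ((D : X →L[ℂ] X) + L ∘L Q)) ∧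
    (IsUnit ((D : X →L[ℂ] X) + L ∘L Q) ↔ LinearMap.det m ≠ 0) := by
  have hD1 : ∀ x, (D : X →L[ℂ] X) ((↑D⁻¹ : X →L[ℂ] X) x) = x := fun x => by
    rw [← mul_apply_eq_comp]; simp
  have hD2 : ∀ x, (↑D⁻¹ : X →L[ℂ] X) ((D : X →L[ℂ] X) x) = x := fun x => by
    rw [← mul_apply_eq_comp]; simp
  set W := (D : X →L[ℂ] X) + L ∘L Q with hW
  have hWx : ∀ x, W x = (D : X →L[ℂ] X) x + L (Q x) := fun x => by simp [hW]
  have i1 : Function.Injective W → Function.Injective m := by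
    intro hi
    rw [injective_iff_map_eq_zero] at hi ⊢
    intro v hv
    rw [hm] at hv
    have h1 : Q ((↑D⁻¹ : X →L[ℂ] X) (L v)) = -v := by
      rw [add_comm] at hv; exact eq_neg_of_add_eq_zero_left hv
    have h2 := hi ((↑D⁻¹ : X →L[ℂ] X) (L v)) (by rw [hWx, hD1, h1]; simp)
    rw [h2, map_zero] at h1
    exact (neg_eq_zero.mp h1.symm)
  have i2 : Function.Surjective W → Function.Surjective m := by
    intro hs v
    obtain ⟨y, rfl⟩ := hQ v
    obtain ⟨x, hx⟩ := hs ((D : X →L[ℂ] X) y)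
    refine ⟨Q x, ?_⟩
    rw [hm, ← map_add, ← hD2 y, ← hx, hWx, map_add (↑D⁻¹ : X →L[ℂ] X), hD2]
  have i3 : Function.Injective m → Function.Injective W := by
    intro hi
    rw [injective_iff_map_eq_zero] at hi ⊢
    intro x hx
    rw [hWx] at hx
    have h1 : Q x = 0 := by
      apply hi
      rw [hm, ← map_add]
      have := congrArg (↑D⁻¹ : X →L[ℂ] X) hx
      rw [map_add, hD2, map_zero] at this
      rw [this, map_zero]
    rw [h1, map_zero, add_zero] at hx
    rw [← hD2 x, hx, map_zero]
  have i4 : Function.Surjective m → Function.Surjective W := by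
    intro hs y
    obtain ⟨u, hu⟩ := hs (Q ((↑D⁻¹ : X →L[ℂ] X) y))
    rw [hm] at hu
    refine ⟨(↑D⁻¹ : X →L[ℂ] X) (y - L u), ?_⟩
    rw [hWx, hD1, map_sub, map_sub, ← hu]
    simp
  have i5 : Function.Injective m ↔ Function.Surjective m := LinearMap.injective_iff_surjective
  have i6 : IsUnit W ↔ Function.Bijective W := ContinuousLinearMap.isUnit_iff_bijective
  refine ⟨fun h => i6.mpr ⟨h, i4 (i5.mp (i1 h))⟩,
    fun h => i6.mpr ⟨i3 (i5.mpr (i2 h)), h⟩, ?_⟩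
  rw [← isUnit_iff_ne_zero, ← LinearMap.isUnit_iff_isUnit_det, Module.End.isUnit_iff, i6]
  exact ⟨fun h => ⟨i1 h.1, i2 h.2⟩, fun h => ⟨i3 h.1, i4 h.2⟩⟩

lemma ss_surj_perturb {X : Type*} [NormedAddCommGroup X] [NormedSpace ℂ X] [CompleteSpace X]
    (D : X →L[ℂ] X) (hD : Function.Surjective D) :
    ∃ ε : ℝ, 0 < ε ∧ ∀ w : X →L[ℂ] X, ‖w‖ < ε → Function.Surjective (D + w) := by
  obtain ⟨R, hR⟩ := D.exists_nonlinearRightInverse_of_surjective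
    (LinearMap.range_eq_top.mpr hD)
  have hpos : (0:ℝ) < (R.nnnorm : ℝ)⁻¹ := by
    have : (0:ℝ) < R.nnnorm := by exact_mod_cast hR
    positivity
  refine ⟨(R.nnnorm : ℝ)⁻¹, hpos, fun w hw y => ?_⟩
  have happ : ApproximatesLinearOn (D + w) D Set.univ ‖w‖₊ := by
    intro x _ y _
    have : (D + w) x - (D + w) y - D (x - y) =
        w (x - y) := by
      simp only [add_apply, map_sub]; abel
    rw [this]
    exact w.le_opNorm _
  have hd : 0 < (R.nnnorm : ℝ)⁻¹ - ‖w‖ := by linarith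
  have := happ.surjOn_closedBall_of_nonlinearRightInverse R
    (ε := ‖y‖ / ((R.nnnorm : ℝ)⁻¹ - ‖w‖)) (b := 0) (by positivity) (Set.subset_univ _)
  have hy : y ∈ Metric.closedBall ((D + w) 0)
      (((R.nnnorm : ℝ)⁻¹ - ‖w‖₊) * (‖y‖ / ((R.nnnorm : ℝ)⁻¹ - ‖w‖))) := by
    rw [map_zero, mem_closedBall_zero_iff, coe_nnnorm, mul_div_cancel₀ _ hd.ne']
  obtain ⟨x, _, hx⟩ := this hy
  exact ⟨x, hx⟩

universe u v in
lemma ss_inj_or_surj {F : Type u} {Y : Type v} [AddCommGroup F] [Module ℂ F] [FiniteDimensional ℂ F]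
    [AddCommGroup Y] [Module ℂ Y] :
    ∃ j : F →ₗ[ℂ] Y, Function.Injective j ∨ Function.Surjective j := by
  rcases le_total (Cardinal.lift.{v} (Module.rank ℂ F)) (Cardinal.lift.{u} (Module.rank ℂ Y)) with h | h
  · obtain ⟨j, hj⟩ := lift_rank_le_iff_exists_linearMap.mp h
    exact ⟨j, Or.inl hj⟩
  · obtain ⟨j, hj⟩ := lift_rank_le_iff_exists_linearMap.mp h
    obtain ⟨k, hk⟩ := j.exists_leftInverse_of_injective (LinearMap.ker_eq_bot.mpr hj)
    exact ⟨k, Or.inr fun y => ⟨j y, by rw [← LinearMap.comp_apply, hk]; rfl⟩⟩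

lemma ss_exists_unit {X F : Type*} [NormedAddCommGroup X] [NormedSpace ℂ X] [CompleteSpace X]
    [NormedAddCommGroup F] [NormedSpace ℂ F] [FiniteDimensional ℂ F]
    (B : X →L[ℂ] X) (z : ℂ) (Q : X →L[ℂ] F) (hQ : Function.Surjective Q) (d : ℝ) (hd : 0 < d)
    (hb : ∀ x, Q x = 0 → d * ‖x‖ ≤ ‖(z • (1 : X →L[ℂ] X) - B) x‖)
    (hz : ∀ ε : ℝ, 0 < ε → ∃ w : ℂ, ‖w - z‖ < ε ∧ IsUnit (w • (1 : X →L[ℂ] X) - B)) :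
    ∃ L : F →L[ℂ] X, IsUnit (z • (1 : X →L[ℂ] X) - B + L ∘L Q) := by
  obtain ⟨s, hs⟩ := ContinuousLinearMap.exists_rightInverse_of_surjective Q
    (LinearMap.range_eq_top.mpr hQ)
  have hQs : ∀ v, Q (s v) = v := fun v => by
    have := congrArg (fun h : F →L[ℂ] F => h v) hs
    simpa using this
  set A : X →L[ℂ] X := z • (1 : X →L[ℂ] X) - B with hA
  let Y : Submodule ℂ X := (LinearMap.ker (Q : X →ₗ[ℂ] F)).map (A : X →ₗ[ℂ] X)
  have hY : ∀ x, Q x = 0 → A x ∈ Y := fun x hx => ⟨x, hx, rfl⟩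
  obtain ⟨j, hj⟩ := ss_inj_or_surj (F := F) (Y := X ⧸ Y)
  obtain ⟨g, hg⟩ := Y.mkQ.exists_rightInverse_of_surjective (Submodule.range_mkQ Y)
  have hg' : ∀ y, Y.mkQ (g y) = y := fun y => congrArg (fun h => h y) hg
  let J : F →L[ℂ] X := LinearMap.toContinuousLinearMap (g ∘ₗ j)
  have hJ : ∀ v, J v = g (j v) := fun v => rfl
  have hmJ : ∀ v, Y.mkQ (J v) = j v := fun v => hg' _
  have fr : ∀ (D W : X →L[ℂ] X) (L : F →L[ℂ] X), IsUnit D → W = D + L ∘L Q →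
      (Function.Injective W → IsUnit W) ∧ (Function.Surjective W → IsUnit W) := by
    rintro D W L ⟨D, rfl⟩ rfl
    have := ss_finite_rank D L Q hQ
      (LinearMap.id + (Q : X →ₗ[ℂ] F) ∘ₗ ((↑D⁻¹ : X →L[ℂ] X) : X →ₗ[ℂ] X) ∘ₗ (L : F →ₗ[ℂ] X))
      (fun v => rfl)
    exact ⟨this.1, this.2.1⟩
  set L : F →L[ℂ] X := J - A ∘L s with hL
  set D : X →L[ℂ] X := A + L ∘L Q with hD
  have hDx : ∀ x, D x = A (x - s (Q x)) + J (Q x) := fun x => by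
    simp only [hD, hL, add_apply, ContinuousLinearMap.comp_apply,
      sub_apply, map_sub]
    abel
  have hQz : ∀ x, Q (x - s (Q x)) = 0 := fun x => by rw [map_sub, hQs, sub_self]
  have hinj : Function.Injective j := by
    rcases hj with hj | hj
    · exact hj
    have hDs : Function.Surjective D := by
      intro y
      obtain ⟨v, hv⟩ := hj (Y.mkQ y)
      have h1 : y - J v ∈ Y := by
        rw [← Submodule.Quotient.mk_eq_zero, ← Submodule.mkQ_apply, map_sub, hmJ, hv, sub_self]
      obtain ⟨n, hn, hn2⟩ := h1
      have hn' : Q n = 0 := hn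
      have hn2' : A n = y - J v := hn2
      refine ⟨n + s v, ?_⟩
      have : Q (n + s v) = v := by rw [map_add, hn', hQs, zero_add]
      rw [hDx, this, add_sub_cancel_right, hn2', sub_add_cancel]
    obtain ⟨ε, hε, hp⟩ := ss_surj_perturb D hDs
    set E : X →L[ℂ] X := 1 - s ∘L Q with hE
    obtain ⟨w, hw, hwu⟩ := hz (ε / (‖E‖ + 1)) (by positivity)
    have h1 : ‖(w - z) • E‖ < ε := by
      rw [norm_smul]
      rw [lt_div_iff₀ (by positivity)] at hw
      calc ‖w - z‖ * ‖E‖ ≤ ‖w - z‖ * (‖E‖ + 1) := by gcongr; linarith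
        _ < ε := hw
    have h2 := hp _ h1
    have h3 : D + (w - z) • E = (w • (1 : X →L[ℂ] X) - B) +
        (J - (w • (1 : X →L[ℂ] X) - B) ∘L s) ∘L Q := by
      ext x
      simp [hD, hL, hA, hE, sub_smul, smul_sub]
      abel
    have h4 := (fr _ _ _ hwu h3).2 h2
    have h5 := (ContinuousLinearMap.isUnit_iff_bijective.mp h4).1
    rw [injective_iff_map_eq_zero] at h5 ⊢
    intro v hv
    have h6 := h5 (s v) (by
      rw [add_apply, hDx, hQs, sub_self, map_zero, zero_add, hJ, hv, map_zero]
      simp [hE, hQs])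
    rw [← hQs v, h6, map_zero]
  have hDinj : Function.Injective D := by
    rw [injective_iff_map_eq_zero] at hinj ⊢
    intro x hx
    have h0 := hx
    rw [hDx] at hx
    have h1 := congrArg Y.mkQ hx
    rw [map_add, hmJ, map_zero, Submodule.mkQ_apply,
      (Submodule.Quotient.mk_eq_zero Y).mpr (hY _ (hQz x)), zero_add] at h1
    have h2 := hinj _ h1
    have h3 := hb x h2
    rw [h2] at hx
    simp only [map_zero, sub_zero, add_zero] at hx
    rw [hx, norm_zero] at h3
    have : ‖x‖ ≤ 0 := by
      by_contra hcon
      push Not at hcon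
      have := mul_pos hd hcon
      linarith
    simpa using this
  have hclosed : IsClosed (Set.range D) := by
    let N : Submodule ℂ X := LinearMap.ker (Q : X →ₗ[ℂ] F)
    have hN : IsClosed (N : Set X) := Q.isClosed_ker
    have : N.CoFG := Submodule.CoFG.ker _
    have : CompleteSpace N := hN.completeSpace_coe
    have hanti : AntilipschitzWith (Real.toNNReal d⁻¹) (D.domRestrict N) := by
      apply ContinuousLinearMap.antilipschitz_of_bound
      rintro ⟨x, hx⟩
      have hx' : Q x = 0 := hx
      have := hb x hx'
      have h2 : D.domRestrict N ⟨x, hx⟩ = A x := by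
        change D x = A x
        rw [hDx, hx']; simp
      rw [h2, Real.coe_toNNReal _ (by positivity)]
      change ‖x‖ ≤ _
      rw [inv_mul_eq_div, le_div_iff₀ hd]
      linarith
    have hce := hanti.isClosedEmbedding (D.domRestrict N).uniformContinuous
    have := (D.isStrictMap_isClosed_range_iff_restrict N hN).mpr
      ⟨hce.isEmbedding.isStrictMap, hce.isClosed_range⟩
    exact this.2
  obtain ⟨K, hK⟩ := D.antilipschitz_of_injective_of_isClosed_range hDinj hclosed
  obtain ⟨c, hc, hcb⟩ : ∃ c : ℝ, 0 < c ∧ ∀ x, c * ‖x‖ ≤ ‖D x‖ := by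
    refine ⟨(K + 1 : ℝ)⁻¹, by positivity, fun x => ?_⟩
    have h1 : ‖x‖ ≤ K * ‖D x‖ := by
      have := hK.le_mul_dist x 0
      simpa using this
    rw [inv_mul_le_iff₀ (by positivity)]
    have := norm_nonneg (D x)
    linarith
  obtain ⟨w, hw, hwu⟩ := hz (c / 4) (by positivity)
  have hWb : ∀ x, c / 2 * ‖x‖ ≤ ‖(D + (w - z) • (1 : X →L[ℂ] X)) x‖ := fun x => by
    have h1 : D x = (D + (w - z) • (1 : X →L[ℂ] X)) x - (w - z) • x := by simp
    have h2 := norm_sub_le ((D + (w - z) • (1 : X →L[ℂ] X)) x) ((w - z) • x)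
    rw [← h1, norm_smul] at h2
    have h3 : ‖w - z‖ * ‖x‖ ≤ c / 4 * ‖x‖ := by gcongr
    have h4 := hcb x
    have := mul_nonneg hc.le (norm_nonneg x)
    linarith
  have hWu : IsUnit (D + (w - z) • (1 : X →L[ℂ] X)) := by
    refine (fr _ _ L hwu ?_).1 ?_
    · simp only [hD, hA, sub_smul]; abel
    · rw [injective_iff_map_eq_zero]
      intro x hx
      have := hWb x
      rw [hx, norm_zero] at this
      have : ‖x‖ ≤ 0 := by
        by_contra hcon
        push Not at hcon
        have := mul_pos (half_pos hc) hcon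
        linarith
      simpa using this
  refine ⟨L, ?_⟩
  obtain ⟨U, hU⟩ := hWu
  have hUn : ‖(↑U⁻¹ : X →L[ℂ] X)‖ ≤ 2 / c := by
    refine ContinuousLinearMap.opNorm_le_bound _ (by positivity) fun x => ?_
    have h1 := hWb ((↑U⁻¹ : X →L[ℂ] X) x)
    rw [← hU, ← mul_apply_eq_comp, Units.mul_inv, one_apply_eq_self] at h1
    rw [div_mul_eq_mul_div, le_div_iff₀ hc]
    linarith
  have h1 : D = ↑U * (1 - (w - z) • (↑U⁻¹ : X →L[ℂ] X)) := by
    rw [mul_sub, mul_one, mul_smul_comm, Units.mul_inv, hU, add_sub_cancel_right]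
  rw [← hD, h1]
  refine U.isUnit.mul (isUnit_one_sub_of_norm_lt_one ?_)
  rw [norm_smul]
  calc ‖w - z‖ * ‖(↑U⁻¹ : X →L[ℂ] X)‖ ≤ c / 4 * (2 / c) := by gcongr
    _ = 1 / 2 := by field_simp; norm_num
    _ < 1 := by norm_num

lemma ss_local {X F : Type*} [NormedAddCommGroup X] [NormedSpace ℂ X] [CompleteSpace X]
    [NormedAddCommGroup F] [NormedSpace ℂ F] [FiniteDimensional ℂ F]
    (B : X →L[ℂ] X) (z : ℂ) (Q : X →L[ℂ] F) (hQ : Function.Surjective Q)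
    (L : F →L[ℂ] X) (hu : IsUnit (z • (1 : X →L[ℂ] X) - B + L ∘L Q))
    (hz : ∃ᶠ w in 𝓝 z, IsUnit (w • (1 : X →L[ℂ] X) - B)) :
    ∀ᶠ w in 𝓝[≠] z, IsUnit (w • (1 : X →L[ℂ] X) - B) := by
  classical
  set M : ℂ → (X →L[ℂ] X) := fun w => w • (1 : X →L[ℂ] X) - B + L ∘L Q with hM
  have hMd : Differentiable ℂ M := by
    intro w
    simp only [hM]
    fun_prop
  have hMa : AnalyticAt ℂ M z := hMd.analyticAt z
  have hinva : AnalyticAt ℂ (fun w => Ring.inverse (M w)) z := by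
    obtain ⟨U, hU⟩ := hu
    have h1 : AnalyticAt ℂ (Ring.inverse : (X →L[ℂ] X) → _) (M z) := by
      have : M z = U := hU.symm
      rw [this]
      exact analyticAt_inverse U
    exact h1.comp hMa
  have hMu : ∀ᶠ w in 𝓝 z, IsUnit (M w) :=
    hMd.continuous.continuousAt.eventually (Units.isOpen.mem_nhds hu)
  let m : ℂ → (F →ₗ[ℂ] F) := fun w =>
    LinearMap.id - (Q : X →ₗ[ℂ] F) ∘ₗ ((Ring.inverse (M w) : X →L[ℂ] X) : X →ₗ[ℂ] X) ∘ₗ (L : F →ₗ[ℂ] X)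
  have hiff : ∀ᶠ w in 𝓝 z, (IsUnit (w • (1 : X →L[ℂ] X) - B) ↔ LinearMap.det (m w) ≠ 0) := by
    filter_upwards [hMu] with w hw
    obtain ⟨U, hU⟩ := hw
    have := (ss_finite_rank U (-L) Q hQ (m w) (fun v => by
      simp only [m, ← hU, Ring.inverse_unit]
      simp [sub_eq_add_neg])).2.2
    rw [← this, hU]
    have h2 : M w + (-L) ∘L Q = w • (1 : X →L[ℂ] X) - B := by
      simp [hM]
    rw [h2]
  let b := Module.finBasis ℂ F
  have hdet : AnalyticAt ℂ (fun w => LinearMap.det (m w)) z := by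
    have h1 : (fun w => LinearMap.det (m w)) = fun w =>
        ∑ σ : Equiv.Perm (Fin (Module.finrank ℂ F)), ((Equiv.Perm.sign σ : ℤ) : ℂ) *
          ∏ i, LinearMap.toMatrix b b (m w) (σ i) i := by
      funext w
      rw [← LinearMap.det_toMatrix b, Matrix.det_apply']
    rw [h1]
    refine Finset.analyticAt_fun_sum _ fun σ _ => ?_
    refine analyticAt_const.mul ?_
    refine Finset.analyticAt_fun_prod _ fun i _ => ?_
    let φ : (X →L[ℂ] X) →L[ℂ] ℂ :=
      (LinearMap.toContinuousLinearMap (b.coord (σ i)) ∘L Q) ∘L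
        (ContinuousLinearMap.apply ℂ X (L (b i)))
    have h2 : (fun w => LinearMap.toMatrix b b (m w) (σ i) i) = fun w =>
        b.repr (b i) (σ i) - φ (Ring.inverse (M w)) := by
      funext w
      rw [LinearMap.toMatrix_apply]
      simp [m, φ]
    rw [h2]
    exact analyticAt_const.sub ((φ.analyticAt _).comp hinva)
  rcases hdet.eventually_eq_zero_or_eventually_ne_zero with h | h
  · exfalso
    obtain ⟨w, h1, h2, h3⟩ := (hz.and_eventually (hiff.and h)).exists
    exact (h2.mp h1) h3
  · filter_upwards [h, hiff.filter_mono nhdsWithin_le_nhds] with w h1 h2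
    exact h2.mpr h1

lemma ss_step {X : Type*} [NormedAddCommGroup X] [NormedSpace ℂ X] [CompleteSpace X]
    (S : X →L[ℂ] X) (hS : StrictlySingular S) (T : X →L[ℂ] X) (z : ℂ)
    (hzT : z ∉ spectrum ℂ T) (hz : z ∈ closure (spectrum ℂ (S + T))ᶜ) :
    ∀ᶠ w in 𝓝[≠] z, w ∈ (spectrum ℂ (S + T))ᶜ := by
  classical
  have hmem : ∀ (C : X →L[ℂ] X) (w : ℂ),
      w ∈ (spectrum ℂ C)ᶜ ↔ IsUnit (w • (1 : X →L[ℂ] X) - C) := fun C w => by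
    rw [Set.mem_compl_iff, spectrum.notMem_iff, Algebra.algebraMap_eq_smul_one]
  have hfreq : ∃ᶠ w in 𝓝 z, IsUnit (w • (1 : X →L[ℂ] X) - (S + T)) := by
    have := mem_closure_iff_frequently.mp hz
    simpa only [hmem] using this
  simp only [hmem]
  obtain ⟨U, hU⟩ := (hmem T z).mp hzT
  have hlow : ∃ c : ℝ, 0 < c ∧ ∀ x,
      c * ‖x‖ ≤ ‖(z • (1 : X →L[ℂ] X) - (S + T)) x‖ + ‖S x‖ := by
    refine ⟨(‖(↑U⁻¹ : X →L[ℂ] X)‖ + 1)⁻¹, by positivity, fun x => ?_⟩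
    rw [inv_mul_le_iff₀ (by positivity)]
    have h1 : (U : X →L[ℂ] X) x = (z • (1 : X →L[ℂ] X) - (S + T)) x + S x := by
      rw [hU]; simp; abel
    have h2 : x = (↑U⁻¹ : X →L[ℂ] X) ((U : X →L[ℂ] X) x) := by
      rw [← mul_apply_eq_comp]; simp
    have h3 : ‖x‖ ≤ ‖(↑U⁻¹ : X →L[ℂ] X)‖ * ‖(U : X →L[ℂ] X) x‖ := by
      conv_lhs => rw [h2]
      exact ContinuousLinearMap.le_opNorm _ _
    have h4 : ‖(U : X →L[ℂ] X) x‖ ≤ ‖(z • (1 : X →L[ℂ] X) - (S + T)) x‖ + ‖S x‖ := by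
      rw [h1]; exact norm_add_le _ _
    calc ‖x‖ ≤ _ := h3
      _ ≤ (‖(↑U⁻¹ : X →L[ℂ] X)‖ + 1) * ‖(U : X →L[ℂ] X) x‖ := by gcongr; linarith
      _ ≤ _ := by gcongr
  obtain ⟨c, hc, hlow⟩ := hlow
  obtain ⟨s, d, hd, hsd⟩ := ss_exists_functionals S hS _ c hc hlow
  let Q₀ : X →L[ℂ] (s → ℂ) := ContinuousLinearMap.pi fun f => f.1
  let Q : X →L[ℂ] (LinearMap.range (Q₀ : X →ₗ[ℂ] (s → ℂ))) :=
    Q₀.codRestrict _ (fun x => ⟨x, rfl⟩)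
  have hQ : Function.Surjective Q := by
    rintro ⟨_, x, rfl⟩
    exact ⟨x, rfl⟩
  have hb : ∀ x, Q x = 0 → d * ‖x‖ ≤ ‖(z • (1 : X →L[ℂ] X) - (S + T)) x‖ := by
    intro x hx
    refine hsd x fun f hf => ?_
    have h1 : Q₀ x = 0 := congrArg Subtype.val hx
    exact congrFun h1 ⟨f, hf⟩
  obtain ⟨L, hL⟩ := ss_exists_unit (S + T) z Q hQ d hd hb (fun ε hε => by
    obtain ⟨w, h1, h2⟩ := (hfreq.and_eventually (Metric.ball_mem_nhds z hε)).exists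
    exact ⟨w, by simpa [dist_eq_norm] using h2, h1⟩)
  exact ss_local (S + T) z Q hQ L hL hfreq

theorem stmt_9 {X : Type*} [NormedAddCommGroup X] [NormedSpace ℂ X] [CompleteSpace X]
    (S : X →L[ℂ] X) (hS : StrictlySingular S) (T : X →L[ℂ] X)
    (hT : (spectrum ℂ T).Countable) :
    (spectrum ℂ (S + T)).Countable ∧
    ∀ z : ℂ, AccPt z (𝓟 (spectrum ℂ (S + T))) → z = 0 ∨ z ∈ spectrum ℂ T := by
  have hconn : IsPreconnected (spectrum ℂ T)ᶜ :=
    (hT.isConnected_compl_of_one_lt_rank (by simp)).isPreconnected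
  set ρ := (spectrum ℂ (S + T))ᶜ with hρ
  have hsub : (spectrum ℂ T)ᶜ ⊆ interior (closure ρ) := by
    refine hconn.subset_left_of_subset_union isOpen_interior
      (isClosed_closure (s := ρ)).isOpen_compl ?_ ?_ ?_
    · exact Set.disjoint_compl_right_iff_subset.mpr interior_subset
    · intro z hz
      by_cases hzc : z ∈ closure ρ
      · left
        have h1 := ss_step S hS T z hz hzc
        rw [mem_interior_iff_mem_nhds]
        rw [eventually_nhdsWithin_iff] at h1
        filter_upwards [h1] with w hw
        by_cases hwz : w = z
        · rw [hwz]; exact hzc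
        · exact subset_closure (hw hwz)
      · exact Or.inr hzc
    · have hcpt : IsCompact (spectrum ℂ T ∪ spectrum ℂ (S + T)) :=
        (spectrum.isCompact T).union (spectrum.isCompact (S + T))
      obtain ⟨w, hw⟩ := (Set.ne_univ_iff_exists_notMem _).mp hcpt.ne_univ
      rw [Set.mem_union, not_or] at hw
      refine ⟨w, hw.1, ?_⟩
      have hop : IsOpen ρ := (spectrum.isClosed (S + T)).isOpen_compl
      exact interior_mono subset_closure (hop.interior_eq.symm ▸ hw.2)
  have hev : ∀ z, z ∉ spectrum ℂ T → ∀ᶠ w in 𝓝[≠] z, w ∈ ρ := fun z hz =>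
    ss_step S hS T z hz (interior_subset (hsub hz))
  refine ⟨?_, ?_⟩
  · have hcount : (spectrum ℂ (S + T) \ spectrum ℂ T).Countable := by
      refine (HereditarilyLindelofSpace.isLindelof _).countable ?_
      rw [discreteTopology_subtype_iff]
      intro z hz
      rw [← _root_.disjoint_iff, Filter.disjoint_principal_right]
      filter_upwards [hev z hz.2] with w hw hw2
      exact hw hw2.1
    refine (hT.union hcount).mono ?_
    rw [Set.union_sdiff_self]
    exact Set.subset_union_right
  · intro z hz
    right
    by_contra hzT
    rw [accPt_iff_frequently_nhdsNE] at hz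
    exact hz (hev z hzT)
end

section
/- Let X be a complex infinite-dimensional Banach space, let S be a strictly singular bounded linear operator on X, and let λ ∈ ℂ. Then σ(λ·I + S) = λ + σ(S); this spectrum is at most countable, contains λ, and λ is its only possible accumulation point (every accumulation point of σ(λ·I + S) equals λ). -/
open Filter Topology

lemma ss_coeff {X : Type*} [NormedAddCommGroup X] [NormedSpace ℂ X]
    (x : ℕ → X) (f : ℕ → StrongDual ℂ X) (hx : ∀ n, ‖x n‖ = 1) (hf : ∀ n, ‖f n‖ ≤ 1)
    (hfx : ∀ n, f n (x n) = 1) (h0 : ∀ m n, m < n → f m (x n) = 0)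
    (n : ℕ) (a : ℕ → ℂ) (j : ℕ) (hj : j < n) :
    ‖a j‖ ≤ 2 ^ j * ‖∑ i ∈ Finset.range n, a i • x i‖ := by
  induction j using Nat.strong_induction_on with
  | _ j ih =>
  set y := ∑ i ∈ Finset.range n, a i • x i with hy
  have h1 : f j y = ∑ i ∈ Finset.range j, a i * f j (x i) + a j := by
    rw [hy, map_sum]
    have : Finset.range (j+1) ⊆ Finset.range n := Finset.range_subset_range.2 hj
    rw [← Finset.sum_subset this]
    · rw [Finset.sum_range_succ]; simp [hfx]
    · intro i _ hi
      simp only [Finset.mem_range, not_lt] at hi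
      simp [h0 j i (by omega)]
  have h2 : a j = f j y - ∑ i ∈ Finset.range j, a i * f j (x i) := by rw [h1]; ring
  have h3 : ‖f j y‖ ≤ ‖y‖ := by
    calc _ ≤ ‖f j‖ * ‖y‖ := (f j).le_opNorm y
      _ ≤ 1 * ‖y‖ := by gcongr; exact hf j
      _ = _ := one_mul _
  have h4 : ‖∑ i ∈ Finset.range j, a i * f j (x i)‖ ≤ ∑ i ∈ Finset.range j, 2 ^ i * ‖y‖ := by
    refine norm_sum_le_of_le _ fun i hi => ?_
    simp only [Finset.mem_range] at hi
    rw [norm_mul]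
    have h5 : ‖f j (x i)‖ ≤ 1 := by
      calc _ ≤ ‖f j‖ * ‖x i‖ := (f j).le_opNorm _
        _ ≤ 1 := by rw [hx]; simpa using hf j
    calc ‖a i‖ * ‖f j (x i)‖ ≤ ‖a i‖ * 1 := by gcongr
      _ ≤ _ := by rw [mul_one]; exact ih i hi (by omega)
  have h6 : ∑ i ∈ Finset.range j, (2:ℝ) ^ i = 2 ^ j - 1 := by
    rw [geom_sum_eq (by norm_num)]; norm_num
  rw [← Finset.sum_mul, h6] at h4
  rw [h2]
  calc _ ≤ _ := norm_sub_le _ _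
    _ ≤ ‖y‖ + (2 ^ j - 1) * ‖y‖ := add_le_add h3 h4
    _ = _ := by ring

lemma ss_bddBelow {X : Type*} [NormedAddCommGroup X] [NormedSpace ℂ X]
    (S : X →L[ℂ] X) (hS : StrictlySingular S) (μ : ℂ) (hμ : μ ≠ 0) :
    ∃ N : Submodule ℂ X, IsClosed (N : Set X) ∧ N.CoFG ∧
      ∃ c : ℝ, 0 < c ∧ ∀ x ∈ N, c * ‖x‖ ≤ ‖S x - μ • x‖ := by
  by_contra hcon
  push Not at hcon
  have hm : 0 < ‖μ‖ := norm_pos_iff.2 hμ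
  let ε : ℕ → ℝ := fun n => ‖μ‖ / 4 * (1/4) ^ n
  have hε : ∀ n, 0 < ε n := fun n => by positivity
  obtain ⟨g, hg, hr⟩ := exists_seq_of_forall_finset_exists
    (α := ℕ × X × StrongDual ℂ X)
    (fun p => ‖p.2.1‖ = 1 ∧ ‖p.2.2‖ ≤ 1 ∧ p.2.2 p.2.1 = 1 ∧ ‖S p.2.1 - μ • p.2.1‖ ≤ ε p.1)
    (fun p q => p.1 < q.1 ∧ p.2.2 q.2.1 = 0) (by
      intro s _
      let Φ : X →L[ℂ] (s → ℂ) := ContinuousLinearMap.pi fun p => p.1.2.2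
      obtain ⟨x, hxN, hx⟩ := hcon (LinearMap.ker Φ.toLinearMap) Φ.isClosed_ker
        (Submodule.CoFG.ker _) (ε (s.sup (fun p => p.1) + 1)) (hε _)
      have hx0 : x ≠ 0 := by rintro rfl; simp at hx
      have hxn : ‖x‖ ≠ 0 := norm_ne_zero_iff.2 hx0
      let y : X := (‖x‖⁻¹ : ℂ) • x
      have hy : ‖y‖ = 1 := by simp [y, norm_smul, hxn]
      obtain ⟨f, hf1, hf2⟩ := exists_dual_vector ℂ y (by rw [hy]; simp)
      refine ⟨(s.sup (fun p => p.1) + 1, y, f), ⟨hy, hf1.le, by rw [hf2, hy]; simp, ?_⟩, ?_⟩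
      · have : S y - μ • y = (‖x‖⁻¹ : ℂ) • (S x - μ • x) := by
          simp only [y, map_smul, smul_sub, smul_comm μ]
        simp only
        rw [this, norm_smul]
        simp only [norm_inv, Complex.norm_real, norm_norm]
        rw [inv_mul_le_iff₀ (by positivity)]
        rw [mul_comm]; exact hx.le
      · intro p hp
        refine ⟨Nat.lt_succ_of_le (Finset.le_sup (f := fun p : ℕ × X × StrongDual ℂ X => p.1) hp), ?_⟩
        have : Φ x = 0 := hxN
        have : p.2.2 x = 0 := congrFun this ⟨p, hp⟩
        simp [y, this])
  let x : ℕ → X := fun n => (g n).2.1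
  let f : ℕ → StrongDual ℂ X := fun n => (g n).2.2
  have hmono : StrictMono fun n => (g n).1 := fun m n h => (hr m n h).1
  have hle : ∀ n, n ≤ (g n).1 := fun n => hmono.le_apply
  have key := ss_coeff x f (fun n => (hg n).1) (fun n => (hg n).2.1) (fun n => (hg n).2.2.1)
    (fun m n h => (hr m n h).2)
  have hT : ∀ n, ‖S (x n) - μ • x n‖ ≤ ‖μ‖ / 4 * (1/4) ^ n := fun n =>
    (hg n).2.2.2.trans (by
      simp only [ε]
      gcongr ‖μ‖ / 4 * ?_
      exact pow_le_pow_of_le_one (by norm_num) (by norm_num) (hle n))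
  have hfin : ∀ l : ℕ →₀ ℂ, ∃ n, (∀ i, l i ≠ 0 → i < n) ∧
      (l.sum fun i c => c • x i) = ∑ i ∈ Finset.range n, l i • x i := by
    intro l
    have h : ∀ i, l i ≠ 0 → i < l.support.sup id + 1 := fun i hi => Nat.lt_succ_of_le
      (Finset.le_sup (f := id) (Finsupp.mem_support_iff.2 hi))
    refine ⟨l.support.sup id + 1, h, ?_⟩
    apply Finset.sum_subset
    · intro i hi; simpa using h i (by simpa using hi)
    · intro i _ hi; simp at hi; simp [hi]
  have hli : LinearIndependent ℂ x := by
    rw [linearIndependent_iff]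
    intro l hl
    obtain ⟨n, h1, h2⟩ := hfin l
    rw [Finsupp.linearCombination_apply, h2] at hl
    ext i
    by_contra hi
    have := key n l i (h1 i hi)
    rw [hl] at this
    simp at this
    exact hi this
  refine hS (Submodule.span ℂ (Set.range x)) ?_ ⟨‖μ‖ / 2, by positivity, ?_⟩
  · intro hfd
    have h2 : LinearIndependent ℂ (fun n => (⟨x n, Submodule.subset_span ⟨n, rfl⟩⟩ :
        Submodule.span ℂ (Set.range x))) :=
      LinearIndependent.of_comp (Submodule.subtype _) hli
    have := h2.finite
    exact not_finite ℕ
  · intro y hy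
    obtain ⟨l, hl⟩ := Finsupp.mem_span_range_iff_exists_finsupp.1 hy
    obtain ⟨n, -, h2⟩ := hfin l
    rw [hl] at h2
    have k2 := key n l
    rw [← h2] at k2
    have h3 : S y - μ • y = ∑ i ∈ Finset.range n, l i • (S (x i) - μ • x i) := by
      rw [h2]; simp [Finset.smul_sum, smul_sub, smul_comm μ]
    have h4 : ‖S y - μ • y‖ ≤ ∑ i ∈ Finset.range n, (‖μ‖ / 4 * ‖y‖) * (1/2) ^ i := by
      rw [h3]
      refine norm_sum_le_of_le _ fun i hi => ?_
      rw [norm_smul]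
      calc _ ≤ (2 ^ i * ‖y‖) * (‖μ‖ / 4 * (1/4) ^ i) := by
            gcongr
            · exact k2 i (by simpa using hi)
            · exact hT i
        _ = (‖μ‖ / 4 * ‖y‖) * (2 ^ i * (1/4) ^ i) := by ring
        _ = _ := by rw [← mul_pow]; norm_num
    have h5 : ∑ i ∈ Finset.range n, (1/2 : ℝ) ^ i ≤ 2 := sum_geometric_two_le n
    rw [← Finset.mul_sum] at h4
    have h6 : (‖μ‖ / 4 * ‖y‖) * ∑ i ∈ Finset.range n, (1/2 : ℝ) ^ i ≤ (‖μ‖ / 4 * ‖y‖) * 2 := by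
      gcongr
    have h7 : ‖μ‖ * ‖y‖ ≤ ‖S y‖ + ‖S y - μ • y‖ := by
      rw [← norm_smul]
      calc ‖μ • y‖ = ‖S y - (S y - μ • y)‖ := by congr 1; abel
        _ ≤ _ := norm_sub_le _ _
    linarith

lemma ss_proj {X : Type*} [NormedAddCommGroup X] [NormedSpace ℂ X] (s : Finset X) :
    ∀ W : Submodule ℂ X, IsClosed (W : Set X) → W ⊔ Submodule.span ℂ (s : Set X) = ⊤ →
    ∃ P : X →L[ℂ] X, (∀ x, P x ∈ W) ∧ (∀ x ∈ W, P x = x) ∧ ‖P‖ ≤ 3 ^ s.card := by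
  classical
  induction s using Finset.induction_on with
  | empty =>
    intro W _ h
    simp at h
    exact ⟨ContinuousLinearMap.id ℂ X, by simp [h], by simp, by
      simpa using ContinuousLinearMap.norm_id_le⟩
  | insert v s hv ih =>
    intro W hW h
    rw [Finset.coe_insert, Submodule.span_insert, ← sup_assoc] at h
    obtain ⟨P', h1, h2, h3⟩ := ih (W ⊔ Submodule.span ℂ {v})
      (Submodule.isClosed_sup_finiteDimensional _ _ hW) h
    rw [Finset.card_insert_of_notMem hv]
    by_cases hvW : v ∈ W
    · have : W ⊔ Submodule.span ℂ {v} = W := by simpa using hvW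
      rw [this] at h1 h2
      exact ⟨P', h1, h2, h3.trans (pow_le_pow_right₀ (by norm_num) (by omega))⟩
    have : IsClosed (W : Set X) := hW
    let q : X ⧸ W := Submodule.Quotient.mk v
    have hq : ‖q‖ ≠ 0 := by
      rw [norm_ne_zero_iff]; simpa [q] using hvW
    have hq' : 0 < ‖q‖ := lt_of_le_of_ne (norm_nonneg _) hq.symm
    obtain ⟨g, hg1, hg2⟩ := exists_dual_vector ℂ q hq
    obtain ⟨x, hx, hxn⟩ := Submodule.Quotient.norm_mk_lt q hq'
    have hxv : v - x ∈ W := by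
      rw [← Submodule.Quotient.eq]; exact hx.symm
    have hgm : ∀ y : X, ‖g (Submodule.Quotient.mk y)‖ ≤ ‖y‖ := fun y => by
      calc _ ≤ ‖g‖ * _ := g.le_opNorm _
        _ ≤ 1 * ‖y‖ := by rw [hg1]; gcongr; exact Submodule.Quotient.norm_mk_le W y
        _ = _ := one_mul _
    let f : X →ₗ[ℂ] ℂ := g.toLinearMap ∘ₗ W.mkQ
    let L : X →ₗ[ℂ] X := LinearMap.id - (LinearMap.toSpanSingleton ℂ X ((‖q‖⁻¹ : ℂ) • x)) ∘ₗ f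
    have hL : ∀ y, L y = y - (g (Submodule.Quotient.mk y)) • ((‖q‖⁻¹ : ℂ) • x) := fun y => rfl
    have hLb : ∀ y, ‖L y‖ ≤ 3 * ‖y‖ := fun y => by
      rw [hL]
      have : ‖(‖q‖⁻¹ : ℂ) • x‖ ≤ 2 := by
        rw [norm_smul]
        simp only [norm_inv, Complex.norm_real, norm_norm]
        rw [inv_mul_le_iff₀ hq']; linarith
      calc _ ≤ _ := norm_sub_le _ _
        _ ≤ ‖y‖ + ‖y‖ * 2 := by rw [norm_smul]; gcongr; exact hgm y
        _ = _ := by ring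
    let LL := L.mkContinuous 3 hLb
    refine ⟨LL ∘L P', ?_, ?_, ?_⟩
    · intro y
      obtain ⟨w, hw, a, ha⟩ : ∃ w ∈ W, ∃ a : ℂ, w + a • v = P' y := by
        simpa [Submodule.mem_sup, Submodule.mem_span_singleton] using h1 y
      change L (P' y) ∈ W
      rw [← ha, hL]
      have hw0 : (Submodule.Quotient.mk w : X ⧸ W) = 0 := by simpa using hw
      have e : g (Submodule.Quotient.mk (w + a • v)) = a * ‖q‖ := by
        rw [Submodule.Quotient.mk_add, hw0, Submodule.Quotient.mk_smul, zero_add, map_smul]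
        change a • g q = _
        rw [hg2]; rfl
      rw [e, smul_smul, mul_assoc, mul_inv_cancel₀ (by exact_mod_cast hq), mul_one, add_sub_assoc,
        ← smul_sub]
      exact W.add_mem hw (W.smul_mem _ hxv)
    · intro y hy
      change L (P' y) = y
      rw [h2 y (Submodule.mem_sup_left hy), hL]
      have hw0 : (Submodule.Quotient.mk y : X ⧸ W) = 0 := by simpa using hy
      simp [hw0]
    · calc _ ≤ ‖LL‖ * ‖P'‖ := ContinuousLinearMap.opNorm_comp_le _ _
        _ ≤ 3 * 3 ^ s.card := by
          gcongr
          exact L.mkContinuous_norm_le (by norm_num) hLb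
        _ = _ := by ring

lemma ss_isUnit_swap {V X : Type*} [NormedAddCommGroup X] [NormedSpace ℂ X]
    [NormedAddCommGroup V] [NormedSpace ℂ V] (a : V →L[ℂ] X) (b : X →L[ℂ] V)
    (h : IsUnit (1 - b ∘L a : V →L[ℂ] V)) : IsUnit (1 - a ∘L b : X →L[ℂ] X) := by
  obtain ⟨u, hu⟩ := h
  let w : V →L[ℂ] V := ((u⁻¹ : (V →L[ℂ] V)ˣ) : V →L[ℂ] V)
  have h1 : ∀ v, w v - b (a (w v)) = v := fun v => by
    have : (u : V →L[ℂ] V) * w = 1 := u.mul_inv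
    rw [hu] at this
    simpa using congrArg (fun T : V →L[ℂ] V => T v) this
  have h2 : ∀ v, w v - w (b (a v)) = v := fun v => by
    have : w * (u : V →L[ℂ] V) = 1 := u.inv_mul
    rw [hu] at this
    simpa using congrArg (fun T : V →L[ℂ] V => T v) this
  refine ⟨⟨1 - a ∘L b, 1 + a ∘L w ∘L b, ?_, ?_⟩, rfl⟩
  · ext x
    have h := congrArg a (h1 (b x))
    simp only [map_sub] at h
    change (x + a (w (b x))) - a (b (x + a (w (b x)))) = x
    rw [map_add, map_add, ← h]; abel
  · ext x
    have h := congrArg a (h2 (b x))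
    simp only [map_sub] at h
    change (x - a (b x)) + a (w (b (x - a (b x)))) = x
    rw [map_sub, map_sub, map_sub, h]; abel

lemma ss_isUnit_iff_det {V : Type*} [NormedAddCommGroup V] [NormedSpace ℂ V]
    [FiniteDimensional ℂ V] (A : V →L[ℂ] V) :
    IsUnit A ↔ LinearMap.det A.toLinearMap ≠ 0 := by
  rw [← isUnit_iff_ne_zero, ← LinearMap.isUnit_iff_isUnit_det]
  constructor
  · intro h
    exact h.map (ContinuousLinearMap.toLinearMapRingHom : (V →L[ℂ] V) →+* (V →ₗ[ℂ] V))
  · rintro ⟨u, hu⟩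
    refine ⟨⟨A, LinearMap.toContinuousLinearMap (u⁻¹ : (V →ₗ[ℂ] V)ˣ).1, ?_, ?_⟩, rfl⟩
    · ext x
      have := congrArg (fun T : V →ₗ[ℂ] V => T x) u.mul_inv
      rw [hu] at this
      exact this
    · ext x
      have := congrArg (fun T : V →ₗ[ℂ] V => T x) u.inv_mul
      rw [hu] at this
      exact this

lemma ss_det_diff {V : Type*} [NormedAddCommGroup V] [NormedSpace ℂ V]
    [FiniteDimensional ℂ V] :
    Differentiable ℂ (fun A : V →L[ℂ] V => LinearMap.det A.toLinearMap) := by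
  classical
  let b := Module.finBasis ℂ V
  have : (fun A : V →L[ℂ] V => LinearMap.det A.toLinearMap) =
      fun A => ∑ σ : Equiv.Perm (Fin (Module.finrank ℂ V)),
        ((Equiv.Perm.sign σ : ℤ) : ℂ) * ∏ i, b.repr (A (b i)) (σ i) := by
    ext A
    rw [← LinearMap.det_toMatrix b, Matrix.det_apply']
    simp [LinearMap.toMatrix_apply]
  rw [this]
  have h : ∀ i j, Differentiable ℂ (fun A : V →L[ℂ] V => b.repr (A (b i)) j) := fun i j => by
    let φ : V →L[ℂ] ℂ := LinearMap.toContinuousLinearMap (b.coord j)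
    have : (fun A : V →L[ℂ] V => b.repr (A (b i)) j) = fun A => φ (A (b i)) := rfl
    rw [this]
    fun_prop
  fun_prop

/-- Local analytic Fredholm theorem. -/
lemma ss_analytic {X : Type*} [NormedAddCommGroup X] [NormedSpace ℂ X] [CompleteSpace X]
    (A F : X →L[ℂ] X) (hF : FiniteDimensional ℂ (LinearMap.range F.toLinearMap))
    (h1 : IsUnit (1 - F)) (r : ℝ) (hr : r * ‖A‖ ≤ 1) (z0 μ : ℂ) (hμ : μ ∈ Metric.ball z0 r) :
    ∀ᶠ z in 𝓝[≠] μ, IsUnit (1 - (z - z0) • A - F) := by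
  let V := LinearMap.range F.toLinearMap
  let F' : X →L[ℂ] V := F.codRestrict V (fun x => ⟨x, rfl⟩)
  let ι : V →L[ℂ] X := V.subtypeL
  have hFF : ι ∘L F' = F := rfl
  let B : ℂ → (X →L[ℂ] X) := fun z => 1 - (z - z0) • A
  have hB : ∀ z ∈ Metric.ball z0 r, IsUnit (B z) := fun z hz => by
    apply isUnit_one_sub_of_norm_lt_one
    rw [norm_smul]
    rw [mem_ball_iff_norm] at hz
    rcases (norm_nonneg A).eq_or_lt with h | h
    · rw [← h]; simp
    · nlinarith
  let C : ℂ → (X →L[ℂ] X) := fun z => Ring.inverse (B z)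
  have hC : DifferentiableOn ℂ C (Metric.ball z0 r) := fun z hz => by
    apply DifferentiableAt.differentiableWithinAt
    apply DifferentiableAt.comp (g := Ring.inverse) (f := B)
    · obtain ⟨u, hu⟩ := hB z hz
      rw [← hu]
      exact differentiableAt_inverse (𝕜 := ℂ) u.isUnit
    · fun_prop
  let M : ℂ → (V →L[ℂ] V) := fun z => 1 - F' ∘L (C z ∘L ι)
  have hM : DifferentiableOn ℂ M (Metric.ball z0 r) := by
    have h1 : DifferentiableOn ℂ (fun z => C z ∘L ι) (Metric.ball z0 r) :=
      hC.clm_comp (differentiableOn_const ι)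
    exact (differentiableOn_const (1 : V →L[ℂ] V)).sub
      ((differentiableOn_const F').clm_comp h1)
  let d : ℂ → ℂ := fun z => LinearMap.det (M z).toLinearMap
  have hd : AnalyticOnNhd ℂ d (Metric.ball z0 r) :=
    ((ss_det_diff (V := V)).comp_differentiableOn hM).analyticOnNhd Metric.isOpen_ball
  have hz0 : z0 ∈ Metric.ball z0 r := Metric.mem_ball_self (Metric.pos_of_mem_ball hμ)
  have hd0 : d z0 ≠ 0 := by
    apply (ss_isUnit_iff_det _).1
    apply ss_isUnit_swap
    have : C z0 = 1 := by simp [C, B]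
    rw [this]
    exact h1
  have hev : ∀ᶠ z in 𝓝[≠] μ, d z ≠ 0 := by
    by_contra hcon
    have := hd.eqOn_zero_of_preconnected_of_frequently_eq_zero
      (convex_ball z0 r).isPreconnected hμ (by
        rw [Filter.not_eventually] at hcon
        exact hcon.mono (fun z hz => not_not.1 hz))
    exact hd0 (this hz0)
  have hev2 : ∀ᶠ z in 𝓝[≠] μ, z ∈ Metric.ball z0 r :=
    nhdsWithin_le_nhds (Metric.isOpen_ball.mem_nhds hμ)
  filter_upwards [hev, hev2] with z hz hzb
  have h2 : IsUnit (1 - (C z ∘L ι) ∘L F') := ss_isUnit_swap _ _ ((ss_isUnit_iff_det _).2 hz)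
  have h3 : 1 - (z - z0) • A - F = B z * (1 - (C z ∘L ι) ∘L F') := by
    have : (C z ∘L ι) ∘L F' = C z * F := rfl
    rw [this, mul_sub, ← mul_assoc, Ring.mul_inverse_cancel _ (hB z hzb), mul_one, one_mul]
  rw [h3]
  exact (hB z hzb).mul h2

lemma ss_isolated {X : Type*} [NormedAddCommGroup X] [NormedSpace ℂ X] [CompleteSpace X]
    (S : X →L[ℂ] X) (hS : StrictlySingular S) (μ : ℂ) (hμ : μ ≠ 0)
    (hcl : ∀ δ > 0, ∃ z0 : ℂ, ‖z0 - μ‖ < δ ∧ IsUnit (S - z0 • (1 : X →L[ℂ] X))) :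
    ∀ᶠ z in 𝓝[≠] μ, IsUnit (S - z • (1 : X →L[ℂ] X)) := by
  classical
  obtain ⟨N, hNc, hNf, c, hc, hcN⟩ := ss_bddBelow S hS μ hμ
  obtain ⟨K, hK⟩ := N.exists_isCompl
  obtain ⟨s, hs⟩ := hNf.fg_of_isCompl hK
  let κ : ℝ := 2 / c * 3 ^ s.card + 1
  have hκ : 0 < κ := by positivity
  obtain ⟨z0, hz0, u, hu⟩ := hcl (min (c/2) κ⁻¹) (by positivity)
  have hz1 : ‖z0 - μ‖ < c / 2 := hz0.trans_le (min_le_left _ _)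
  have hz2 : ‖z0 - μ‖ < κ⁻¹ := hz0.trans_le (min_le_right _ _)
  let R : X →L[ℂ] X := u
  let Ri : X →L[ℂ] X := (u⁻¹ : (X →L[ℂ] X)ˣ)
  have hR : ∀ x, R x = S x - z0 • x := fun x => by
    change (u : X →L[ℂ] X) x = _
    rw [hu]; rfl
  have hRRi' : R * Ri = 1 := u.mul_inv
  have hRiR' : Ri * R = 1 := u.inv_mul
  have hRRi : ∀ x, R (Ri x) = x := fun x => congrArg (fun T : X →L[ℂ] X => T x) hRRi'
  have hRiR : ∀ x, Ri (R x) = x := fun x => congrArg (fun T : X →L[ℂ] X => T x) hRiR'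
  have hRN : ∀ x ∈ N, c / 2 * ‖x‖ ≤ ‖R x‖ := fun x hx => by
    have h1 := hcN x hx
    have h2 : S x - μ • x = R x + (z0 - μ) • x := by rw [hR, sub_smul]; abel
    have h3 : ‖(z0 - μ) • x‖ ≤ c / 2 * ‖x‖ := by rw [norm_smul]; gcongr
    rw [h2] at h1
    have := norm_add_le (R x) ((z0 - μ) • x)
    linarith
  let W : Submodule ℂ X := N.comap Ri.toLinearMap
  have hWc : IsClosed (W : Set X) := hNc.preimage Ri.continuous
  have hWs : W ⊔ Submodule.span ℂ ((s.image R : Finset X) : Set X) = ⊤ := by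
    rw [Finset.coe_image, eq_top_iff]
    intro x _
    have : Ri x ∈ N ⊔ K := by rw [hK.sup_eq_top]; trivial
    obtain ⟨n, hn, k, hk, hnk⟩ := Submodule.mem_sup.1 this
    refine Submodule.mem_sup.2 ⟨R n, ?_, R k, ?_, ?_⟩
    · change Ri (R n) ∈ N
      rwa [hRiR]
    · have : Submodule.span ℂ (R '' (s : Set X)) = K.map R.toLinearMap := by
        rw [← hs, Submodule.map_span]; rfl
      rw [this]
      exact ⟨k, hk, rfl⟩
    · rw [← map_add, hnk, hRRi]
  obtain ⟨P, hP1, hP2, hP3⟩ := ss_proj (s.image R) W hWc hWs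
  replace hP3 : ‖P‖ ≤ 3 ^ s.card :=
    hP3.trans (pow_le_pow_right₀ (by norm_num) Finset.card_image_le)
  have hPP : P * P = P := by ext x; exact hP2 _ (hP1 x)
  have hRiP : ‖Ri * P‖ ≤ 2 / c * 3 ^ s.card := by
    refine ContinuousLinearMap.opNorm_le_bound _ (by positivity) fun x => ?_
    have h1 := hRN (Ri (P x)) (hP1 x)
    rw [hRRi] at h1
    have h2 : ‖P x‖ ≤ 3 ^ s.card * ‖x‖ := (P.le_opNorm x).trans (by gcongr)
    change ‖Ri (P x)‖ ≤ _
    calc ‖Ri (P x)‖ = 2 / c * (c / 2 * ‖Ri (P x)‖) := by field_simp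
      _ ≤ 2 / c * (3 ^ s.card * ‖x‖) :=
          mul_le_mul_of_nonneg_left (h1.trans h2) (by positivity)
      _ = _ := by ring
  obtain ⟨e, he0, hen⟩ : ∃ e : ℂ, e ≠ 0 ∧ ‖e‖ * ‖Ri * (1 - P)‖ ≤ 1 := by
    have he : 0 < (‖Ri * (1 - P)‖ + 1)⁻¹ := by positivity
    refine ⟨(((‖Ri * (1 - P)‖ + 1)⁻¹ : ℝ) : ℂ), Complex.ofReal_ne_zero.2 he.ne', ?_⟩
    rw [Complex.norm_real, Real.norm_of_nonneg he.le, inv_mul_le_iff₀ (by positivity)]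
    linarith
  let D : X →L[ℂ] X := P + e • (1 - P)
  let Di : X →L[ℂ] X := P + e⁻¹ • (1 - P)
  have hQ1 : P * (1 - P) = 0 := by rw [mul_sub, hPP, mul_one, sub_self]
  have hQ2 : (1 - P) * P = 0 := by rw [sub_mul, hPP, one_mul, sub_self]
  have hQ3 : (1 - P) * (1 - P) = 1 - P := by rw [mul_sub, hQ2, mul_one, sub_zero]
  have hD : IsUnit D := by
    refine ⟨⟨D, Di, ?_, ?_⟩, rfl⟩
    · simp only [D, Di, add_mul, mul_add, smul_mul_assoc, mul_smul_comm, hPP, hQ1, hQ2, hQ3,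
        smul_zero, smul_smul, mul_inv_cancel₀ he0, inv_mul_cancel₀ he0, one_smul,
        add_zero, zero_add]
      abel
    · simp only [D, Di, add_mul, mul_add, smul_mul_assoc, mul_smul_comm, hPP, hQ1, hQ2, hQ3,
        smul_zero, smul_smul, mul_inv_cancel₀ he0, inv_mul_cancel₀ he0, one_smul,
        add_zero, zero_add]
      abel
  let A : X →L[ℂ] X := Ri * D
  have hA : IsUnit A := IsUnit.mul (u⁻¹).isUnit hD
  have hAn : ‖A‖ ≤ κ := by
    have : A = Ri * P + e • (Ri * (1 - P)) := by
      simp only [A, D, mul_add, mul_smul_comm]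
    rw [this]
    refine (norm_add_le _ _).trans (add_le_add hRiP ?_)
    rw [norm_smul]
    exact hen
  let F : X →L[ℂ] X := 1 - A * R
  have hFe : F = (1 - e) • (Ri * (1 - P) * R) := by
    have h1 : D = 1 - (1 - e) • (1 - P) := by
      simp only [D, sub_smul, one_smul]; abel
    simp only [F, A]
    rw [h1, mul_sub, sub_mul, mul_one, hRiR', mul_smul_comm, smul_mul_assoc]
    abel
  have hfd1 : FiniteDimensional ℂ (LinearMap.range (1 - P).toLinearMap) := by
    have hle : LinearMap.range (1 - P).toLinearMap ≤
        (Submodule.span ℂ ((s.image R : Finset X) : Set X)).map (1 - P).toLinearMap := by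
      rintro _ ⟨x, rfl⟩
      have : x ∈ W ⊔ Submodule.span ℂ ((s.image R : Finset X) : Set X) := by
        rw [hWs]; trivial
      obtain ⟨w, hw, k, hk, rfl⟩ := Submodule.mem_sup.1 this
      refine ⟨k, hk, ?_⟩
      rw [map_add]
      have : (1 - P) w = 0 := by
        change w - P w = 0
        rw [hP2 w hw, sub_self]
      exact ((congrArg (· + (1 - P) k) this).trans (zero_add _)).symm
    exact Submodule.finiteDimensional_of_le hle
  have hfd : FiniteDimensional ℂ (LinearMap.range F.toLinearMap) := by
    have hle : LinearMap.range F.toLinearMap ≤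
        (LinearMap.range (1 - P).toLinearMap).map Ri.toLinearMap := by
      rintro _ ⟨x, rfl⟩
      rw [hFe]
      exact Submodule.smul_mem _ _ ⟨(1 - P) (R x), ⟨R x, rfl⟩, rfl⟩
    exact Submodule.finiteDimensional_of_le hle
  have hF1 : IsUnit (1 - F) := by
    simp only [F, sub_sub_cancel]
    exact hA.mul u.isUnit
  have hmain := ss_analytic A F hfd hF1 κ⁻¹ (by
    rw [inv_mul_le_iff₀ hκ]; linarith) z0 μ (by
    rw [mem_ball_iff_norm, norm_sub_rev]; exact hz2)
  filter_upwards [hmain] with z hz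
  have h1 : 1 - (z - z0) • A - F = A * (S - z • (1 : X →L[ℂ] X)) := by
    have : S - z • (1 : X →L[ℂ] X) = R - (z - z0) • 1 := by
      change _ = (u : X →L[ℂ] X) - _
      rw [hu, sub_smul]; abel
    rw [this, mul_sub, mul_smul_comm, mul_one]
    simp only [F]; abel
  rw [h1] at hz
  obtain ⟨v, hv⟩ := hA
  rw [← hv] at hz
  exact (Units.isUnit_units_mul v _).1 hz

lemma ss_mem {X : Type*} [NormedAddCommGroup X] [NormedSpace ℂ X]
    (S : X →L[ℂ] X) (z : ℂ) : z ∈ spectrum ℂ S ↔ ¬ IsUnit (S - z • (1 : X →L[ℂ] X)) := by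
  rw [spectrum.mem_iff, Algebra.algebraMap_eq_smul_one, ← IsUnit.neg_iff, neg_sub]

lemma ss_not_acc {X : Type*} [NormedAddCommGroup X] [NormedSpace ℂ X] [CompleteSpace X]
    (S : X →L[ℂ] X) (hS : StrictlySingular S) (μ : ℂ) (hμ : μ ≠ 0) :
    ∀ᶠ z in 𝓝[≠] μ, z ∉ spectrum ℂ S := by
  let A : Set ℂ := interior (spectrum ℂ S)
  let B : Set ℂ := {w | ∀ᶠ z in 𝓝[≠] w, z ∉ spectrum ℂ S}
  have hB : IsOpen B := by
    rw [isOpen_iff_mem_nhds]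
    intro w hw
    obtain ⟨ε, hε, h⟩ := Metric.mem_nhdsWithin_iff.1 (hw : _ ∈ 𝓝[≠] w)
    rw [Metric.mem_nhds_iff]
    refine ⟨ε, hε, fun z hz => ?_⟩
    by_cases hzw : z = w
    · rw [hzw]; exact hw
    · have h1 : Metric.ball w ε ∩ {w}ᶜ ∈ 𝓝 z :=
        (Metric.isOpen_ball.inter isOpen_compl_singleton).mem_nhds ⟨hz, hzw⟩
      exact nhdsWithin_le_nhds (Filter.mem_of_superset h1 h)
  have hcov : ∀ w, w ≠ 0 → w ∉ A → w ∈ B := by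
    intro w hw hwA
    have := ss_isolated S hS w hw (by
      intro δ hδ
      by_contra hcon
      push Not at hcon
      apply hwA
      rw [mem_interior_iff_mem_nhds, Metric.mem_nhds_iff]
      refine ⟨δ, hδ, fun z hz => ?_⟩
      rw [ss_mem]
      exact hcon z (by rwa [mem_ball_iff_norm] at hz))
    filter_upwards [this] with z hz
    rw [ss_mem, not_not]; exact hz
  by_contra hμB
  have hconn : IsPreconnected ({0}ᶜ : Set ℂ) :=
    (isConnected_compl_singleton_of_one_lt_rank (by simp) (0:ℂ)).isPreconnected
  obtain ⟨w, hw, hwA, hwB⟩ := hconn A B isOpen_interior hB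
    (fun w hw => by
      by_cases h : w ∈ A
      · exact Or.inl h
      · exact Or.inr (hcov w hw h))
    ⟨μ, hμ, by by_contra h; exact hμB (hcov μ hμ h)⟩
    (by
      let w : ℂ := ((‖S‖ * ‖(1 : X →L[ℂ] X)‖ + 1 : ℝ) : ℂ)
      have hpos : 0 < ‖S‖ * ‖(1 : X →L[ℂ] X)‖ + 1 := by positivity
      have hw0 : w ≠ 0 := Complex.ofReal_ne_zero.2 hpos.ne'
      refine ⟨w, hw0, hcov w hw0 fun h => ?_⟩
      have := spectrum.norm_le_norm_mul_of_mem (interior_subset h)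
      rw [Complex.norm_real, Real.norm_of_nonneg hpos.le] at this
      linarith)
  have h1 : ∀ᶠ z in 𝓝[≠] w, z ∈ spectrum ℂ S :=
    nhdsWithin_le_nhds (mem_interior_iff_mem_nhds.1 hwA)
  obtain ⟨z, hz1, hz2⟩ := (h1.and hwB).exists
  exact hz2 hz1

theorem stmt_10 {X : Type*} [NormedAddCommGroup X] [NormedSpace ℂ X] [CompleteSpace X]
    (hX : ¬ FiniteDimensional ℂ X) (S : X →L[ℂ] X) (hS : StrictlySingular S) (lam : ℂ) :
    spectrum ℂ (lam • ContinuousLinearMap.id ℂ X + S) = (fun μ => lam + μ) '' spectrum ℂ S ∧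
    (spectrum ℂ (lam • ContinuousLinearMap.id ℂ X + S)).Countable ∧
    lam ∈ spectrum ℂ (lam • ContinuousLinearMap.id ℂ X + S) ∧
    ∀ z : ℂ, AccPt z (𝓟 (spectrum ℂ (lam • ContinuousLinearMap.id ℂ X + S))) → z = lam := by
  have hshift : ∀ z, z ∈ spectrum ℂ (lam • ContinuousLinearMap.id ℂ X + S) ↔
      z - lam ∈ spectrum ℂ S := by
    intro z
    rw [ss_mem, ss_mem]
    have : lam • ContinuousLinearMap.id ℂ X + S - z • (1 : X →L[ℂ] X) =
        S - (z - lam) • (1 : X →L[ℂ] X) := by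
      rw [sub_smul]
      change lam • (1 : X →L[ℂ] X) + S - _ = _
      abel
    rw [this]
  have hacc : ∀ z, z ≠ lam →
      ∀ᶠ w in 𝓝[≠] z, w ∉ spectrum ℂ (lam • ContinuousLinearMap.id ℂ X + S) := by
    intro z hz
    have h1 := ss_not_acc S hS (z - lam) (sub_ne_zero.2 hz)
    have h2 : Tendsto (fun w : ℂ => w - lam) (𝓝[≠] z) (𝓝[≠] (z - lam)) := by
      apply tendsto_nhdsWithin_of_tendsto_nhds_of_eventually_within
      · exact ((continuous_sub_right lam).tendsto z).mono_left nhdsWithin_le_nhds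
      · filter_upwards [self_mem_nhdsWithin] with w hw
        intro h
        exact hw (sub_left_injective h)
    filter_upwards [h2.eventually h1] with w hw
    rwa [hshift]
  refine ⟨?_, ?_, ?_, ?_⟩
  · ext z
    rw [hshift]
    constructor
    · intro h; exact ⟨z - lam, h, by simp⟩
    · rintro ⟨w, hw, rfl⟩; simpa using hw
  · set σ := spectrum ℂ (lam • ContinuousLinearMap.id ℂ X + S)
    have hd : IsDiscrete (σ \ {lam}) := by
      rw [isDiscrete_iff_nhdsNE]
      intro x hx
      rw [Filter.inf_principal_eq_bot]
      filter_upwards [hacc x hx.2] with w hw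
      exact fun h => hw h.1
    have hc : (σ \ {lam}).Countable :=
      (HereditarilyLindelofSpace.isLindelof _).countable_of_isDiscrete hd
    exact (hc.union (Set.countable_singleton lam)).mono (by simp)
  · rw [hshift, sub_self, ss_mem]
    rintro ⟨u, hu⟩
    rw [zero_smul, sub_zero] at hu
    refine hS ⊤ (fun h => hX ?_) ?_
    · exact (Submodule.topEquiv (R := ℂ) (M := X)).finiteDimensional
    · let T : X →L[ℂ] X := (u⁻¹ : (X →L[ℂ] X)ˣ)
      refine ⟨(‖T‖ + 1)⁻¹, by positivity, fun x _ => ?_⟩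
      have h1 : T (S x) = x := by
        have := congrArg (fun T : X →L[ℂ] X => T x) u.inv_mul
        rw [hu] at this
        exact this
      rw [inv_mul_le_iff₀ (by positivity)]
      calc ‖x‖ = ‖T (S x)‖ := by rw [h1]
        _ ≤ ‖T‖ * ‖S x‖ := T.le_opNorm _
        _ ≤ _ := by gcongr; linarith
  · intro z hz
    by_contra hne
    rw [accPt_iff_frequently_nhdsNE] at hz
    exact hz (hacc z hne)
end

section
/- Let X be a non-separable reflexive Banach space. Then for every infinite-dimensional separable closed subspace Y of X and for every real number λ with λ > 1, there exists a J-class bounded linear operator T on X with ‖T‖ = λ such that Y ⊆ A_T. -/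
open Filter Topology

/-- `D` norms `A` with respect to the pairing `B`. -/
def Norms15 {E F : Type*} [NormedAddCommGroup E] [NormedAddCommGroup F]
    (B : E → F → ℝ) (A : Set E) (D : Set F) : Prop :=
  ∀ a ∈ A, ∀ ε > 0, ∃ d ∈ D, ‖d‖ ≤ 1 ∧ ‖a‖ - ε ≤ B a d

lemma Norms15.closure {E F : Type*} [NormedAddCommGroup E] [NormedAddCommGroup F]
    {B : E → F → ℝ} (hL : ∀ e e' f, ‖f‖ ≤ 1 → B e f ≤ B e' f + ‖e - e'‖)
    {A : Set E} {D : Set F} (h : Norms15 B A D) : Norms15 B (closure A) D := by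
  intro a ha ε hε
  obtain ⟨b, hb, hab⟩ := Metric.mem_closure_iff.1 ha (ε / 4) (by positivity)
  obtain ⟨d, hd, hd1, h2⟩ := h b hb (ε / 4) (by positivity)
  refine ⟨d, hd, hd1, ?_⟩
  have h3 := hL b a d hd1
  have h4 : ‖a‖ - ‖b‖ ≤ ‖a - b‖ := norm_sub_norm_le a b
  rw [dist_eq_norm] at hab
  rw [norm_sub_rev] at h3
  linarith

lemma exists_norms15 {E F : Type*} [NormedAddCommGroup E] [NormedAddCommGroup F]
    [NormedSpace ℝ F]
    {B : E → F → ℝ} (hL : ∀ e e' f, ‖f‖ ≤ 1 → B e f ≤ B e' f + ‖e - e'‖)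
    (hB : ∀ e, ∀ ε > 0, ∃ f, ‖f‖ ≤ 1 ∧ ‖e‖ - ε ≤ B e f)
    {A : Set E} (hA : TopologicalSpace.IsSeparable A) :
    ∃ D : Submodule ℝ F, TopologicalSpace.IsSeparable (D : Set F) ∧ Norms15 B A D := by
  obtain ⟨t, htA, htc, ht⟩ := hA.exists_countable_dense_subset
  have : Countable t := htc.to_subtype
  choose f hf1 hf2 using fun (p : t × ℕ) => hB p.1 (1 / ((p.2 : ℝ) + 1)) (by positivity)
  refine ⟨Submodule.span ℝ (Set.range f), (Set.countable_range f).isSeparable.span, ?_⟩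
  have h : Norms15 B t (Submodule.span ℝ (Set.range f) : Set F) := by
    intro a ha ε hε
    obtain ⟨n, hn⟩ := exists_nat_one_div_lt hε
    refine ⟨f (⟨a, ha⟩, n), Submodule.subset_span ⟨_, rfl⟩, hf1 _, ?_⟩
    have := hf2 (⟨a, ha⟩, n)
    simp only at this
    linarith
  intro a ha
  exact h.closure hL a (ht ha)

lemma sep_sup15 {E : Type*} [NormedAddCommGroup E] [NormedSpace ℝ E] {A B : Submodule ℝ E}
    (hA : TopologicalSpace.IsSeparable (A : Set E)) (hB : TopologicalSpace.IsSeparable (B : Set E)) :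
    TopologicalSpace.IsSeparable ((A ⊔ B : Submodule ℝ E) : Set E) := by
  have := (hA.union hB).span (R := ℝ)
  rwa [Submodule.span_union, Submodule.span_eq, Submodule.span_eq] at this

lemma exists_pair15 {X : Type*} [NormedAddCommGroup X] [NormedSpace ℝ X]
    (Y : Submodule ℝ X) (hY : TopologicalSpace.IsSeparable (Y : Set X)) :
    ∃ (Z : Submodule ℝ X) (F : Submodule ℝ (StrongDual ℝ X)),
      IsClosed (Z : Set X) ∧ IsClosed (F : Set (StrongDual ℝ X)) ∧
      TopologicalSpace.IsSeparable (Z : Set X) ∧ Y ≤ Z ∧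
      Norms15 (fun x f => f x) (Z : Set X) (F : Set (StrongDual ℝ X)) ∧
      Norms15 (fun f x => f x) (F : Set (StrongDual ℝ X)) (Z : Set X) := by
  set B1 : X → StrongDual ℝ X → ℝ := fun x f => f x with hB1
  set B2 : StrongDual ℝ X → X → ℝ := fun f x => f x with hB2
  have hL1 : ∀ e e' f, ‖f‖ ≤ 1 → B1 e f ≤ B1 e' f + ‖e - e'‖ := by
    intro e e' f hf
    have h1 := (le_abs_self _).trans (f.le_opNorm (e - e'))
    have h2 : ‖f‖ * ‖e - e'‖ ≤ 1 * ‖e - e'‖ := by gcongr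
    simp only [hB1, map_sub] at *
    linarith
  have hL2 : ∀ e e' f, ‖f‖ ≤ 1 → B2 e f ≤ B2 e' f + ‖e - e'‖ := by
    intro e e' f hf
    have h1 := (le_abs_self _).trans ((e - e').le_opNorm f)
    have h2 : ‖e - e'‖ * ‖f‖ ≤ ‖e - e'‖ * 1 := by gcongr
    simp only [hB2, sub_apply] at *
    linarith
  have hN1 : ∀ e, ∀ ε > 0, ∃ f, ‖f‖ ≤ 1 ∧ ‖e‖ - ε ≤ B1 e f := by
    intro e ε hε
    obtain ⟨g, hg, hge⟩ := exists_dual_vector'' ℝ e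
    refine ⟨g, hg, ?_⟩
    simp only [hB1, hge]
    simp; linarith
  have hN2 : ∀ e, ∀ ε > 0, ∃ f, ‖f‖ ≤ 1 ∧ ‖e‖ - ε ≤ B2 e f := by
    intro e ε hε
    by_contra! hcon
    have hpos : 0 ≤ ‖e‖ - ε := by
      have := hcon 0 (by simp)
      simp [hB2] at this
      linarith
    have : ‖e‖ ≤ ‖e‖ - ε := by
      refine ContinuousLinearMap.opNorm_le_of_unit_norm hpos ?_
      intro x hx
      have h1 := hcon x hx.le
      have h2 := hcon (-x) (by simp [hx])
      simp only [hB2, map_neg] at h1 h2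
      rw [Real.norm_eq_abs, abs_le]
      constructor <;> linarith
    linarith
  choose! H hHs hHn using fun (A : Submodule ℝ X)
    (hA : TopologicalSpace.IsSeparable (A : Set X)) => exists_norms15 hL1 hN1 hA
  choose! G hGs hGn using fun (A : Submodule ℝ (StrongDual ℝ X))
    (hA : TopologicalSpace.IsSeparable (A : Set (StrongDual ℝ X))) => exists_norms15 hL2 hN2 hA
  let q : ℕ → Submodule ℝ X × Submodule ℝ (StrongDual ℝ X) := fun n =>
    Nat.rec (Y, ⊥) (fun _ p => (p.1 ⊔ G p.2, p.2 ⊔ H p.1)) n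
  have q0 : q 0 = (Y, ⊥) := rfl
  have qs : ∀ n, q (n + 1) = ((q n).1 ⊔ G (q n).2, (q n).2 ⊔ H (q n).1) := fun n => rfl
  have hsep : ∀ n, TopologicalSpace.IsSeparable ((q n).1 : Set X) ∧
      TopologicalSpace.IsSeparable ((q n).2 : Set (StrongDual ℝ X)) := by
    intro n
    induction n with
    | zero =>
      rw [q0]
      refine ⟨hY, ?_⟩
      simpa using (Set.countable_singleton (0 : StrongDual ℝ X)).isSeparable
    | succ n ih =>
      rw [qs]
      exact ⟨sep_sup15 ih.1 (hGs _ ih.2), sep_sup15 ih.2 (hHs _ ih.1)⟩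
  have m1 : Monotone fun n => (q n).1 := monotone_nat_of_le_succ fun n => by
    simp only [qs]; exact le_sup_left
  have m2 : Monotone fun n => (q n).2 := monotone_nat_of_le_succ fun n => by
    simp only [qs]; exact le_sup_left
  have n1 : Norms15 B1 ((⨆ n, (q n).1 : Submodule ℝ X) : Set X)
      ((⨆ n, (q n).2 : Submodule ℝ (StrongDual ℝ X)) : Set (StrongDual ℝ X)) := by
    intro a ha ε hε
    obtain ⟨n, hn⟩ := (Submodule.mem_iSup_of_directed _ m1.directed_le).1 ha
    obtain ⟨d, hd, h1⟩ := hHn _ (hsep n).1 a hn ε hε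
    refine ⟨d, ?_, h1⟩
    refine Submodule.mem_iSup_of_mem (n + 1) ?_
    rw [qs]
    exact Submodule.mem_sup_right hd
  have n2 : Norms15 B2 ((⨆ n, (q n).2 : Submodule ℝ (StrongDual ℝ X)) : Set (StrongDual ℝ X))
      ((⨆ n, (q n).1 : Submodule ℝ X) : Set X) := by
    intro a ha ε hε
    obtain ⟨n, hn⟩ := (Submodule.mem_iSup_of_directed _ m2.directed_le).1 ha
    obtain ⟨d, hd, h1⟩ := hGn _ (hsep n).2 a hn ε hε
    refine ⟨d, ?_, h1⟩
    refine Submodule.mem_iSup_of_mem (n + 1) ?_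
    rw [qs]
    exact Submodule.mem_sup_right hd
  refine ⟨(⨆ n, (q n).1).topologicalClosure, (⨆ n, (q n).2).topologicalClosure,
    Submodule.isClosed_topologicalClosure _, Submodule.isClosed_topologicalClosure _, ?_, ?_, ?_, ?_⟩
  · rw [Submodule.topologicalClosure_coe]
    refine TopologicalSpace.IsSeparable.closure ?_
    rw [Submodule.coe_iSup_of_directed _ m1.directed_le]
    exact TopologicalSpace.IsSeparable.iUnion fun n => (hsep n).1
  · exact (le_iSup (fun n => (q n).1) 0).trans (Submodule.le_topologicalClosure _)
  · intro a ha ε hε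
    obtain ⟨d, hd, h1⟩ := n1.closure hL1 a ha ε hε
    exact ⟨d, Submodule.le_topologicalClosure _ hd, h1⟩
  · intro a ha ε hε
    obtain ⟨d, hd, h1⟩ := n2.closure hL2 a ha ε hε
    exact ⟨d, Submodule.le_topologicalClosure _ hd, h1⟩

lemma exists_sep15 {X : Type*} [NormedAddCommGroup X] [NormedSpace ℝ X]
    (V : Submodule ℝ X) (hV : IsClosed (V : Set X)) (v : X) (hv : v ∉ V) :
    ∃ φ : StrongDual ℝ X, φ v = 1 ∧ ∀ u ∈ V, φ u = 0 := by
  have : IsClosed (V : Set X) := hV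
  have hne : V.mkQ v ≠ 0 := by
    simpa using hv
  obtain ⟨f, hf⟩ := SeparatingDual.exists_eq_one (R := ℝ) hne
  refine ⟨f.comp V.mkQL, by simpa using hf, ?_⟩
  intro u hu
  have : V.mkQ u = 0 := by simpa using hu
  have h2 : V.mkQL u = 0 := this
  simp [h2]

lemma exists_proj15 {X : Type*} [NormedAddCommGroup X] [NormedSpace ℝ X] [CompleteSpace X]
    (hrefl : Function.Surjective (NormedSpace.inclusionInDoubleDual ℝ X))
    (Y : Submodule ℝ X) (hY : TopologicalSpace.IsSeparable (Y : Set X)) :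
    ∃ (Z : Submodule ℝ X) (P : X →L[ℝ] X),
      TopologicalSpace.IsSeparable (Z : Set X) ∧ Y ≤ Z ∧ (∀ x, P x ∈ Z) ∧ ∀ z ∈ Z, P z = z := by
  obtain ⟨Z, F, hZc, hFc, hZs, hYZ, h1, h2⟩ := exists_pair15 Y hY
  let W : Submodule ℝ X := ⨅ f : F, LinearMap.ker (f : StrongDual ℝ X).toLinearMap
  have hW : ∀ w, w ∈ W ↔ ∀ f ∈ F, f w = 0 := by
    intro w
    simp [W]
  have hWc : IsClosed (W : Set X) := by
    have : (W : Set X) = ⋂ f : F, {x | (f : StrongDual ℝ X) x = 0} := by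
      ext w
      simp [hW]
    rw [this]
    exact isClosed_iInter fun f => isClosed_eq (by fun_prop) (by fun_prop)
  have hn : ∀ z ∈ Z, ∀ w ∈ W, ‖z‖ ≤ ‖z + w‖ := by
    intro z hz w hw
    refine le_of_forall_pos_le_add fun ε hε => ?_
    obtain ⟨f, hf, hf1, hf2⟩ := h1 z hz ε hε
    have h3 := (le_abs_self _).trans (f.le_opNorm (z + w))
    have h4 : ‖f‖ * ‖z + w‖ ≤ 1 * ‖z + w‖ := by gcongr
    have h5 := (hW w).1 hw f hf
    simp only [map_add, h5] at *
    linarith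
  have hdisj : Disjoint Z W := by
    rw [Submodule.disjoint_def]
    intro x hx hxw
    have := hn x hx (-x) (W.neg_mem hxw)
    simpa using this
  have hclosed : IsClosed ((Z ⊔ W : Submodule ℝ X) : Set X) := by
    have : CompleteSpace Z := hZc.completeSpace_coe
    have : CompleteSpace W := hWc.completeSpace_coe
    let C : (Z × W) →L[ℝ] X := Z.subtypeL.coprod W.subtypeL
    have hA : AntilipschitzWith 2 C := by
      refine ContinuousLinearMap.antilipschitz_of_bound _ ?_
      rintro ⟨z, w⟩
      have a1 := hn z z.2 w w.2
      have a2 : ‖(w : X)‖ ≤ ‖(z : X) + w‖ + ‖(z : X)‖ := by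
        have := norm_sub_le ((z : X) + w) z
        simpa using this
      have : C (z, w) = (z : X) + w := by simp [C]
      rw [this, Prod.norm_def]
      refine max_le ?_ ?_
      · simp only [NNReal.coe_ofNat, Submodule.coe_norm]
        linarith [norm_nonneg ((z : X) + w)]
      · simp only [NNReal.coe_ofNat, Submodule.coe_norm]
        linarith
    have := hA.isClosed_range C.uniformContinuous
    convert this using 1
    ext x
    simp only [SetLike.mem_coe, Submodule.mem_sup, Set.mem_range, Prod.exists, C]
    constructor
    · rintro ⟨z, hz, w, hw, rfl⟩
      exact ⟨⟨z, hz⟩, ⟨w, hw⟩, by simp⟩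
    · rintro ⟨z, w, rfl⟩
      exact ⟨z, z.2, w, w.2, by simp⟩
  have hcod : Codisjoint Z W := by
    rw [codisjoint_iff, eq_top_iff]
    intro x _
    by_contra hx
    obtain ⟨f, hfx, hf⟩ := exists_sep15 _ hclosed x hx
    have hfF : f ∈ F := by
      by_contra hfF
      obtain ⟨Ψ, hΨ1, hΨ2⟩ := exists_sep15 _ hFc f hfF
      obtain ⟨w, rfl⟩ := hrefl Ψ
      simp only [NormedSpace.dual_def] at hΨ1 hΨ2
      have := hf w (Submodule.mem_sup_right ((hW w).2 hΨ2))
      rw [this] at hΨ1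
      exact zero_ne_one hΨ1
    have hf0 : ‖f‖ ≤ 0 := by
      refine le_of_forall_pos_le_add fun ε hε => ?_
      obtain ⟨z, hz, -, h3⟩ := h2 f hfF ε hε
      have := hf z (Submodule.mem_sup_left hz)
      simp only [this] at h3
      linarith
    have : f = 0 := by simpa using hf0
    rw [this] at hfx
    simp at hfx
  obtain ⟨p, hp⟩ := Submodule.ClosedComplemented.of_isCompl_isClosed ⟨hdisj, hcod⟩ hZc hWc
  refine ⟨Z, Z.subtypeL.comp p, hZs, hYZ, fun x => by simp, fun z hz => ?_⟩
  have := hp ⟨z, hz⟩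
  simp [this]

lemma strong_seq15 {α : Type*} [Nonempty α] (P : ℕ → (ℕ → α) → α → Prop)
    (h : ∀ n g, ∃ a, P n g a)
    (hloc : ∀ n g g' a, (∀ i < n, g i = g' i) → P n g a → P n g' a) :
    ∃ g : ℕ → α, ∀ n, P n g (g n) := by
  choose step hstep using h
  let G : ℕ → (ℕ → α) := fun n =>
    Nat.rec (fun _ => Classical.arbitrary α) (fun n g => Function.update g n (step n g)) n
  have Gs : ∀ n, G (n + 1) = Function.update (G n) n (step n (G n)) := fun n => rfl
  have key : ∀ i n, i < n → G n i = G (i + 1) i := by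
    intro i n hin
    induction n, hin using Nat.le_induction with
    | base => rfl
    | succ n hn ih =>
      rw [Gs, Function.update_of_ne (by omega), ih]
  refine ⟨fun n => G (n + 1) n, fun n => ?_⟩
  refine hloc n (G n) _ _ (fun i hi => key i n hi) ?_
  simp only [Gs, Function.update_self]
  exact hstep _ _

lemma exists_biorth15 {X : Type*} [NormedAddCommGroup X] [NormedSpace ℝ X]
    (Z : Submodule ℝ X) (hZ : ¬ FiniteDimensional ℝ Z) (x : ℕ → X) (hx : ∀ n, x n ∈ Z)
    (δ : ℕ → ℝ) (hδ : ∀ n, 0 < δ n) :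
    ∃ (v : ℕ → X) (φ : ℕ → StrongDual ℝ X), (∀ n, v n ∈ Z) ∧
      (∀ i j, φ i (v j) = if i = j then 1 else 0) ∧
      (∀ n, ‖φ n‖ * ‖∑ i ∈ Finset.range n, (n.choose i : ℝ) • v i‖ ≤ δ n) ∧
      ∀ n, x n ∈ Submodule.span ℝ (Set.range v) := by
  let P : ℕ → (ℕ → X × StrongDual ℝ X) → X × StrongDual ℝ X → Prop := fun n g a =>
    (∀ i < n, ∀ j < n, (g i).2 (g j).1 = if i = j then 1 else 0) → (∀ i < n, (g i).1 ∈ Z) →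
      a.1 ∈ Z ∧ (∀ i < n, (g i).2 a.1 = 0) ∧ (∀ i < n, a.2 (g i).1 = 0) ∧ a.2 a.1 = 1 ∧
      ‖a.2‖ * ‖∑ i ∈ Finset.range n, (n.choose i : ℝ) • (g i).1‖ ≤ δ n ∧
      x n ∈ Submodule.span ℝ (insert a.1 ((fun i => (g i).1) '' Set.Iio n))
  obtain ⟨g, hg⟩ := strong_seq15 P (by
    intro n g
    by_cases hb : (∀ i < n, ∀ j < n, (g i).2 (g j).1 = if i = j then 1 else 0) ∧
      (∀ i < n, (g i).1 ∈ Z)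
    swap
    · exact ⟨0, fun h1 h2 => (hb ⟨h1, h2⟩).elim⟩
    obtain ⟨hb, hZg⟩ := hb
    set V := Submodule.span ℝ ((fun i => (g i).1) '' Set.Iio n) with hVdef
    have hVf : FiniteDimensional ℝ V :=
      FiniteDimensional.span_of_finite ℝ ((Set.finite_Iio n).image _)
    have hVc : IsClosed (V : Set X) := Submodule.closed_of_finiteDimensional V
    have hex : ∃ v0 ∈ Z, v0 ∉ V ∧ (x n ∈ V ∨ v0 = x n) := by
      by_cases hxV : x n ∈ V
      · by_contra! hcon
        have hle : Z ≤ V := by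
          intro z hz
          by_contra hzV
          exact (hcon z hz hzV).1 hxV
        exact hZ (Submodule.finiteDimensional_of_le hle)
      · exact ⟨x n, hx n, hxV, Or.inr rfl⟩
    obtain ⟨v0, hv0Z, hv0V, hv0x⟩ := hex
    have hgV : ∀ i < n, (g i).1 ∈ V := fun i hi => Submodule.subset_span ⟨i, hi, rfl⟩
    set s := ∑ i ∈ Finset.range n, ((g i).2 v0) • (g i).1 with hs
    have hsV : s ∈ V := Submodule.sum_mem _ fun i hi =>
      V.smul_mem _ (hgV i (Finset.mem_range.1 hi))
    have hsZ : s ∈ Z := Submodule.sum_mem _ fun i hi =>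
      Z.smul_mem _ (hZg i (Finset.mem_range.1 hi))
    set v1 := v0 - s with hv1
    have hv1V : v1 ∉ V := fun h => hv0V (by simpa [hv1] using V.add_mem h hsV)
    have hv1g : ∀ i < n, (g i).2 v1 = 0 := by
      intro i hi
      have : (g i).2 s = (g i).2 v0 := by
        rw [hs, map_sum, Finset.sum_eq_single i]
        · simp [hb i hi i hi]
        · intro j hj hji
          simp [hb i hi j (Finset.mem_range.1 hj), hji.symm]
        · intro h; exact (h (Finset.mem_range.2 hi)).elim
      simp [hv1, this]
    obtain ⟨ψ, hψ1, hψ2⟩ := exists_sep15 V hVc v1 hv1V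
    set R := ‖ψ‖ * ‖∑ i ∈ Finset.range n, (n.choose i : ℝ) • (g i).1‖ with hR
    have hR0 : 0 ≤ R := by positivity
    set a : ℝ := 1 + R / δ n with ha
    have hδn := hδ n
    have ha0 : 0 < a := by positivity
    refine ⟨(a • v1, a⁻¹ • ψ), fun _ _ => ⟨Z.smul_mem _ (Z.sub_mem hv0Z hsZ), ?_, ?_, ?_, ?_, ?_⟩⟩
    · intro i hi; simp [hv1g i hi]
    · intro i hi; simp [hψ2 _ (hgV i hi)]
    · simp [hψ1, ha0.ne']
    · simp only [norm_smul, norm_inv, Real.norm_eq_abs, abs_of_pos ha0]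
      rw [mul_assoc, ← hR, inv_mul_le_iff₀ ha0, ha]
      have : R / δ n * δ n = R := by field_simp
      nlinarith
    · rcases hv0x with h | h
      · exact Submodule.span_mono (Set.subset_insert _ _) h
      · rw [Submodule.mem_span_insert]
        refine ⟨a⁻¹, s, hsV, ?_⟩
        simp [smul_smul, ha0.ne', hv1, h]) (by
    intro n g g' a hgg hP h1 h2
    have h1' : ∀ i < n, ∀ j < n, (g i).2 (g j).1 = if i = j then 1 else 0 := by
      intro i hi j hj
      rw [hgg i hi, hgg j hj]; exact h1 i hi j hj
    have h2' : ∀ i < n, (g i).1 ∈ Z := by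
      intro i hi
      rw [hgg i hi]; exact h2 i hi
    obtain ⟨c1, c2, c3, c4, c5, c6⟩ := hP h1' h2'
    refine ⟨c1, ?_, ?_, c4, ?_, ?_⟩
    · intro i hi; rw [← hgg i hi]; exact c2 i hi
    · intro i hi; rw [← hgg i hi]; exact c3 i hi
    · rw [Finset.sum_congr rfl (g := fun i => (n.choose i : ℝ) • (g i).1)]
      · exact c5
      · intro i hi
        rw [hgg i (Finset.mem_range.1 hi)]
    · rw [Set.image_congr (g := fun i => (g i).1)]
      · exact c6
      · intro i hi
        rw [hgg i hi])
  have hind : ∀ n, (∀ i < n, ∀ j < n, (g i).2 (g j).1 = if i = j then 1 else 0) ∧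
      (∀ i < n, (g i).1 ∈ Z) := by
    intro n
    induction n with
    | zero => simp
    | succ n ih =>
      obtain ⟨c1, c2, c3, c4, c5, c6⟩ := hg n ih.1 ih.2
      constructor
      · intro i hi j hj
        rcases Nat.lt_succ_iff_lt_or_eq.1 hi with hi | rfl
        · rcases Nat.lt_succ_iff_lt_or_eq.1 hj with hj | rfl
          · exact ih.1 i hi j hj
          · rw [c2 i hi, if_neg hi.ne]
        · rcases Nat.lt_succ_iff_lt_or_eq.1 hj with hj | rfl
          · rw [c3 j hj, if_neg hj.ne']
          · simp [c4]
      · intro i hi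
        rcases Nat.lt_succ_iff_lt_or_eq.1 hi with hi | rfl
        · exact ih.2 i hi
        · exact c1
  refine ⟨fun n => (g n).1, fun n => (g n).2, fun n => (hind (n + 1)).2 n (by omega), ?_, ?_, ?_⟩
  · intro i j
    exact (hind (i + j + 1)).1 i (by omega) j (by omega)
  · intro n
    exact (hg n (hind n).1 (hind n).2).2.2.2.2.1
  · intro n
    refine Submodule.span_mono ?_ (hg n (hind n).1 (hind n).2).2.2.2.2.2
    rintro _ (rfl | ⟨i, -, rfl⟩)
    · exact ⟨n, rfl⟩
    · exact ⟨i, rfl⟩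

lemma exists_shift15 {X : Type*} [NormedAddCommGroup X] [NormedSpace ℝ X] [CompleteSpace X]
    (Z : Submodule ℝ X) (hZ : ¬ FiniteDimensional ℝ Z)
    (hZs : TopologicalSpace.IsSeparable (Z : Set X)) (ε : ℝ) (hε : 0 < ε) :
    ∃ (v : ℕ → X) (N : X →L[ℝ] X), ‖N‖ ≤ ε ∧ (∀ n, v n ∈ Z) ∧
      (∀ n, N (v n) = ∑ i ∈ Finset.range n, (n.choose i : ℝ) • v i) ∧
      (Z : Set X) ⊆ closure (Submodule.span ℝ (Set.range v) : Set X) := by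
  obtain ⟨t, htZ, htc, ht⟩ := hZs.exists_countable_dense_subset
  have htne : t.Nonempty := by
    rw [Set.nonempty_iff_ne_empty]
    rintro rfl
    have := ht Z.zero_mem
    simp at this
  obtain ⟨x, rfl⟩ := htc.exists_eq_range htne
  obtain ⟨v, φ, hvZ, hb, hs, hx⟩ := exists_biorth15 Z hZ x (fun n => htZ ⟨n, rfl⟩)
    (fun n => ε / 2 / 2 ^ n) (fun n => by positivity)
  let A : ℕ → X →L[ℝ] X := fun n =>
    (φ n).smulRight (∑ i ∈ Finset.range n, (n.choose i : ℝ) • v i)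
  have hA : ∀ n, ‖A n‖ ≤ ε / 2 / 2 ^ n := fun n => by
    simp only [A, ContinuousLinearMap.norm_smulRight_apply]
    exact hs n
  have hsum := hasSum_geometric_two' ε
  have hAs : Summable A := Summable.of_norm_bounded hsum.summable hA
  refine ⟨v, ∑' n, A n, tsum_of_norm_bounded hsum hA, hvZ, ?_, ?_⟩
  · intro n
    have h1 : HasSum (fun k => A k (v n)) ((∑' n, A n) (v n)) :=
      hAs.hasSum.mapL (ContinuousLinearMap.apply ℝ X (v n))
    rw [← h1.tsum_eq, tsum_eq_single n]
    · simp [A, hb]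
    · intro k hk
      simp [A, hb, hk]
  · refine ht.trans (closure_mono ?_)
    rintro _ ⟨n, rfl⟩
    exact hx n

/-- The limit of the graphs of the powers of `T`. -/
def Glim15 {X : Type*} [NormedAddCommGroup X] [NormedSpace ℝ X] (T : X →L[ℝ] X) :
    Submodule ℝ (X × X) where
  carrier := {p | ∀ ε > 0, ∀ᶠ k in atTop, ∃ u, ‖u - p.1‖ < ε ∧ ‖(T ^ k) u - p.2‖ < ε}
  zero_mem' := by
    intro ε hε
    exact Eventually.of_forall fun k => ⟨0, by simpa using hε⟩
  add_mem' := by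
    intro p q hp hq ε hε
    filter_upwards [hp (ε / 2) (by positivity), hq (ε / 2) (by positivity)] with k h1 h2
    obtain ⟨u, hu1, hu2⟩ := h1
    obtain ⟨w, hw1, hw2⟩ := h2
    refine ⟨u + w, ?_, ?_⟩
    · have : u + w - (p + q).1 = (u - p.1) + (w - q.1) := by simp; abel
      rw [this]
      refine (norm_add_le _ _).trans_lt ?_
      linarith
    · have : (T ^ k) (u + w) - (p + q).2 = ((T ^ k) u - p.2) + ((T ^ k) w - q.2) := by
        rw [map_add]; simp; abel
      rw [this]
      refine (norm_add_le _ _).trans_lt ?_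
      linarith
  smul_mem' := by
    intro c p hp ε hε
    have hc : 0 < ‖c‖ + 1 := by positivity
    filter_upwards [hp (ε / (‖c‖ + 1)) (by positivity)] with k h1
    obtain ⟨u, hu1, hu2⟩ := h1
    have aux : ∀ r : ℝ, 0 ≤ r → r < ε / (‖c‖ + 1) → ‖c‖ * r < ε := by
      intro r h0 hr
      rw [lt_div_iff₀ hc] at hr
      nlinarith
    refine ⟨c • u, ?_, ?_⟩
    · rw [Prod.smul_fst, ← smul_sub, norm_smul]
      exact aux _ (norm_nonneg _) hu1
    · rw [Prod.smul_snd, map_smul, ← smul_sub, norm_smul]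
      exact aux _ (norm_nonneg _) hu2

lemma mem_Glim15 {X : Type*} [NormedAddCommGroup X] [NormedSpace ℝ X] {T : X →L[ℝ] X}
    {x y : X} : (x, y) ∈ Glim15 T ↔
      ∀ ε > 0, ∀ᶠ k in atTop, ∃ u, ‖u - x‖ < ε ∧ ‖(T ^ k) u - y‖ < ε := Iff.rfl

lemma isClosed_Glim15 {X : Type*} [NormedAddCommGroup X] [NormedSpace ℝ X] (T : X →L[ℝ] X) :
    IsClosed (Glim15 T : Set (X × X)) := by
  refine isClosed_of_closure_subset ?_
  rintro ⟨x, y⟩ h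
  rw [SetLike.mem_coe, mem_Glim15]
  intro ε hε
  obtain ⟨⟨x', y'⟩, hm, hd⟩ := Metric.mem_closure_iff.1 h (ε / 2) (by positivity)
  rw [Prod.dist_eq, max_lt_iff, dist_eq_norm, dist_eq_norm] at hd
  simp only at hd
  filter_upwards [mem_Glim15.1 hm (ε / 2) (by positivity)] with k hk
  obtain ⟨u, h1, h2⟩ := hk
  refine ⟨u, ?_, ?_⟩
  · have := norm_sub_le_norm_sub_add_norm_sub u x' x
    rw [norm_sub_rev x' x] at this
    linarith
  · have := norm_sub_le_norm_sub_add_norm_sub ((T ^ k) u) y' y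
    rw [norm_sub_rev y' y] at this
    linarith

lemma mem_Glim15_of_tendsto {X : Type*} [NormedAddCommGroup X] [NormedSpace ℝ X]
    {T : X →L[ℝ] X} {x y : X} (u : ℕ → X) (h1 : Tendsto u atTop (𝓝 x))
    (h2 : Tendsto (fun k => (T ^ k) (u k)) atTop (𝓝 y)) : (x, y) ∈ Glim15 T := by
  rw [mem_Glim15]
  intro ε hε
  filter_upwards [Metric.tendsto_nhds.1 h1 ε hε, Metric.tendsto_nhds.1 h2 ε hε] with k a b
  rw [dist_eq_norm] at a b
  exact ⟨u k, a, b⟩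

lemma mem_JSet_of_Glim15 {X : Type*} [NormedAddCommGroup X] [NormedSpace ℝ X]
    {T : X →L[ℝ] X} {x y : X} (h : (x, y) ∈ Glim15 T) : y ∈ JSet T x := by
  rw [mem_Glim15] at h
  obtain ⟨k, hk, hu⟩ := extraction_forall_of_eventually
    (fun n : ℕ => h (1 / ((n : ℝ) + 1)) (by positivity))
  choose u h1 h2 using hu
  refine ⟨k, hk, u, ?_, ?_⟩
  · rw [tendsto_iff_norm_sub_tendsto_zero]
    exact squeeze_zero (fun _ => norm_nonneg _) (fun n => (h1 n).le)
      tendsto_one_div_add_atTop_nhds_zero_nat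
  · rw [tendsto_iff_norm_sub_tendsto_zero]
    exact squeeze_zero (fun _ => norm_nonneg _) (fun n => (h2 n).le)
      tendsto_one_div_add_atTop_nhds_zero_nat

open Polynomial in
lemma cont15 {E : Type*} [NormedAddCommGroup E] [NormedSpace ℝ E] (Φ : ℝ[X] →ₗ[ℝ] E)
    (b : ℕ) : ∀ p : ℝ[X], Continuous fun s : ℝ => Φ (p * (1 + C s * X) ^ b) := by
  induction b with
  | zero => intro p; simpa using continuous_const
  | succ b ih =>
    intro p
    have : (fun s : ℝ => Φ (p * (1 + C s * X) ^ (b + 1))) = fun s : ℝ =>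
        Φ (p * (1 + C s * X) ^ b) + s • Φ ((p * X) * (1 + C s * X) ^ b) := by
      funext s
      rw [← map_smul, ← map_add, smul_eq_C_mul]
      congr 1
      ring
    rw [this]
    exact (ih p).add (continuous_id.smul (ih _))

open Polynomial in
lemma pow_taylor15 {E : Type*} [NormedAddCommGroup E] [NormedSpace ℝ E] (Φ : ℝ[X] →ₗ[ℝ] E)
    (T : E →L[ℝ] E) (hT : ∀ p, T (Φ p) = Φ (taylor 1 p)) (k : ℕ) (p : ℝ[X]) :
    (T ^ k) (Φ p) = Φ (taylor (k : ℝ) p) := by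
  induction k with
  | zero => simp
  | succ k ih =>
    rw [pow_succ', mul_apply_eq_comp, ih, hT, taylor_taylor]
    congr 2
    push_cast
    ring_nf

open Polynomial in
lemma Glim15_left {E : Type*} [NormedAddCommGroup E] [NormedSpace ℝ E] (Φ : ℝ[X] →ₗ[ℝ] E)
    (T : E →L[ℝ] E) (hT : ∀ p, T (Φ p) = Φ (taylor 1 p)) (m : ℕ) :
    (Φ (X ^ m), 0) ∈ Glim15 T := by
  have hs : Tendsto (fun k : ℕ => ((k : ℝ))⁻¹) atTop (𝓝 0) := tendsto_inv_atTop_nhds_zero_nat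
  refine mem_Glim15_of_tendsto
    (fun k => Φ (X ^ m * (1 + C (-(k : ℝ)⁻¹) * X) ^ (m + 1))) ?_ ?_
  · have h := ((cont15 Φ (m + 1) (X ^ m)).tendsto 0).comp (by simpa using hs.neg)
    simp only [C_0, zero_mul, add_zero, one_pow, mul_one] at h
    exact h
  · have h := ((cont15 Φ m (X ^ (m + 1))).tendsto 0).comp hs
    have h2 := (hs.smul h).const_smul ((-1 : ℝ) ^ (m + 1))
    simp only [zero_smul, smul_zero] at h2
    refine h2.congr' ?_
    filter_upwards [eventually_gt_atTop 0] with k hk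
    rw [pow_taylor15 Φ T hT]
    have hk' : (k : ℝ) ≠ 0 := by positivity
    simp only [Function.comp]
    rw [← map_smul, ← map_smul]
    congr 1
    have hc : (C (k : ℝ)⁻¹ : ℝ[X]) * C (k : ℝ) = 1 := by
      rw [← C_mul, inv_mul_cancel₀ hk', C_1]
    simp only [smul_eq_C_mul, taylor_mul, taylor_pow, taylor_X, map_add, taylor_one, taylor_C,
      map_pow, C_1, map_neg]
    set c := (C (k : ℝ)⁻¹ : ℝ[X])
    set d := (C (k : ℝ) : ℝ[X])
    have e1 : 1 + -c * (X + d) = -1 * c * X := by linear_combination -hc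
    have e2 : 1 + c * X = c * (X + d) := by linear_combination -hc
    rw [e1, e2]
    simp only [mul_pow]
    ring

open Polynomial in
lemma Glim15_right {E : Type*} [NormedAddCommGroup E] [NormedSpace ℝ E] (Φ : ℝ[X] →ₗ[ℝ] E)
    (T : E →L[ℝ] E) (hT : ∀ p, T (Φ p) = Φ (taylor 1 p)) (m : ℕ) :
    (0, Φ (X ^ m)) ∈ Glim15 T := by
  have hs : Tendsto (fun k : ℕ => ((k : ℝ))⁻¹) atTop (𝓝 0) := tendsto_inv_atTop_nhds_zero_nat
  refine mem_Glim15_of_tendsto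
    (fun k => (-1 : ℝ) ^ m • (k : ℝ)⁻¹ • Φ (X ^ (m + 1) * (1 + C (-(k : ℝ)⁻¹) * X) ^ m)) ?_ ?_
  · have h := ((cont15 Φ m (X ^ (m + 1))).tendsto 0).comp (by simpa using hs.neg)
    have h2 := (hs.smul h).const_smul ((-1 : ℝ) ^ m)
    simp only [zero_smul, smul_zero] at h2
    exact h2
  · have h := ((cont15 Φ (m + 1) (X ^ m)).tendsto 0).comp hs
    simp only [C_0, zero_mul, add_zero, one_pow, mul_one] at h
    refine h.congr' ?_
    filter_upwards [eventually_gt_atTop 0] with k hk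
    rw [map_smul, map_smul, pow_taylor15 Φ T hT]
    have hk' : (k : ℝ) ≠ 0 := by positivity
    simp only [Function.comp]
    rw [← map_smul, ← map_smul]
    congr 1
    have hc : (C (k : ℝ)⁻¹ : ℝ[X]) * C (k : ℝ) = 1 := by
      rw [← C_mul, inv_mul_cancel₀ hk', C_1]
    simp only [smul_eq_C_mul, taylor_mul, taylor_pow, taylor_X, map_add, taylor_one, taylor_C,
      map_pow, C_1, map_neg]
    set c := (C (k : ℝ)⁻¹ : ℝ[X])
    set d := (C (k : ℝ) : ℝ[X])
    have e1 : 1 + -c * (X + d) = -1 * c * X := by linear_combination -hc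
    have e2 : 1 + c * X = c * (X + d) := by linear_combination -hc
    rw [e1, e2]
    have e3 : ((-1 : ℝ[X]) ^ m) * (-1) ^ m = 1 := by rw [← mul_pow]; simp
    simp only [mul_pow]
    linear_combination (-(c ^ (m + 1) * (X + d) ^ (m + 1) * X ^ m)) * e3

open Polynomial in
lemma exists_Phi15 {E : Type*} [NormedAddCommGroup E] [NormedSpace ℝ E] (v : ℕ → E)
    (T : E →L[ℝ] E)
    (hT : ∀ n, T (v n) = v n + ∑ i ∈ Finset.range n, (n.choose i : ℝ) • v i) :
    ∃ Φ : ℝ[X] →ₗ[ℝ] E, (∀ n, Φ (X ^ n) = v n) ∧ ∀ p, T (Φ p) = Φ (taylor 1 p) := by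
  let Φ : ℝ[X] →ₗ[ℝ] E := (Polynomial.basisMonomials ℝ).constr ℝ v
  have h1 : ∀ n, Φ (X ^ n) = v n := by
    intro n
    have := (Polynomial.basisMonomials ℝ).constr_basis ℝ v n
    simpa only [Polynomial.coe_basisMonomials, monomial_one_right_eq_X_pow] using this
  refine ⟨Φ, h1, ?_⟩
  have h2 : T.toLinearMap ∘ₗ Φ = Φ ∘ₗ (taylor (1 : ℝ)) := by
    refine (Polynomial.basisMonomials ℝ).ext fun n => ?_
    simp only [Polynomial.coe_basisMonomials, monomial_one_right_eq_X_pow, LinearMap.comp_apply,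
      taylor_pow, taylor_X, h1, ContinuousLinearMap.coe_coe, hT, C_1, add_pow, one_pow, mul_one,
      map_sum]
    rw [Finset.sum_range_succ, add_comm]
    have : ∀ i, Φ (X ^ i * (n.choose i : ℝ[X])) = (n.choose i : ℝ) • v i := by
      intro i
      rw [← h1, ← map_smul, smul_eq_C_mul, mul_comm]
      simp
    simp [this, h1]
  intro p
  exact LinearMap.congr_fun h2 p

theorem stmt_15 {X : Type*} [NormedAddCommGroup X] [NormedSpace ℝ X] [CompleteSpace X]
    (hX : ¬ TopologicalSpace.SeparableSpace X)
    (hrefl : Function.Surjective (NormedSpace.inclusionInDoubleDual ℝ X))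
    (Y : Submodule ℝ X) (hYc : IsClosed (Y : Set X))
    (hYs : TopologicalSpace.IsSeparable (Y : Set X)) (hYinf : ¬ FiniteDimensional ℝ Y)
    (lam : ℝ) (hlam : 1 < lam) :
    ∃ T : X →L[ℝ] X, ‖T‖ = lam ∧ (∃ x : X, x ≠ 0 ∧ JSet T x = Set.univ) ∧
      (Y : Set X) ⊆ {x : X | JSet T x = Set.univ} := by
  obtain ⟨Z, P, hZs, hYZ, hPZ, hPid⟩ := exists_proj15 hrefl Y hYs
  have hZinf : ¬ FiniteDimensional ℝ Z := fun h => hYinf (Submodule.finiteDimensional_of_le hYZ)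
  -- a nonzero vector in the complement
  have hex : ∃ x, x - P x ≠ 0 := by
    by_contra! hcon
    apply hX
    have : (Z : Set X) = Set.univ := by
      ext x
      have h1 := sub_eq_zero.1 (hcon x)
      simp only [SetLike.mem_coe, Set.mem_univ, iff_true]
      rw [h1]
      exact hPZ x
    rw [this] at hZs
    exact TopologicalSpace.isSeparable_univ_iff.1 hZs
  obtain ⟨x0, hx0⟩ := hex
  set w0 := x0 - P x0 with hw0
  have hPP : ∀ x, P (P x) = P x := fun x => hPid _ (hPZ x)
  have hPw0 : P w0 = 0 := by simp [hw0, hPP]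
  have hε : 0 < (lam - 1) / 2 / (‖P‖ + 1) := div_pos (by linarith) (by positivity)
  obtain ⟨v, N, hN, hvZ, hNv, hdense⟩ := exists_shift15 Z hZinf hZs _ hε
  let Tm : ℝ → X →L[ℝ] X := fun μ =>
    ContinuousLinearMap.id ℝ X + N.comp P + (μ - 1) • (ContinuousLinearMap.id ℝ X - P)
  have hTm : ∀ μ x, Tm μ x = x + N (P x) + (μ - 1) • (x - P x) := fun μ x => by simp [Tm]
  have hcont : Continuous fun μ => ‖Tm μ‖ := by fun_prop
  have h1 : ‖Tm 1‖ < lam := by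
    have e : Tm 1 = ContinuousLinearMap.id ℝ X + N.comp P := by simp [Tm]
    rw [e]
    refine (norm_add_le _ _).trans_lt ?_
    have a1 := ContinuousLinearMap.norm_id_le (𝕜 := ℝ) (E := X)
    have a2 := N.opNorm_comp_le P
    have a3 : ‖N‖ * ‖P‖ ≤ (lam - 1) / 2 / (‖P‖ + 1) * (‖P‖ + 1) := by
      gcongr
      linarith
    rw [div_mul_cancel₀ _ (by positivity)] at a3
    linarith
  have h2 : lam ≤ ‖Tm lam‖ := by
    have a := (Tm lam).le_opNorm w0
    have e : Tm lam w0 = lam • w0 := by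
      rw [hTm, hPw0]
      simp [sub_smul]
    rw [e, norm_smul, Real.norm_eq_abs, abs_of_pos (by linarith)] at a
    exact le_of_mul_le_mul_right a (norm_pos_iff.2 hx0)
  obtain ⟨μ, hμ, hnorm⟩ := intermediate_value_Icc hlam.le hcont.continuousOn ⟨h1.le, h2⟩
  simp only at hnorm
  have hμ1 : 1 < μ := by
    refine lt_of_le_of_ne hμ.1 ?_
    rintro rfl
    linarith
  have hTv : ∀ n, Tm μ (v n) = v n + ∑ i ∈ Finset.range n, (n.choose i : ℝ) • v i := by
    intro n
    rw [hTm, hPid _ (hvZ n), hNv]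
    simp
  obtain ⟨Φ, hΦ, hΦT⟩ := exists_Phi15 v (Tm μ) hTv
  have hG1 : ∀ z ∈ Z, (z, (0 : X)) ∈ Glim15 (Tm μ) := by
    intro z hz
    have hle : Submodule.span ℝ (Set.range v) ≤
        (Glim15 (Tm μ)).comap (LinearMap.inl ℝ X X) := by
      rw [Submodule.span_le]
      rintro _ ⟨n, rfl⟩
      rw [← hΦ n]
      exact Glim15_left Φ _ hΦT n
    have hc : IsClosed {x : X | (x, (0 : X)) ∈ (Glim15 (Tm μ) : Set (X × X))} :=
      (isClosed_Glim15 (Tm μ)).preimage (by fun_prop)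
    exact closure_minimal (fun x hx => hle hx) hc (hdense hz)
  have hG2 : ∀ z ∈ Z, ((0 : X), z) ∈ Glim15 (Tm μ) := by
    intro z hz
    have hle : Submodule.span ℝ (Set.range v) ≤
        (Glim15 (Tm μ)).comap (LinearMap.inr ℝ X X) := by
      rw [Submodule.span_le]
      rintro _ ⟨n, rfl⟩
      rw [← hΦ n]
      exact Glim15_right Φ _ hΦT n
    have hc : IsClosed {x : X | ((0 : X), x) ∈ (Glim15 (Tm μ) : Set (X × X))} :=
      (isClosed_Glim15 (Tm μ)).preimage (by fun_prop)
    exact closure_minimal (fun x hx => hle hx) hc (hdense hz)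
  have hG3 : ∀ w, P w = 0 → ((0 : X), w) ∈ Glim15 (Tm μ) := by
    intro w hw
    have hpow : ∀ k : ℕ, (Tm μ ^ k) w = μ ^ k • w := by
      intro k
      induction k with
      | zero => simp
      | succ k ih =>
        rw [pow_succ', mul_apply_eq_comp, ih, map_smul, hTm, hw, pow_succ]
        simp [sub_smul, smul_smul]
    have hμ0 : μ ≠ 0 := by positivity
    refine mem_Glim15_of_tendsto (fun k => (μ⁻¹) ^ k • w) ?_ ?_
    · have := (tendsto_pow_atTop_nhds_zero_of_lt_one (r := μ⁻¹) (by positivity)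
        (inv_lt_one_of_one_lt₀ hμ1)).smul_const w
      simpa using this
    · refine tendsto_const_nhds.congr fun k => ?_
      rw [map_smul, hpow, smul_smul, ← mul_pow, inv_mul_cancel₀ hμ0]
      simp
  have hJ : ∀ z ∈ Z, JSet (Tm μ) z = Set.univ := by
    intro z hz
    refine Set.eq_univ_of_forall fun x => mem_JSet_of_Glim15 ?_
    have := (Glim15 (Tm μ)).add_mem (hG1 z hz) ((Glim15 (Tm μ)).add_mem (hG2 (P x) (hPZ x))
      (hG3 (x - P x) (by simp [hPP])))
    simpa using this
  refine ⟨Tm μ, hnorm, ?_, fun y hy => hJ y (hYZ hy)⟩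
  have hYne : Y ≠ ⊥ := by
    rintro rfl
    exact hYinf inferInstance
  obtain ⟨y, hy, hy0⟩ := Submodule.exists_mem_ne_zero_of_ne_bot hYne
  exact ⟨y, hy0, hJ y (hYZ hy)⟩
end

section
/- Let W be an infinite-dimensional separable Banach space and let ε > 0. Then there exists a hypercyclic bounded linear operator T₁ on W of the form T₁ = I + K, where K is a compact operator with ‖K‖ < ε. -/
open Filter Topology

/-- An operator is hypercyclic if some vector has dense orbit. -/
def Hypercyclic {𝕜 Y : Type*} [NontriviallyNormedField 𝕜] [NormedAddCommGroup Y]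
    [NormedSpace 𝕜 Y] (T : Y →L[𝕜] Y) : Prop :=
  ∃ y : Y, Dense (Set.range fun n : ℕ => (T ^ n) y)



noncomputable section

namespace HypPert

variable {W : Type*} [NormedAddCommGroup W] [NormedSpace ℂ W]

/-- Newton type map from functions to vectors. -/
def Phi (K : W →L[ℂ] W) (u : W) (m : ℕ) (g : ℂ → ℂ) : W :=
  ∑ j ∈ Finset.range m, ((fwdDiff (1 : ℂ))^[j] g 0) • (K ^ (m - 1 - j)) u

lemma Phi_step (K : W →L[ℂ] W) (u : W) (m : ℕ) (hu : (K ^ m) u = 0) (g : ℂ → ℂ)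
    (hg : (fwdDiff (1 : ℂ))^[m] g = 0) :
    Phi K u m (fun x => g (x + 1)) = (ContinuousLinearMap.id ℂ W + K) (Phi K u m g) := by
  cases m with
  | zero => simp [Phi]
  | succ m =>
    have h1 : ∀ j, (fwdDiff (1 : ℂ))^[j] (fun x => g (x + 1)) 0
        = (fwdDiff (1 : ℂ))^[j] g 0 + (fwdDiff (1 : ℂ))^[j+1] g 0 := by
      intro j
      rw [fwdDiff_iter_comp_add, Function.iterate_succ_apply']
      simp [fwdDiff]
    have h2 : ∑ j ∈ Finset.range (m+1), ((fwdDiff (1 : ℂ))^[j+1] g 0) • (K ^ (m + 1 - 1 - j)) u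
        = K (Phi K u (m+1) g) := by
      rw [Phi, map_sum, Finset.sum_range_succ, Finset.sum_range_succ', hg]
      have : K ((K ^ m) u) = 0 := by
        rw [pow_succ'] at hu; simpa using hu
      simp only [add_tsub_cancel_right, Pi.zero_apply, zero_smul, add_zero, map_smul, tsub_zero,
        this, smul_zero]
      refine Finset.sum_congr rfl fun j hj => ?_
      have hj' := Finset.mem_range.1 hj
      have : m - j = (m - (j+1)) + 1 := by omega
      rw [this, pow_succ']
      simp
    simp only [add_apply, ContinuousLinearMap.id_apply]
    rw [← h2]
    simp only [Phi, h1, add_smul, Finset.sum_add_distrib]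

lemma Phi_iter (K : W →L[ℂ] W) (u : W) (m : ℕ) (hu : (K ^ m) u = 0) (g : ℂ → ℂ)
    (hg : (fwdDiff (1 : ℂ))^[m] g = 0) (k : ℕ) :
    Phi K u m (fun x => g (x + k)) = ((ContinuousLinearMap.id ℂ W + K) ^ k) (Phi K u m g) := by
  induction k with
  | zero => simp
  | succ k ih =>
    have h : (fwdDiff (1 : ℂ))^[m] (fun x => g (x + k)) = 0 := by
      ext y
      rw [fwdDiff_iter_comp_add, hg]; rfl
    rw [pow_succ', mul_apply_eq_comp, ← ih, ← Phi_step K u m hu _ h]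
    congr 1
    ext x
    push_cast
    ring_nf

lemma Phi_tendsto (K : W →L[ℂ] W) (u : W) (m : ℕ) (g : ℕ → ℂ → ℂ) (g' : ℂ → ℂ)
    (h : ∀ x, Tendsto (fun k => g k x) atTop (𝓝 (g' x))) :
    Tendsto (fun k => Phi K u m (g k)) atTop (𝓝 (Phi K u m g')) := by
  unfold Phi
  refine tendsto_finsetSum _ fun j _ => Tendsto.smul_const ?_ _
  simp only [fwdDiff_iter_eq_sum_shift]
  exact tendsto_finsetSum _ fun i _ => (h _).const_smul _

lemma Phi_zero (K : W →L[ℂ] W) (u : W) (m : ℕ) : Phi K u m (fun _ => 0) = 0 := by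
  simp [Phi, fwdDiff_iter_eq_sum_shift]

lemma lim_aux (p : Polynomial ℂ) (n : ℕ) (hp : p.natDegree < n) (x s : ℂ) :
    Tendsto (fun k : ℕ => p.eval (x + s * k) * (x * (k : ℂ)⁻¹) ^ n) atTop (𝓝 0) := by
  have hinv : Tendsto (fun k : ℕ => (k : ℂ)⁻¹) atTop (𝓝 0) :=
    tendsto_inv_atTop_nhds_zero_nat
  have hmono : ∀ i, i < n → Tendsto (fun k : ℕ => (x + s * k) ^ i * (x * (k : ℂ)⁻¹) ^ n)
      atTop (𝓝 0) := by
    intro i hi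
    have h1 : Tendsto (fun k : ℕ => (x * (k : ℂ)⁻¹ + s) ^ i * x ^ n * ((k : ℂ)⁻¹) ^ (n - i))
        atTop (𝓝 ((x * 0 + s) ^ i * x ^ n * 0 ^ (n - i))) :=
      ((((hinv.const_mul x).add_const s).pow i).mul_const _).mul (hinv.pow _)
    rw [zero_pow (by omega), mul_zero] at h1
    refine h1.congr' ?_
    filter_upwards [eventually_ge_atTop 1] with k hk
    have hk0 : (k : ℂ) ≠ 0 := by exact_mod_cast (by omega : k ≠ 0)
    have e1 : x * (k : ℂ)⁻¹ + s = (x + s * k) * (k : ℂ)⁻¹ := by field_simp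
    have e2 : ((k : ℂ)⁻¹) ^ n = ((k : ℂ)⁻¹) ^ i * ((k : ℂ)⁻¹) ^ (n - i) := by
      rw [← pow_add]; congr 1; omega
    rw [e1, mul_pow, mul_pow, e2]; ring
  have h2 : Tendsto (fun k : ℕ => ∑ i ∈ Finset.range (p.natDegree + 1),
      p.coeff i * ((x + s * k) ^ i * (x * (k : ℂ)⁻¹) ^ n)) atTop
      (𝓝 (∑ i ∈ Finset.range (p.natDegree + 1), p.coeff i * 0)) :=
    tendsto_finsetSum _ fun i hi => (hmono i (by have := Finset.mem_range.1 hi; omega)).const_mul _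
  simp only [mul_zero, Finset.sum_const_zero] at h2
  refine h2.congr fun k => ?_
  rw [Polynomial.eval_eq_sum_range, Finset.sum_mul]
  refine Finset.sum_congr rfl fun i _ => by ring

lemma exists_poly (n : ℕ) : ∃ p : Polynomial ℂ, p.natDegree ≤ n ∧
    ∀ j, (fwdDiff (1 : ℂ))^[j] p.eval 0 = if j = n then 1 else 0 := by
  refine ⟨Polynomial.C ((n.factorial : ℂ)⁻¹) * descPochhammer ℂ n, ?_, ?_⟩
  · refine (Polynomial.natDegree_C_mul_le _ _).trans ?_
    rw [descPochhammer_natDegree]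
  · intro j
    have hz := fwdDiff_iter_choose_zero n j
    rw [fwdDiff_iter_eq_sum_shift] at hz ⊢
    have hz' := congrArg (fun z : ℤ => (z : ℂ)) hz
    have hc : (((if j = n then 1 else 0 : ℤ)) : ℂ) = if j = n then 1 else 0 := by
      simp
    have key : ∀ i : ℕ, (Polynomial.C ((n.factorial : ℂ)⁻¹) * descPochhammer ℂ n).eval
        (0 + i • (1:ℂ)) = (i.choose n : ℂ) := by
      intro i
      have hf : (n.factorial : ℂ) ≠ 0 := by exact_mod_cast n.factorial_ne_zero
      simp [descPochhammer_eval_eq_descFactorial, Nat.descFactorial_eq_factorial_mul_choose, hf]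
    simp only [key]
    rw [← hc, ← hz']
    simp

/-- Vectors that can be reached and escaped from. -/
lemma good (K : W →L[ℂ] W) (u : W) (n : ℕ) (hu : (K ^ (2 * (n+1))) u = 0) :
    (∃ a : ℕ → W, Tendsto a atTop (𝓝 ((K ^ (n+1)) u)) ∧
      Tendsto (fun k => ((ContinuousLinearMap.id ℂ W + K) ^ k) (a k)) atTop (𝓝 0)) ∧
    (∃ b : ℕ → W, Tendsto b atTop (𝓝 0) ∧
      Tendsto (fun k => ((ContinuousLinearMap.id ℂ W + K) ^ k) (b k)) atTop
        (𝓝 ((K ^ (n+1)) u))) := by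
  obtain ⟨p, hpd, hp⟩ := exists_poly n
  have hinv : Tendsto (fun k : ℕ => (k : ℂ)⁻¹) atTop (𝓝 0) :=
    tendsto_inv_atTop_nhds_zero_nat
  have hPhi : Phi K u (2 * (n+1)) p.eval = (K ^ (n+1)) u := by
    unfold Phi
    simp only [hp, ite_smul, one_smul, zero_smul]
    rw [Finset.sum_ite_eq' (Finset.range (2 * (n+1))) n, if_pos (Finset.mem_range.2 (by omega))]
    congr 2; omega
  constructor
  · let q : ℕ → Polynomial ℂ := fun k =>
      p * (1 - Polynomial.C ((k : ℂ)⁻¹) * Polynomial.X) ^ (n+1)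
    have hqd : ∀ k, (q k).natDegree < 2 * (n+1) := by
      intro k
      have h1 : (1 - Polynomial.C ((k : ℂ)⁻¹) * Polynomial.X).natDegree ≤ 1 := by compute_degree
      have h2 := Polynomial.natDegree_pow_le_of_le (n+1) h1
      have h3 := Polynomial.natDegree_mul_le_of_le hpd h2
      change (p * _).natDegree < _
      omega
    refine ⟨fun k => Phi K u (2 * (n+1)) (q k).eval, ?_, ?_⟩
    · rw [← hPhi]
      refine Phi_tendsto _ _ _ _ _ fun x => ?_
      have : Tendsto (fun k : ℕ => p.eval x * (1 - (k : ℂ)⁻¹ * x) ^ (n+1)) atTop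
          (𝓝 (p.eval x * (1 - 0 * x) ^ (n+1))) :=
        (((hinv.mul_const x).const_sub 1).pow _).const_mul _
      simpa [q] using this
    · simp only [← Phi_iter K u _ hu _ (Polynomial.fwdDiff_iter_eq_zero_of_degree_lt (hqd _))]
      rw [← Phi_zero K u (2 * (n+1))]
      refine Phi_tendsto _ _ _ _ _ fun x => ?_
      have h := (lim_aux p (n+1) (by omega) x 1).const_mul ((-1) ^ (n+1))
      rw [mul_zero] at h
      refine h.congr' ?_
      filter_upwards [eventually_ge_atTop 1] with k hk
      have hk0 : (k : ℂ) ≠ 0 := by exact_mod_cast (by omega : k ≠ 0)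
      have : (1 - (k : ℂ)⁻¹ * (x + k)) = (-1) * (x * (k : ℂ)⁻¹) := by field_simp; ring
      simp only [q, Polynomial.eval_mul, Polynomial.eval_pow, Polynomial.eval_sub,
        Polynomial.eval_one, Polynomial.eval_C, Polynomial.eval_X, this, one_mul]
      ring
  · let q : ℕ → Polynomial ℂ := fun k =>
      p.comp (Polynomial.X - Polynomial.C (k : ℂ)) *
        (Polynomial.C ((k : ℂ)⁻¹) * Polynomial.X) ^ (n+1)
    have hqd : ∀ k, (q k).natDegree < 2 * (n+1) := by
      intro k
      have h1 : (Polynomial.C ((k : ℂ)⁻¹) * Polynomial.X).natDegree ≤ 1 := by compute_degree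
      have h2 := Polynomial.natDegree_pow_le_of_le (n+1) h1
      have h0 : (p.comp (Polynomial.X - Polynomial.C (k : ℂ))).natDegree ≤ n := by
        rw [Polynomial.natDegree_comp, Polynomial.natDegree_X_sub_C]; omega
      have h3 := Polynomial.natDegree_mul_le_of_le h0 h2
      change (_ * _ : Polynomial ℂ).natDegree < _
      omega
    refine ⟨fun k => Phi K u (2 * (n+1)) (q k).eval, ?_, ?_⟩
    · rw [← Phi_zero K u (2 * (n+1))]
      refine Phi_tendsto _ _ _ _ _ fun x => ?_
      refine (lim_aux p (n+1) (by omega) x (-1)).congr fun k => ?_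
      simp only [q, Polynomial.eval_mul, Polynomial.eval_pow, Polynomial.eval_comp,
        Polynomial.eval_sub, Polynomial.eval_C, Polynomial.eval_X]
      rw [show x + -1 * (k : ℂ) = x - k by ring, mul_comm x]
    · simp only [← Phi_iter K u _ hu _ (Polynomial.fwdDiff_iter_eq_zero_of_degree_lt (hqd _))]
      rw [← hPhi]
      refine Phi_tendsto _ _ _ _ _ fun x => ?_
      have : Tendsto (fun k : ℕ => p.eval x * (1 + (k : ℂ)⁻¹ * x) ^ (n+1)) atTop
          (𝓝 (p.eval x * (1 + 0 * x) ^ (n+1))) :=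
        (((hinv.mul_const x).const_add 1).pow _).const_mul _
      simp only [zero_mul, add_zero, one_pow, mul_one] at this
      refine this.congr' ?_
      filter_upwards [eventually_ge_atTop 1] with k hk
      have hk0 : (k : ℂ) ≠ 0 := by exact_mod_cast (by omega : k ≠ 0)
      have : (k : ℂ)⁻¹ * (x + k) = 1 + (k : ℂ)⁻¹ * x := by field_simp; ring
      simp [q, Polynomial.eval_comp, this]

/-- Birkhoff transitivity plus density of the good set. -/
lemma hyper [CompleteSpace W] [TopologicalSpace.SeparableSpace W] (K : W →L[ℂ] W)
    (D : Set W) (hD : Dense D)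
    (h : ∀ x ∈ D, ∃ n u, (K ^ (2 * (n+1))) u = 0 ∧ (K ^ (n+1)) u = x) :
    Hypercyclic (ContinuousLinearMap.id ℂ W + K) := by
  set T := ContinuousLinearMap.id ℂ W + K with hT
  have : SecondCountableTopology W := UniformSpace.secondCountable_of_separable W
  let B := TopologicalSpace.countableBasis W
  have hB := TopologicalSpace.isBasis_countableBasis W
  have : Countable B := (TopologicalSpace.countable_countableBasis W).to_subtype
  have hdense : Dense (⋂ V : B, ⋃ k : ℕ, (fun x => (T ^ k) x) ⁻¹' V.1) := by
    refine dense_iInter_of_isOpen (fun V => isOpen_iUnion fun k =>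
      (hB.isOpen V.2).preimage (T ^ k).continuous) fun V => ?_
    rw [dense_iff_inter_open]
    intro U hU hUn
    obtain ⟨x, hxU, hxD⟩ := hD.inter_open_nonempty U hU hUn
    obtain ⟨y, hyV, hyD⟩ := hD.inter_open_nonempty V.1 (hB.isOpen V.2)
      (TopologicalSpace.nonempty_of_mem_countableBasis V.2)
    obtain ⟨n, u, hu, rfl⟩ := h x hxD
    obtain ⟨n', u', hu', rfl⟩ := h y hyD
    obtain ⟨⟨a, ha, ha'⟩, -⟩ := good K u n hu
    obtain ⟨-, ⟨b, hb, hb'⟩⟩ := good K u' n' hu'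
    have h1 := ha.add hb
    have h2 := ha'.add hb'
    rw [add_zero] at h1
    rw [zero_add] at h2
    have e1 := h1.eventually (hU.mem_nhds hxU)
    have e2 := h2.eventually ((hB.isOpen V.2).mem_nhds hyV)
    obtain ⟨k, hk1, hk2⟩ := (e1.and e2).exists
    refine ⟨a k + b k, hk1, Set.mem_iUnion.2 ⟨k, ?_⟩⟩
    change (T ^ k) (a k + b k) ∈ V.1
    rw [map_add]
    exact hk2
  obtain ⟨y, hy⟩ := hdense.nonempty
  refine ⟨y, hB.dense_iff.2 fun V hV _ => ?_⟩
  obtain ⟨k, hk⟩ := Set.mem_iUnion.1 (Set.mem_iInter.1 hy ⟨V, hV⟩)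
  exact ⟨_, hk, ⟨k, rfl⟩⟩

lemma exists_seq [TopologicalSpace.SeparableSpace W] (hW : ¬ FiniteDimensional ℂ W) :
    ∃ x : ℕ → W, LinearIndependent ℂ x ∧ Dense (Submodule.span ℂ (Set.range x) : Set W) := by
  obtain ⟨s, hsc, hsd⟩ := TopologicalSpace.exists_countable_dense W
  obtain ⟨b, hbs, hspan, hli⟩ := exists_linearIndependent ℂ s
  have hd : Dense (Submodule.span ℂ b : Set W) := by
    rw [hspan]; exact hsd.mono Submodule.subset_span
  have hinf : b.Infinite := by
    intro hfin
    have : FiniteDimensional ℂ (Submodule.span ℂ b) := FiniteDimensional.span_of_finite ℂ hfin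
    have hcl : IsClosed (Submodule.span ℂ b : Set W) := Submodule.closed_of_finiteDimensional _
    have htop : Submodule.span ℂ b = ⊤ := by
      rw [← SetLike.coe_set_eq, ← hcl.closure_eq, hd.closure_eq]; rfl
    rw [htop] at this
    exact hW (Module.Finite.equiv Submodule.topEquiv)
  have := hinf.to_subtype
  have := (hsc.mono hbs).to_subtype
  obtain ⟨e⟩ := nonempty_denumerable b
  let f : ℕ ≃ b := (Denumerable.eqv b).symm
  refine ⟨fun n => (f n : W), hli.comp f f.injective, ?_⟩
  have : Set.range (fun n => (f n : W)) = b := by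
    ext w; constructor
    · rintro ⟨n, rfl⟩; exact (f n).2
    · intro hw; exact ⟨f.symm ⟨w, hw⟩, by simp⟩
  rw [this]; exact hd

lemma exists_func (x : ℕ → W) (hx : LinearIndependent ℂ x) (n : ℕ) :
    ∃ g : W →L[ℂ] ℂ, g (x (n+1)) = 1 ∧ ∀ i ≤ n, g (x i) = 0 := by
  let E := Submodule.span ℂ (x '' Set.Iic n)
  have : FiniteDimensional ℂ E := FiniteDimensional.span_of_finite ℂ ((Set.finite_Iic n).image x)
  have : IsClosed (E : Set W) := Submodule.closed_of_finiteDimensional E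
  have hne : (E.mkQL (x (n+1))) ≠ 0 := by
    intro h
    have h' : x (n+1) ∈ E := (Submodule.Quotient.mk_eq_zero E).1 h
    have := hx.notMem_span_image (s := Set.Iic n) (x := n+1) (by simp)
    exact this h'
  have : IsClosed (E : Set W) := Submodule.closed_of_finiteDimensional E
  obtain ⟨f, hf⟩ := SeparatingDual.exists_eq_one (R := ℂ) hne
  refine ⟨f.comp E.mkQL, hf, fun i hi => ?_⟩
  have : E.mkQL (x i) = 0 :=
    (Submodule.Quotient.mk_eq_zero E).2 (Submodule.subset_span ⟨i, hi, rfl⟩)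
  simp [this]

lemma main [CompleteSpace W] [TopologicalSpace.SeparableSpace W]
    (hW : ¬ FiniteDimensional ℂ W) (ε : ℝ) (hε : 0 < ε) :
    ∃ K : W →L[ℂ] W, IsCompactOperator K ∧ ‖K‖ < ε ∧
      Hypercyclic (ContinuousLinearMap.id ℂ W + K) := by
  obtain ⟨x, hx, hxd⟩ := exists_seq hW
  choose g hg1 hg0 using exists_func x hx
  let c : ℕ → ℝ := fun n => (ε / 2 / 2 / 2 ^ n) / (‖g n‖ * ‖x n‖ + 1)
  have hpos : ∀ n, 0 < ‖g n‖ * ‖x n‖ + 1 := fun n => by positivity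
  have hc : ∀ n, 0 < c n := fun n => div_pos (by positivity) (hpos n)
  let F : ℕ → W →L[ℂ] W := fun n => (c n : ℂ) • (g n).smulRight (x n)
  have hF : ∀ n, ‖F n‖ ≤ ε / 2 / 2 / 2 ^ n := by
    intro n
    have h1 : ‖F n‖ = c n * (‖g n‖ * ‖x n‖) := by
      simp only [F]
      rw [norm_smul, ContinuousLinearMap.norm_smulRight_apply, Complex.norm_real,
        Real.norm_of_nonneg (hc n).le]
    have h2 : c n * (‖g n‖ * ‖x n‖ + 1) = ε / 2 / 2 / 2 ^ n :=
      div_mul_cancel₀ _ (hpos n).ne'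
    rw [h1, ← h2]
    have := hc n
    nlinarith
  have hgeo := hasSum_geometric_two' (ε / 2)
  have hsum : Summable F := Summable.of_norm_bounded hgeo.summable hF
  let K : W →L[ℂ] W := ∑' n, F n
  have hKs : HasSum F K := hsum.hasSum
  have hnorm : ‖K‖ ≤ ε / 2 := tsum_of_norm_bounded hgeo hF
  have hcomp : IsCompactOperator K := by
    refine isCompactOperator_of_tendsto hKs (Filter.Eventually.of_forall fun s => ?_)
    have hmem : (∑ b ∈ s, F b) ∈ compactOperator (RingHom.id ℂ) W W := by
      refine Submodule.sum_mem _ fun n _ => ?_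
      have h1 : IsCompactOperator (g n) :=
        isCompactOperator_of_locallyCompactSpace_dom (g n)
      have h2 : IsCompactOperator ((g n).smulRight (x n)) :=
        h1.clm_comp ((ContinuousLinearMap.id ℂ ℂ).smulRight (x n))
      exact h2.smul (c n : ℂ)
    exact hmem
  refine ⟨K, hcomp, by linarith, ?_⟩
  have hFx : ∀ n y, F n y = ((c n : ℂ) * g n y) • x n := by
    intro n y; rw [mul_smul]; rfl
  have hKx : ∀ m, K (x m) = ∑ n ∈ Finset.range m, F n (x m) := by
    intro m
    have h1 : HasSum (fun n => F n (x m)) (K (x m)) :=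
      hKs.mapL (ContinuousLinearMap.apply ℂ W (x m))
    have h2 : HasSum (fun n => F n (x m)) (∑ n ∈ Finset.range m, F n (x m)) := by
      refine hasSum_sum_of_ne_finset_zero fun n hn => ?_
      rw [hFx, hg0 n m (by simpa using hn)]; simp
    exact h1.unique h2
  let E : ℕ → Submodule ℂ W := fun m => Submodule.span ℂ (x '' Set.Iio m)
  have hxE : ∀ i m, i < m → x i ∈ E m := fun i m h => Submodule.subset_span ⟨i, h, rfl⟩
  have hEmono : ∀ {a b}, a ≤ b → E a ≤ E b := fun h =>
    Submodule.span_mono (Set.image_mono (Set.Iio_subset_Iio h))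
  have hFE : ∀ m y, ∑ n ∈ Finset.range m, F n y ∈ E m := by
    intro m y
    refine Submodule.sum_mem _ fun n hn => ?_
    rw [hFx]
    exact Submodule.smul_mem _ _ (hxE _ _ (Finset.mem_range.1 hn))
  have hKE : ∀ m, ∀ w ∈ E (m+1), K w ∈ E m := by
    intro m
    have : E (m+1) ≤ (E m).comap (K : W →ₗ[ℂ] W) := by
      refine Submodule.span_le.2 ?_
      rintro _ ⟨i, hi, rfl⟩
      change K (x i) ∈ E m
      rw [hKx]
      exact hEmono (Nat.lt_succ_iff.1 hi) (hFE _ _)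
    exact fun w hw => this hw
  have hA : ∀ m, ∀ w ∈ E m, (K ^ m) w = 0 := by
    intro m
    induction m with
    | zero => intro w hw; simpa [E] using hw
    | succ m ih =>
      intro w hw
      rw [pow_succ, mul_apply_eq_comp]
      exact ih _ (hKE m w hw)
  have hB : ∀ m, E m ≤ (E (m+1)).map (K : W →ₗ[ℂ] W) := by
    intro m
    induction m with
    | zero => simp [E]
    | succ m ih =>
      have ih' : E m ≤ (E (m+1+1)).map (K : W →ₗ[ℂ] W) :=
        ih.trans (Submodule.map_mono (hEmono (by omega)))
      refine Submodule.span_le.2 ?_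
      rintro _ ⟨i, hi, rfl⟩
      rcases Nat.lt_succ_iff_lt_or_eq.1 hi with h | rfl
      · exact ih' (hxE _ _ h)
      · have h1 := hKx (i+1)
        rw [Finset.sum_range_succ, hFx i, hg1, mul_one] at h1
        have hc0 : (c i : ℂ) ≠ 0 := by exact_mod_cast (hc i).ne'
        have h2 : x i = (c i : ℂ)⁻¹ • (K (x (i+1)) - ∑ n ∈ Finset.range i, F n (x (i+1))) := by
          rw [h1, add_sub_cancel_left, smul_smul, inv_mul_cancel₀ hc0, one_smul]
        rw [SetLike.mem_coe, h2]
        refine Submodule.smul_mem _ _ (Submodule.sub_mem _ ?_ (ih' (hFE _ _)))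
        exact ⟨x (i+1), hxE _ _ (by omega), rfl⟩
  have hC : ∀ n m, ∀ w ∈ E m, ∃ v ∈ E (m+n), (K ^ n) v = w := by
    intro n
    induction n with
    | zero => intro m w hw; exact ⟨w, hw, by simp⟩
    | succ n ih =>
      intro m w hw
      obtain ⟨v, hv, rfl⟩ := hB m hw
      obtain ⟨v', hv', rfl⟩ := ih (m+1) v hv
      refine ⟨v', by rwa [show m + (n+1) = m+1+n by omega], ?_⟩
      rw [pow_succ']; rfl
  refine hyper K _ hxd fun w hw => ?_
  have hex : ∃ n, w ∈ E (n+1) := by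
    induction hw using Submodule.span_induction with
    | mem w h => obtain ⟨i, rfl⟩ := h; exact ⟨i, hxE _ _ (by omega)⟩
    | zero => exact ⟨0, Submodule.zero_mem _⟩
    | add a b _ _ ha hb =>
      obtain ⟨n, hn⟩ := ha
      obtain ⟨m, hm⟩ := hb
      exact ⟨n + m, Submodule.add_mem _ (hEmono (by omega) hn) (hEmono (by omega) hm)⟩
    | smul r a _ ha =>
      obtain ⟨n, hn⟩ := ha
      exact ⟨n, Submodule.smul_mem _ _ hn⟩
  obtain ⟨n, hn⟩ := hex
  obtain ⟨v, hv, hvw⟩ := hC (n+1) (n+1) w hn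
  refine ⟨n, v, hA _ v ?_, hvw⟩
  rwa [two_mul]

end HypPert

end

theorem stmt_19 {W : Type*} [NormedAddCommGroup W] [NormedSpace ℂ W] [CompleteSpace W]
    [TopologicalSpace.SeparableSpace W] (hW : ¬ FiniteDimensional ℂ W)
    (ε : ℝ) (hε : 0 < ε) :
    ∃ K : W →L[ℂ] W, IsCompactOperator K ∧ ‖K‖ < ε ∧
      Hypercyclic (ContinuousLinearMap.id ℂ W + K) := by
  exact HypPert.main hW ε hε
end
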